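/- Let d ≥ 2 and p₀ > p_c(d). There exist β = β(p₀) > 0, Â = Â(p₀) > 0 and B̂ = B̂(p₀) > 0, depending only on p₀ and d, such that for all p ≥ p₀ and all x ∈ ℤ^d, ℙ( β‖x‖₁ ≤ D^{𝒞'_p}(0, x) < +∞ ) ≤ Â exp(−B̂ ‖x‖₁). -/

import Mathlib

open MeasureTheory Filter Topology
open scoped ENNReal

namespace Perco

/-- Vertices of the hypercubic lattice `ℤ^d`. -/
abbrev V (d : ℕ) := Fin d → ℤ

/-- The `ℓ¹` distance on `ℤ^d`. -/
def dist1 {d : ℕ} (x y : V d) : ℕ := ∑ i, (x i - y i).natAbs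

/-- The `ℓ¹` norm, as a real number. -/
def norm1 {d : ℕ} (x : V d) : ℝ := (dist1 x 0 : ℝ)

/-- The `ℓ¹` distance, descended to unordered pairs. -/
def sym2dist1 {d : ℕ} : Sym2 (V d) → ℕ :=
  Sym2.lift ⟨fun x y => dist1 x y, fun x y => by
    unfold dist1
    exact Finset.sum_congr rfl fun i _ => by rw [← Int.natAbs_neg, neg_sub]⟩

/-- Edges of the lattice `(ℤ^d, 𝔼^d)`: unordered pairs of nearest neighbours. -/
def Edge (d : ℕ) : Type := {e : Sym2 (V d) // sym2dist1 e = 1}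

/-- A bond percolation configuration: every edge is open (`true`) or closed (`false`). -/
abbrev Config (d : ℕ) := Edge d → Bool

/-- The unordered pair `e` is an open edge of the configuration `ω`. -/
def openE {d : ℕ} (ω : Config d) (e : Sym2 (V d)) : Prop :=
  ∃ h : sym2dist1 e = 1, ω ⟨e, h⟩ = true

/-- `⟨x, y⟩` is an open edge of the configuration `ω`. -/
def edgeOpen {d : ℕ} (ω : Config d) (x y : V d) : Prop := openE ω s(x, y)

/-- `f 0, f 1, …, f n` is an `ω`-open path (with `n` edges). -/
def IsOpenPath {d : ℕ} (ω : Config d) (n : ℕ) (f : ℕ → V d) : Prop :=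
  ∀ i < n, edgeOpen ω (f i) (f (i + 1))

/-- `f 0, …, f n` is a (not necessarily open) lattice path of `ℤ^d`. -/
def IsLatticePath {d : ℕ} (n : ℕ) (f : ℕ → V d) : Prop :=
  ∀ i < n, dist1 (f i) (f (i + 1)) = 1

/-- The chemical distance between `x` and `y` in the configuration `ω`:
the minimal number of edges of an `ω`-open path from `x` to `y` (`⊤` if there is none). -/
noncomputable def chemDist {d : ℕ} (ω : Config d) (x y : V d) : ℝ≥0∞ :=
  sInf {r : ℝ≥0∞ | ∃ (n : ℕ) (f : ℕ → V d),
    IsOpenPath ω n f ∧ f 0 = x ∧ f n = y ∧ r = (n : ℝ≥0∞)}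

/-- `x` and `y` are connected by an `ω`-open path. -/
def Connected {d : ℕ} (ω : Config d) (x y : V d) : Prop := chemDist ω x y ≠ ⊤

/-- The open cluster of the vertex `x`. -/
def cluster {d : ℕ} (ω : Config d) (x : V d) : Set (V d) := {y | Connected ω x y}

/-- `x` lies in an infinite open cluster. -/
def InInfiniteCluster {d : ℕ} (ω : Config d) (x : V d) : Prop := (cluster ω x).Infinite

open Classical in
/-- The regularized point `x̃`: a point of the infinite cluster minimizing the `ℓ¹`
distance to `x` (with a deterministic rule to break ties); `x` itself if there is none. -/
noncomputable def regPoint {d : ℕ} (ω : Config d) (x : V d) : V d :=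
  if h : ∃ y : V d, InInfiniteCluster ω y ∧
      ∀ z : V d, InInfiniteCluster ω z → dist1 x y ≤ dist1 x z
  then h.choose else x

/-- Real-valued chemical distance (in the configuration `ωdist`) between the
regularizations (w.r.t. the configuration `ωreg`) of `x` and `y`. -/
noncomputable def DReg {d : ℕ} (ωdist ωreg : Config d) (x y : V d) : ℝ :=
  (chemDist ωdist (regPoint ωreg x) (regPoint ωreg y)).toReal

open Classical in
/-- The number of elements of a set, as an element of `ℝ≥0∞` (`⊤` for infinite sets). -/
noncomputable def eSize {α : Type*} (A : Set α) : ℝ≥0∞ :=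
  if h : A.Finite then (h.toFinset.card : ℝ≥0∞) else ⊤

/-!  ### Boxes and renormalization  -/

/-- The box of "radius" `R` centered at `c`: `∏ₖ [c k - R, c k + R)`. -/
def boxC {d : ℕ} (c : V d) (R : ℕ) : Set (V d) :=
  {x | ∀ k, c k - (R : ℤ) ≤ x k ∧ x k < c k + (R : ℤ)}

/-- The center `i(2N+1)` of the `N`-box of macroscopic index `i`. -/
def center {d : ℕ} (N : ℕ) (i : V d) : V d := fun k => i k * (2 * (N : ℤ) + 1)

/-- The `N`-box `B_N(i) = i(2N+1) + [-N, N)^d`. -/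
def macroBox {d : ℕ} (N : ℕ) (i : V d) : Set (V d) := boxC (center N i) N

/-- The enlarged box `B'_N(i) = i(2N+1) + [-3N, 3N)^d`. -/
def macroBox' {d : ℕ} (N : ℕ) (i : V d) : Set (V d) := boxC (center N i) (3 * N)

/-- An open path all of whose vertices stay in the set `S`. -/
def IsOpenPathIn {d : ℕ} (ω : Config d) (S : Set (V d)) (n : ℕ) (f : ℕ → V d) : Prop :=
  IsOpenPath ω n f ∧ ∀ i ≤ n, f i ∈ S

/-- `x` and `y` are connected by an open path inside `S`. -/
def ConnectedIn {d : ℕ} (ω : Config d) (S : Set (V d)) (x y : V d) : Prop :=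
  ∃ (n : ℕ) (f : ℕ → V d), IsOpenPathIn ω S n f ∧ f 0 = x ∧ f n = y

/-- The open cluster of `x` inside the set `S`. -/
def clusterIn {d : ℕ} (ω : Config d) (S : Set (V d)) (x : V d) : Set (V d) :=
  {y | ConnectedIn ω S x y}

/-- `C` is an open cluster of the region `S`. -/
def IsClusterIn {d : ℕ} (ω : Config d) (S : Set (V d)) (C : Set (V d)) : Prop :=
  ∃ x ∈ S, C = clusterIn ω S x

/-- The cluster `C` has diameter at least `m`. -/
def diamGE {d : ℕ} (C : Set (V d)) (m : ℕ) : Prop :=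
  ∃ x ∈ C, ∃ y ∈ C, ∃ k, (m : ℤ) ≤ |x k - y k|

/-- The cluster `C` is crossing for the box `boxC c R`: for each of the `d` directions,
`C ∩ boxC c R` contains an open path connecting the two opposite faces of the box. -/
def CrossingFor {d : ℕ} (ω : Config d) (C : Set (V d)) (c : V d) (R : ℕ) : Prop :=
  ∀ k : Fin d, ∃ (n : ℕ) (f : ℕ → V d), IsOpenPath ω n f ∧
    (∀ m ≤ n, f m ∈ C ∩ boxC c R) ∧ f 0 k = c k - (R : ℤ) ∧ f n k = c k + (R : ℤ) - 1

/-- The `N`-box `B_N(i)` is good (for the configuration `ω`, with parameter `β`):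
(i) there is a unique open cluster `C` of `B'_N(i)` of diameter at least `N`;
(ii) `C` is crossing for each of the `3^d` `N`-boxes included in `B'_N(i)`;
(iii) any two points of `C ∩ B'_N(i)` are at chemical distance at most `12βN`. -/
def IsGoodBox {d : ℕ} (ω : Config d) (N : ℕ) (β : ℝ) (i : V d) : Prop :=
  ∃ C : Set (V d),
    IsClusterIn ω (macroBox' N i) C ∧ diamGE C N ∧
    (∀ C', IsClusterIn ω (macroBox' N i) C' → diamGE C' N → C' = C) ∧
    (∀ j : V d, (∀ k, |j k - i k| ≤ 1) → CrossingFor ω C (center N j) N) ∧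
    (∀ x ∈ macroBox' N i, ∀ y ∈ macroBox' N i, x ∈ C → y ∈ C →
      chemDist ω x y ≤ ENNReal.ofReal (12 * β * N))

/-- `x` belongs to the crossing cluster of the good box `B_N(j)`, i.e. to a cluster of
`B'_N(j)` of diameter at least `N`. -/
def InCrossingCluster {d : ℕ} (ω : Config d) (N : ℕ) (j : V d) (x : V d) : Prop :=
  ∃ C : Set (V d), IsClusterIn ω (macroBox' N j) C ∧ diamGE C N ∧ x ∈ C

/-!  ### Macroscopic site percolation -/

/-- A nearest-neighbour path of macroscopic sites staying in `S`. -/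
def IsSitePathIn {d : ℕ} (S : Set (V d)) (n : ℕ) (f : ℕ → V d) : Prop :=
  (∀ m ≤ n, f m ∈ S) ∧ ∀ m < n, dist1 (f m) (f (m + 1)) = 1

/-- The sites `i` and `j` are connected by a nearest-neighbour path inside `S`. -/
def SiteConnectedIn {d : ℕ} (S : Set (V d)) (i j : V d) : Prop :=
  ∃ (n : ℕ) (f : ℕ → V d), IsSitePathIn S n f ∧ f 0 = i ∧ f n = j

/-- A `*`-path of macroscopic sites staying in `S` (consecutive sites are `*`-neighbours:
their `ℓ^∞` distance is `1`). -/
def IsStarPathIn {d : ℕ} (S : Set (V d)) (n : ℕ) (f : ℕ → V d) : Prop :=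
  (∀ m ≤ n, f m ∈ S) ∧ ∀ m < n, f m ≠ f (m + 1) ∧ ∀ k, |f (m + 1) k - f m k| ≤ 1

/-- The set of good macroscopic sites. -/
def goodSites {d : ℕ} (ω : Config d) (N : ℕ) (β : ℝ) : Set (V d) :=
  {i | IsGoodBox ω N β i}

/-- The macroscopic site `i` belongs to an infinite cluster of good boxes. -/
def InInfiniteGoodCluster {d : ℕ} (ω : Config d) (N : ℕ) (β : ℝ) (i : V d) : Prop :=
  IsGoodBox ω N β i ∧ {j | SiteConnectedIn (goodSites ω N β) i j}.Infinite

/-- The union of the bad connected components (of the macroscopic site percolation)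
meeting the set `Γ`; its size is `Σ_{C ∈ Bad, C ∩ Γ ≠ ∅} |C|`. -/
def badTouching {d : ℕ} (ω : Config d) (N : ℕ) (β : ℝ) (Γ : Set (V d)) : Set (V d) :=
  {j | ∃ i ∈ Γ, i ∉ goodSites ω N β ∧ SiteConnectedIn {k | k ∉ goodSites ω N β} i j}

/-!  ### Edges and sites of a path -/

/-- The set of edges of the path `f 0, …, f n`. -/
def pathEdges {d : ℕ} (n : ℕ) (f : ℕ → V d) : Set (Sym2 (V d)) :=
  {e | ∃ i < n, e = s(f i, f (i + 1))}

/-- The set of vertices of the path `f 0, …, f n`. -/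
def pathVerts {d : ℕ} (n : ℕ) (f : ℕ → V d) : Set (V d) :=
  {v | ∃ i ≤ n, f i = v}

/-- The set of `ω`-closed edges of the path `f 0, …, f n`. -/
def closedEdges {d : ℕ} (ω : Config d) (n : ℕ) (f : ℕ → V d) : Set (Sym2 (V d)) :=
  {e | e ∈ pathEdges n f ∧ ¬ openE ω e}

/-- The set `Γ` of macroscopic sites whose `N`-box is visited by the path `f 0, …, f n`. -/
def visitedSites {d : ℕ} (N : ℕ) (n : ℕ) (f : ℕ → V d) : Set (V d) :=
  {i | ∃ m ≤ n, f m ∈ macroBox N i}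

/-!  ### Probability: i.i.d. Bernoulli bond percolation -/

/-- A family of i.i.d. Bernoulli bond percolation measures on the configurations:
`P p` is a probability measure under which the states of the edges are independent
Bernoulli variables of parameter `p`. -/
structure BernoulliFamily (d : ℕ) where
  P : ℝ → Measure (Config d)
  prob : ∀ p, IsProbabilityMeasure (P p)
  iid : ∀ p, 0 ≤ p → p ≤ 1 → ∀ (s : Finset (Edge d)) (f : Edge d → Bool),
    P p {ω : Config d | ∀ e ∈ s, ω e = f e}
      = ∏ e ∈ s, ENNReal.ofReal (if f e then p else 1 - p)

/-- The critical parameter `p_c(d)` of the family. -/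
noncomputable def pc {d : ℕ} (F : BernoulliFamily d) : ℝ :=
  sInf {p : ℝ | 0 ≤ p ∧ p ≤ 1 ∧ 0 < F.P p {ω : Config d | InInfiniteCluster ω 0}}

/-- `t` is the time constant of the percolation measure `P`: for every `x ∈ ℤ^d`,
`D^{𝒞}(0̃, ñx)/n → t x` almost surely. -/
def ASTimeConstant {d : ℕ} (P : Measure (Config d)) (t : V d → ℝ) : Prop :=
  ∀ x : V d, ∀ᵐ ω ∂P, Tendsto (fun n : ℕ => DReg ω ω 0 (n • x) / n) atTop (𝓝 (t x))

/-!  ### Couplings -/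

/-- Two-stage coupling configurations: each edge carries a pair `(V, Z)` of Booleans. -/
abbrev CConfig (d : ℕ) := Edge d → Bool × Bool

/-- The `q`-configuration of a coupled configuration: `e` is `q`-open iff `V e = 1`. -/
def cfgQ {d : ℕ} (u : CConfig d) : Config d := fun e => (u e).1

/-- The `p`-configuration of a coupled configuration: `e` is `p`-open iff `V e Z e = 1`. -/
def cfgP {d : ℕ} (u : CConfig d) : Config d := fun e => (u e).1 && (u e).2

/-- Two-stage coupling of the `p`- and `q`-percolations: on each edge, independently,
`V` is Bernoulli of parameter `q` and `Z` is an independent Bernoulli of parameter `p/q`. -/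
structure CouplingMeasure (d : ℕ) (p q : ℝ) where
  Q : Measure (CConfig d)
  prob : IsProbabilityMeasure Q
  iid : ∀ (s : Finset (Edge d)) (f : Edge d → Bool × Bool),
    Q {u : CConfig d | ∀ e ∈ s, u e = f e}
      = ∏ e ∈ s,
          (ENNReal.ofReal (if (f e).1 then q else 1 - q) *
            ENNReal.ofReal (if (f e).2 then p / q else 1 - p / q))

/-- Standard coupling: i.i.d. uniform variables on `[0,1]`, one for each edge. -/
structure UniformCoupling (d : ℕ) where
  Q : Measure (Edge d → ℝ)
  prob : IsProbabilityMeasure Q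
  iid : ∀ (s : Finset (Edge d)) (a : Edge d → ℝ), (∀ e ∈ s, 0 ≤ a e ∧ a e ≤ 1) →
    Q {u | ∀ e ∈ s, u e ≤ a e} = ∏ e ∈ s, ENNReal.ofReal (a e)

open Classical in
/-- The `p`-configuration of the standard coupling: `e` is `p`-open iff `U e ≤ p`. -/
noncomputable def cfgAt {d : ℕ} (u : Edge d → ℝ) (p : ℝ) : Config d :=
  fun e => if u e ≤ p then true else false

/-- The critical parameter `p_c(d)` read on the standard coupling. -/
noncomputable def pcU {d : ℕ} (U : UniformCoupling d) : ℝ :=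
  sInf {p : ℝ | 0 ≤ p ∧ p ≤ 1 ∧ 0 < U.Q {u | InInfiniteCluster (cfgAt u p) 0}}

open Classical in
/-- A deterministically chosen geodesic (open path of minimal length) from `x` to `y`
in the configuration `ω` (a trivial constant path if there is none). -/
noncomputable def geod {d : ℕ} (ω : Config d) (x y : V d) : ℕ × (ℕ → V d) :=
  if h : ∃ nf : ℕ × (ℕ → V d), IsOpenPath ω nf.1 nf.2 ∧ nf.2 0 = x ∧ nf.2 nf.1 = y ∧
      (nf.1 : ℝ≥0∞) = chemDist ω x y
  then h.choose else (0, fun _ => x)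

/-!  ### Norms on `ℝ^d` -/

/-- `f` is a norm on the Euclidean space `ℝ^d`. -/
def IsNorm {d : ℕ} (f : EuclideanSpace ℝ (Fin d) → ℝ) : Prop :=
  (∀ x, 0 ≤ f x) ∧ (∀ x, f x = 0 ↔ x = 0) ∧
  (∀ (c : ℝ) (x), f (c • x) = |c| * f x) ∧ ∀ x y, f (x + y) ≤ f x + f y

/-- The canonical embedding of `ℤ^d` into the Euclidean space `ℝ^d`. -/
noncomputable def toEuc {d : ℕ} (x : V d) : EuclideanSpace ℝ (Fin d) :=
  (WithLp.equiv 2 (Fin d → ℝ)).symm fun i => (x i : ℝ)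

/-- Property (1) of the path-modification lemma: the edges of `γ' \ γ` decompose as a
disjoint union of self-avoiding `p`-open paths intersecting `γ' ∩ γ` at their endpoints. -/
def DisjointPathDecomposition {d : ℕ} (ωp : Config d) (n : ℕ) (f : ℕ → V d)
    (n' : ℕ) (g : ℕ → V d) : Prop :=
  ∃ (K : ℕ) (m : ℕ → ℕ) (h : ℕ → ℕ → V d),
    (⋃ j ∈ Finset.range K, pathEdges (m j) (h j)) = pathEdges n' g \ pathEdges n f ∧
    (∀ j < K, IsOpenPath ωp (m j) (h j)) ∧
    (∀ j < K, ∀ a ≤ m j, ∀ b ≤ m j, h j a = h j b → a = b) ∧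
    (∀ j < K, ∀ l < K, j ≠ l → Disjoint (pathEdges (m j) (h j)) (pathEdges (m l) (h l))) ∧
    (∀ j < K, h j 0 ∈ pathVerts n f ∧ h j (m j) ∈ pathVerts n f) ∧
    (∀ j < K, ∀ a, 0 < a → a < m j → h j a ∉ pathVerts n f)

/-- The conclusion of the path-modification lemma, for the constant `ρ`:
any `q`-open path between well-connected points of `𝒞_p` can be turned into a `p`-open
path, the total length of the bypasses being controlled by the bad clusters met and the
number of `p`-closed edges. -/
def BypassProperty (d : ℕ) (ρ : ℕ) : Prop :=
  ∀ (N : ℕ), 1 ≤ N → ∀ (β : ℝ), 1 ≤ β → ∀ (ωp ωq : Config d),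
    (∀ e, ωp e = true → ωq e = true) →
    ∀ y z : V d, InInfiniteCluster ωp y → InInfiniteCluster ωp z →
    (∃ i, y ∈ macroBox N i ∧ InInfiniteGoodCluster ωp N β i) →
    (∃ i, z ∈ macroBox N i ∧ InInfiniteGoodCluster ωp N β i) →
    ∀ (n : ℕ) (f : ℕ → V d), IsOpenPath ωq n f → f 0 = y → f n = z →
    ∃ (n' : ℕ) (g : ℕ → V d), IsOpenPath ωp n' g ∧ g 0 = y ∧ g n' = z ∧
      DisjointPathDecomposition ωp n f n' g ∧
      eSize (pathEdges n' g \ pathEdges n f) ≤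
        ((ρ * N : ℕ) : ℝ≥0∞) *
          (eSize (badTouching ωp N β (visitedSites N n f)) + eSize (closedEdges ωp n f))


/-! ## Part A: product Bernoulli measures -/

/-- The Bernoulli measure on `Bool`. -/
noncomputable def bern (p : unitInterval) : Measure Bool :=
  ENNReal.ofReal p • Measure.dirac true + ENNReal.ofReal (1 - p) • Measure.dirac false

lemma bern_true (p : unitInterval) : bern p {true} = ENNReal.ofReal p := by
  simp [bern]

lemma bern_false (p : unitInterval) : bern p {false} = ENNReal.ofReal (1 - p) := by
  simp [bern]

instance bern_prob (p : unitInterval) : IsProbabilityMeasure (bern p) := by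
  constructor
  have h0 := p.2.1
  have h1 := p.2.2
  simp only [bern, Measure.add_apply, Measure.smul_apply, measure_univ, smul_eq_mul, mul_one]
  rw [← ENNReal.ofReal_add h0 (by linarith)]
  simp

/-- The product Bernoulli measure. -/
noncomputable def mu {ι : Type*} (p : ι → unitInterval) : Measure (ι → Bool) :=
  Measure.infinitePi (fun i => bern (p i))

instance mu_prob {ι : Type*} (p : ι → unitInterval) : IsProbabilityMeasure (mu p) := by
  unfold mu; infer_instance

/-- Probability of an event, as a real number. -/
noncomputable def Pr {ι : Type*} (p : ι → unitInterval) (A : Set (ι → Bool)) : ℝ :=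
  (mu p).real A

/-- The event `A` depends only on the coordinates in `S`. -/
def Dep {ι : Type*} (S : Set ι) (A : Set (ι → Bool)) : Prop :=
  ∀ ω ω' : ι → Bool, (∀ i ∈ S, ω i = ω' i) → ω ∈ A → ω' ∈ A

section basic
variable {ι : Type*} {p : ι → unitInterval} {A B : Set (ι → Bool)} {S T : Set ι}

lemma Dep.iff (h : Dep S A) {ω ω' : ι → Bool} (e : ∀ i ∈ S, ω i = ω' i) : ω ∈ A ↔ ω' ∈ A :=
  ⟨h ω ω' e, h ω' ω fun i hi => (e i hi).symm⟩

lemma Dep.mono (h : Dep S A) (hST : S ⊆ T) : Dep T A :=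
  fun ω ω' e => h ω ω' fun i hi => e i (hST hi)

lemma Dep.compl (h : Dep S A) : Dep S Aᶜ :=
  fun _ _ e hA hB => hA ((h.iff e).2 hB)

lemma Dep.inter (hA : Dep S A) (hB : Dep S B) : Dep S (A ∩ B) :=
  fun ω ω' e h => ⟨hA ω ω' e h.1, hB ω ω' e h.2⟩

lemma Dep.union (hA : Dep S A) (hB : Dep S B) : Dep S (A ∪ B) :=
  fun ω ω' e h => h.imp (hA ω ω' e) (hB ω ω' e)

lemma Dep.iUnion {κ : Sort*} {A : κ → Set (ι → Bool)} (hA : ∀ k, Dep S (A k)) :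
    Dep S (⋃ k, A k) := by
  intro ω ω' e h
  rw [Set.mem_iUnion] at h ⊢
  exact h.imp fun k => hA k ω ω' e

lemma Dep.iInter {κ : Sort*} {A : κ → Set (ι → Bool)} (hA : ∀ k, Dep S (A k)) :
    Dep S (⋂ k, A k) := by
  intro ω ω' e h
  rw [Set.mem_iInter] at h ⊢
  exact fun k => hA k ω ω' e (h k)

lemma Dep.meas (hA : Dep S A) (hS : S.Finite) : MeasurableSet A := by
  have := hS.to_subtype
  have h : A = (fun ω : ι → Bool => fun i : S => ω i) ⁻¹'
      {σ | ∃ ω ∈ A, (fun i : S => ω i) = σ} := by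
    ext ω
    constructor
    · intro h; exact ⟨ω, h, rfl⟩
    · rintro ⟨ω', h, e⟩
      exact hA ω' ω (fun i hi => congrFun e ⟨i, hi⟩) h
  rw [h]
  exact measurable_pi_lambda _ (fun i => measurable_pi_apply _) (Set.toFinite _).measurableSet

lemma Pr_nonneg : 0 ≤ Pr p A := measureReal_nonneg
lemma Pr_le_one : Pr p A ≤ 1 := measureReal_le_one
lemma Pr_mono (h : A ⊆ B) : Pr p A ≤ Pr p B := measureReal_mono h
lemma Pr_univ : Pr p Set.univ = 1 := by simp [Pr]
lemma Pr_empty : Pr p (∅ : Set (ι → Bool)) = 0 := by simp [Pr]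
lemma Pr_compl (h : MeasurableSet A) : Pr p Aᶜ = 1 - Pr p A := by
  unfold Pr; rw [measureReal_compl h]; simp
lemma Pr_union_le : Pr p (A ∪ B) ≤ Pr p A + Pr p B := measureReal_union_le _ _
lemma Pr_biUnion_le {κ : Type*} (s : Finset κ) (A : κ → Set (ι → Bool)) :
    Pr p (⋃ k ∈ s, A k) ≤ ∑ k ∈ s, Pr p (A k) := measureReal_biUnion_finset_le _ _

lemma Pr_biUnion {κ : Type*} (s : Finset κ) (A : κ → Set (ι → Bool))
    (hd : (s : Set κ).PairwiseDisjoint A) (hm : ∀ k ∈ s, MeasurableSet (A k)) :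
    Pr p (⋃ k ∈ s, A k) = ∑ k ∈ s, Pr p (A k) := measureReal_biUnion_finset hd hm

lemma Pr_inter_ge (hB : MeasurableSet B) : Pr p A + Pr p B - 1 ≤ Pr p (A ∩ B) := by
  have h1 : Pr p A ≤ Pr p (A ∩ B) + Pr p Bᶜ := by
    refine (Pr_mono ?_).trans Pr_union_le
    intro x hx
    by_cases h : x ∈ B
    · exact Or.inl ⟨hx, h⟩
    · exact Or.inr h
  rw [Pr_compl hB] at h1
  linarith

lemma Pr_indep (hA : Dep S A) (hB : Dep T B) (hS : S.Finite) (hT : T.Finite)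
    (hd : Disjoint S T) : Pr p (A ∩ B) = Pr p A * Pr p B := by
  classical
  have hi : ProbabilityTheory.iIndepFun (fun i (ω : ι → Bool) => ω i) (mu p) :=
    ProbabilityTheory.iIndepFun_infinitePi (X := fun _ x => x) (fun _ => measurable_id)
  have h2 := hi.indepFun_finset hS.toFinset hT.toFinset
    (by rw [Finset.disjoint_left]; intro a; simp only [Set.Finite.mem_toFinset]
        exact fun h1 h2 => Set.disjoint_left.1 hd h1 h2) (fun i => measurable_pi_apply i)
  have key : ∀ {S : Set ι} (hS : S.Finite) {A : Set (ι → Bool)}, Dep S A →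
      A = (fun (a : ι → Bool) (i : hS.toFinset) => a i) ⁻¹'
        {σ | ∃ ω ∈ A, (fun i : hS.toFinset => ω i) = σ} := by
    intro S hS A hA
    ext ω
    constructor
    · intro h; exact ⟨ω, h, rfl⟩
    · rintro ⟨ω', h, e⟩
      exact hA ω' ω (fun i hi => congrFun e ⟨i, by simpa using hi⟩) h
  rw [key hS hA, key hT hB]
  unfold Pr
  rw [measureReal_def, measureReal_def, measureReal_def, ← ENNReal.toReal_mul]
  congr 1
  exact h2.measure_inter_preimage_eq_mul _ _ (Set.toFinite _).measurableSet
    (Set.toFinite _).measurableSet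

lemma Pr_true (i : ι) : Pr p {ω | ω i = true} = p i := by
  have : {ω : ι → Bool | ω i = true} = (fun ω => ω i) ⁻¹' {true} := by ext; simp
  unfold Pr
  rw [this, measureReal_def, ← Measure.map_apply (measurable_pi_apply i) (by simp)]
  unfold mu
  rw [Measure.infinitePi_map_eval, bern_true, ENNReal.toReal_ofReal (p i).2.1]

lemma Dep_coord (i : ι) (b : Bool) : Dep {i} {ω : ι → Bool | ω i = b} := by
  intro ω ω' e h
  simp only [Set.mem_ofPred_eq] at *
  rw [← e i rfl, h]

lemma Pr_false (i : ι) : Pr p {ω | ω i = false} = 1 - p i := by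
  rw [← Pr_true (p := p) i, ← Pr_compl ((Dep_coord i true).meas (Set.finite_singleton i))]
  congr 1
  ext; simp

lemma Pr_all_true (s : Finset ι) : Pr p {ω | ∀ i ∈ s, ω i = true} = ∏ i ∈ s, (p i : ℝ) := by
  have : {ω : ι → Bool | ∀ i ∈ s, ω i = true} = Set.pi s (fun _ => {true}) := by
    ext; simp [Set.mem_pi]
  unfold Pr
  rw [this, measureReal_def, mu, Measure.infinitePi_pi _ (by simp), ENNReal.toReal_prod]
  refine Finset.prod_congr rfl fun i _ => ?_
  rw [bern_true, ENNReal.toReal_ofReal (p i).2.1]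

lemma Pr_all_false (s : Finset ι) :
    Pr p {ω | ∀ i ∈ s, ω i = false} = ∏ i ∈ s, (1 - p i : ℝ) := by
  have : {ω : ι → Bool | ∀ i ∈ s, ω i = false} = Set.pi s (fun _ => {false}) := by
    ext; simp [Set.mem_pi]
  unfold Pr
  rw [this, measureReal_def, mu, Measure.infinitePi_pi _ (by simp), ENNReal.toReal_prod]
  refine Finset.prod_congr rfl fun i _ => ?_
  rw [bern_false, ENNReal.toReal_ofReal (by linarith [(p i).2.2])]

lemma Dep_all (s : Finset ι) (b : Bool) : Dep (s : Set ι) {ω : ι → Bool | ∀ i ∈ s, ω i = b} := by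
  intro ω ω' e h i hi
  rw [← e i hi, h i hi]

/-- coordinate `a` forced to `b`. -/
def force [DecidableEq ι] (a : ι) (b : Bool) (A : Set (ι → Bool)) : Set (ι → Bool) :=
  {ω | Function.update ω a b ∈ A}

lemma Dep.force [DecidableEq ι] {a : ι} (h : Dep (insert a S) A) (b : Bool) :
    Dep S (force a b A) := by
  intro ω ω' e hω
  refine h _ _ ?_ hω
  intro i hi
  by_cases hia : i = a
  · subst hia; simp
  · simp only [Function.update_of_ne hia]
    exact e i (hi.resolve_left hia)

lemma upper_force [DecidableEq ι] {a : ι} (h : IsUpperSet A) (b : Bool) :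
    IsUpperSet (force a b A) := by
  intro ω ω' e hω
  refine h ?_ hω
  exact update_le_update_iff.2 ⟨le_rfl, fun i _ => e i⟩

lemma force_mono [DecidableEq ι] {a : ι} (h : IsUpperSet A) :
    force a false A ⊆ force a true A := by
  intro ω hω
  refine h ?_ hω
  exact update_le_update_iff.2 ⟨Bool.false_le _, fun i _ => le_rfl⟩

/-- Conditioning on one coordinate. -/
lemma Pr_cond [DecidableEq ι] {a : ι} (ha : a ∉ S) (hS : S.Finite) (h : Dep (insert a S) A) :
    Pr p A = p a * Pr p (force a true A) + (1 - p a) * Pr p (force a false A) := by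
  have e : A = ({ω | ω a = true} ∩ force a true A) ∪ ({ω | ω a = false} ∩ force a false A) := by
    ext ω
    simp only [Set.mem_union, Set.mem_inter_iff, Set.mem_ofPred_eq, force]
    cases hb : ω a
    · simp only [Bool.false_eq_true, false_and, true_and, false_or]
      rw [← hb, Function.update_eq_self]
    · simp only [Bool.true_eq_false, false_and, true_and, or_false]
      rw [← hb, Function.update_eq_self]
  have hd : Disjoint {a} S := by simpa using ha
  have h1 := Pr_indep (p := p) (Dep_coord a true) (h.force true) (Set.finite_singleton a) hS hd
  have h2 := Pr_indep (p := p) (Dep_coord a false) (h.force false) (Set.finite_singleton a) hS hd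
  rw [Pr_true] at h1
  rw [Pr_false] at h2
  rw [← h1, ← h2]
  conv_lhs => rw [e]
  unfold Pr
  refine measureReal_union ?_ ?_
  · rw [Set.disjoint_left]
    rintro ω ⟨h1, _⟩ ⟨h2, _⟩
    simp only [Set.mem_ofPred_eq] at h1 h2
    rw [h1] at h2; cases h2
  · exact ((Dep_coord a false).meas (Set.finite_singleton a)).inter ((h.force false).meas hS)

lemma Dep.empty_cases (h : Dep (∅ : Set ι) A) : A = ∅ ∨ A = Set.univ := by
  by_cases hA : A.Nonempty
  · right
    obtain ⟨ω, hω⟩ := hA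
    ext ω'
    simp only [Set.mem_univ, iff_true]
    exact h ω ω' (by simp) hω
  · left
    exact Set.not_nonempty_iff_eq_empty.1 hA

/-- FKG inequality for events depending on finitely many coordinates. -/
lemma fkg_up (hA : Dep S A) (hB : Dep S B) (hS : S.Finite) (uA : IsUpperSet A)
    (uB : IsUpperSet B) : Pr p A * Pr p B ≤ Pr p (A ∩ B) := by
  classical
  induction S, hS using Set.Finite.induction_on generalizing A B with
  | empty =>
    rcases hA.empty_cases with rfl | rfl <;> rcases hB.empty_cases with rfl | rfl <;>
      simp [Pr_univ, Pr_empty]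
  | @insert a S ha hS ih =>
    have i1 := ih (hA.force true) (hB.force true) (upper_force uA _) (upper_force uB _)
    have i0 := ih (hA.force false) (hB.force false) (upper_force uA _) (upper_force uB _)
    rw [Pr_cond ha hS hA, Pr_cond ha hS hB, Pr_cond ha hS (hA.inter hB)]
    have mA := Pr_mono (p := p) (force_mono (a := a) uA)
    have mB := Pr_mono (p := p) (force_mono (a := a) uB)
    have q0 := (p a).2.1
    have q1 := (p a).2.2
    set q : ℝ := (p a : ℝ)
    have e1 : force a true (A ∩ B) = force a true A ∩ force a true B := rfl
    have e0 : force a false (A ∩ B) = force a false A ∩ force a false B := rfl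
    rw [e1, e0]
    have k1 := mul_le_mul_of_nonneg_left i1 q0
    have k0 := mul_le_mul_of_nonneg_left i0 (sub_nonneg.2 q1)
    have k2 : 0 ≤ q * (1 - q) * ((Pr p (force a true A) - Pr p (force a false A)) *
      (Pr p (force a true B) - Pr p (force a false B))) :=
      mul_nonneg (mul_nonneg q0 (sub_nonneg.2 q1)) (mul_nonneg (sub_nonneg.2 mA) (sub_nonneg.2 mB))
    nlinarith

/-- Monotonicity in the parameters. -/
lemma Pr_mono_p {p' : ι → unitInterval} (hp : ∀ i ∈ S, p i ≤ p' i) (hA : Dep S A) (hS : S.Finite)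
    (uA : IsUpperSet A) : Pr p A ≤ Pr p' A := by
  classical
  induction S, hS using Set.Finite.induction_on generalizing A with
  | empty =>
    rcases hA.empty_cases with rfl | rfl <;> simp [Pr_univ, Pr_empty]
  | @insert a S ha hS ih =>
    have i1 := ih (fun i hi => hp i (Or.inr hi)) (hA.force true) (upper_force uA _)
    have i0 := ih (fun i hi => hp i (Or.inr hi)) (hA.force false) (upper_force uA _)
    rw [Pr_cond ha hS hA, Pr_cond ha hS hA]
    have mA := Pr_mono (p := p') (force_mono (a := a) uA)
    have q0 := (p a).2.1
    have q1 := (p a).2.2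
    have h : (p a : ℝ) ≤ p' a := hp a (Or.inl rfl)
    nlinarith [mul_le_mul_of_nonneg_left i1 q0, mul_le_mul_of_nonneg_left i0 (sub_nonneg.2 q1),
      mul_nonneg (sub_nonneg.2 h) (sub_nonneg.2 mA)]

/-- Continuity in the parameter. -/
lemma Pr_continuous (hA : Dep S A) (hS : S.Finite) :
    Continuous (fun q : unitInterval => Pr (fun _ : ι => q) A) := by
  classical
  induction S, hS using Set.Finite.induction_on generalizing A with
  | empty =>
    rcases hA.empty_cases with rfl | rfl
    · simp only [Pr_empty]; exact continuous_const
    · simp only [Pr_univ]; exact continuous_const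
  | @insert a S ha hS ih =>
    have i1 := ih (hA.force true)
    have i0 := ih (hA.force false)
    have e : (fun q : unitInterval => Pr (fun _ : ι => q) A) = fun q : unitInterval =>
      (q : ℝ) * Pr (fun _ : ι => q) (force a true A)
        + (1 - (q : ℝ)) * Pr (fun _ : ι => q) (force a false A) := by
      funext q
      exact Pr_cond (p := fun _ : ι => q) ha hS hA
    rw [e]
    fun_prop

/-- Pull-back along an injection of the index sets. -/
lemma Pr_comap {κ : Type*} {f : κ → ι} (hf : Function.Injective f) {A : Set (κ → Bool)}
    (hA : MeasurableSet A) : Pr p {ω | (fun k => ω (f k)) ∈ A} = Pr (fun k => p (f k)) A := by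
  have h := Measure.map_infinitePi_infinitePi_of_inj (P := fun i => bern (p i)) hf
  unfold Pr
  have e : mu (fun k => p (f k)) = (mu p).map (fun ω k => ω (f k)) := h.symm
  rw [e, measureReal_def, measureReal_def, Measure.map_apply _ hA]
  · rfl
  · exact measurable_pi_lambda _ fun k => measurable_pi_apply _

end basic

/-- the `OR` over layers. -/
noncomputable def orL {ι Λ : Type*} (ω : ι × Λ → Bool) : ι → Bool :=
  fun i => @decide (∃ l, ω (i, l) = true) (Classical.dec _)

/-- If the layered parameters combine to at most `P`, the `OR` configuration is dominated. -/
lemma Pr_or {ι Λ : Type*} [Fintype Λ] {p : ι × Λ → unitInterval} {P : ι → unitInterval}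
    {S : Set ι} (hp : ∀ i ∈ S, (1 - P i : ℝ) ≤ ∏ l, (1 - p (i, l) : ℝ)) {A : Set (ι → Bool)}
    (hA : Dep S A) (hS : S.Finite) (uA : IsUpperSet A) :
    Pr p {ω | orL ω ∈ A} ≤ Pr P A := by
  classical
  have depOr : ∀ {S : Set ι} {A : Set (ι → Bool)}, Dep S A →
      Dep (S ×ˢ (Set.univ : Set Λ)) {ω : ι × Λ → Bool | orL ω ∈ A} := by
    intro S A hA ω ω' e h
    refine hA _ _ (fun i hi => ?_) h
    unfold orL
    congr 1
    ext
    refine exists_congr fun l => ?_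
    rw [e (i, l) ⟨hi, trivial⟩]
  induction S, hS using Set.Finite.induction_on generalizing A with
  | empty =>
    rcases hA.empty_cases with rfl | rfl
    · simp [Pr_empty]
    · simp [Pr_univ]
  | @insert a S ha hS ih =>
    have i1 := ih (fun i hi => hp i (Or.inr hi)) (hA.force true) (upper_force uA _)
    have i0 := ih (fun i hi => hp i (Or.inr hi)) (hA.force false) (upper_force uA _)
    rw [Pr_cond ha hS hA]
    set Z : Finset (ι × Λ) := Finset.univ.image (fun l : Λ => (a, l)) with hZ
    set C : Set (ι × Λ → Bool) := {ω | ∀ i ∈ Z, ω i = false} with hC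
    have dC : Dep (Z : Set (ι × Λ)) C := Dep_all Z false
    have mC : MeasurableSet C := dC.meas Z.finite_toSet
    have pC : Pr p C = ∏ l, (1 - p (a, l) : ℝ) := by
      rw [hC, Pr_all_false, hZ, Finset.prod_image]
      intro x _ y _ h
      exact (Prod.mk.inj h).2
    have hdis : Disjoint (Z : Set (ι × Λ)) (S ×ˢ (Set.univ : Set Λ)) := by
      rw [Set.disjoint_left]
      rintro ⟨i, l⟩ h1 h2
      simp only [hZ, Finset.coe_image, Finset.coe_univ, Set.image_univ, Set.mem_range,
        Prod.mk.injEq] at h1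
      obtain ⟨y, rfl, _⟩ := h1
      exact ha h2.1
    have hSf : (S ×ˢ (Set.univ : Set Λ)).Finite := hS.prod Set.finite_univ
    have s1 := Pr_indep (p := p) dC.compl (depOr (hA.force true)) Z.finite_toSet hSf hdis
    have s0 := Pr_indep (p := p) dC (depOr (hA.force false)) Z.finite_toSet hSf hdis
    have e : {ω | orL ω ∈ A} ⊆ (Cᶜ ∩ {ω : ι × Λ → Bool | orL ω ∈ force a true A}) ∪
        (C ∩ {ω | orL ω ∈ force a false A}) := by
      intro ω hω
      have hb : ω ∈ C ↔ orL ω a = false := by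
        simp [hC, hZ, orL]
      by_cases h : ω ∈ C
      · refine Or.inr ⟨h, ?_⟩
        change Function.update (orL ω) a false ∈ A
        rw [← hb.1 h, Function.update_eq_self]
        exact hω
      · refine Or.inl ⟨h, ?_⟩
        change Function.update (orL ω) a true ∈ A
        have : orL ω a = true := by
          rw [hb] at h; simpa using h
        rw [← this, Function.update_eq_self]
        exact hω
    have h1 := (Pr_mono (p := p) e).trans Pr_union_le
    rw [s1, s0, Pr_compl mC, pC] at h1
    have mA := Pr_mono (p := P) (force_mono (a := a) uA)
    have hpa := hp a (Or.inl rfl)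
    have hle : ∏ l, (1 - p (a, l) : ℝ) ≤ 1 :=
      Finset.prod_le_one (fun l _ => sub_nonneg.2 (p (a, l)).2.2)
        (fun l _ => by linarith [(p (a, l)).2.1])
    have hge : 0 ≤ ∏ l, (1 - p (a, l) : ℝ) :=
      Finset.prod_nonneg (fun l _ => sub_nonneg.2 (p (a, l)).2.2)
    refine h1.trans ?_
    nlinarith [mul_le_mul_of_nonneg_left i1 (sub_nonneg.2 hle), mul_le_mul_of_nonneg_left i0 hge,
      mul_nonneg (sub_nonneg.2 hpa) (sub_nonneg.2 mA)]

/-- Exploration lemma: sum over the disjoint outcomes `G k` of an exploration. -/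
lemma Pr_explore {ι κ : Type*} {p : ι → unitInterval} (I : Finset κ) (G B : κ → Set (ι → Bool))
    (S T : κ → Set ι) (hG : ∀ k ∈ I, Dep (S k) (G k)) (hB : ∀ k ∈ I, Dep (T k) (B k))
    (hS : ∀ k ∈ I, (S k).Finite) (hT : ∀ k ∈ I, (T k).Finite)
    (hST : ∀ k ∈ I, Disjoint (S k) (T k)) (hd : (I : Set κ).PairwiseDisjoint G)
    (A : Set (ι → Bool)) (hA : ∀ k ∈ I, G k ∩ B k ⊆ A) (c : κ → ℝ)
    (hc : ∀ k ∈ I, c k ≤ Pr p (B k)) : ∑ k ∈ I, Pr p (G k) * c k ≤ Pr p A := by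
  calc ∑ k ∈ I, Pr p (G k) * c k ≤ ∑ k ∈ I, Pr p (G k ∩ B k) := by
        refine Finset.sum_le_sum fun k hk => ?_
        rw [Pr_indep (hG k hk) (hB k hk) (hS k hk) (hT k hk) (hST k hk)]
        exact mul_le_mul_of_nonneg_left (hc k hk) Pr_nonneg
    _ = Pr p (⋃ k ∈ I, G k ∩ B k) := by
        rw [Pr_biUnion]
        · exact hd.mono fun k => Set.inter_subset_left
        · intro k hk
          exact ((hG k hk).meas (hS k hk)).inter ((hB k hk).meas (hT k hk))
    _ ≤ Pr p A := Pr_mono (by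
        intro ω hω
        simp only [Set.mem_iUnion] at hω
        obtain ⟨k, hk, h⟩ := hω
        exact hA k hk h)

/-- Agreement of the given family with the product measure. -/
lemma family_eq {d : ℕ} (F : BernoulliFamily d) (p : unitInterval) :
    F.P p = mu (fun _ : Edge d => p) := by
  have := F.prob p
  refine (Measure.isProjectiveLimit_infinitePi (fun _ : Edge d => bern p)).unique ?_ |>.symm
  intro s
  refine Measure.ext_of_singleton fun σ => ?_
  classical
  rw [Measure.map_apply (by fun_prop) (MeasurableSet.singleton σ), ← Set.univ_pi_singleton σ,
    Measure.pi_pi]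
  have h := F.iid p p.2.1 p.2.2 s (fun e => if h : e ∈ s then σ ⟨e, h⟩ else false)
  have e1 : s.restrict ⁻¹' (Set.univ.pi fun i : s => ({σ i} : Set Bool)) =
      {ω : Config d | ∀ e ∈ s, ω e = if h : e ∈ s then σ ⟨e, h⟩ else false} := by
    ext ω
    simp only [Set.mem_preimage, Set.mem_pi, Set.mem_univ, Set.mem_singleton_iff, forall_const,
      Set.mem_ofPred_eq, Finset.restrict, Subtype.forall]
    refine forall_congr' fun e => forall_congr' fun he => ?_
    simp [he]
  rw [e1, h, ← Finset.prod_attach]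
  refine Finset.prod_congr rfl fun i _ => ?_
  simp only [i.2, dif_pos]
  cases σ i
  · simp [bern_false]
  · simp [bern_true]

/-! ## Part B: connections, boxes, and the first crossing estimates -/

/-- Connection by `O`-steps inside `D`. -/
def conn {α : Type*} (O : α → α → Prop) (D : Set α) : α → α → Prop :=
  Relation.ReflTransGen (fun a b => a ∈ D ∧ b ∈ D ∧ O a b)

/-- `X` is connected to `T` inside `D`. -/
def hit {α : Type*} (O : α → α → Prop) (D X T : Set α) : Prop :=
  ∃ x ∈ X, ∃ y ∈ T, conn O D x y

section conn
variable {α : Type*} {O O' : α → α → Prop} {D D' X T S : Set α} {x y z : α}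

lemma conn.refl : conn O D x x := Relation.ReflTransGen.refl

lemma conn.trans (h : conn O D x y) (h' : conn O D y z) : conn O D x z :=
  Relation.ReflTransGen.trans h h'

lemma conn.single (h : O x y) (hx : x ∈ D) (hy : y ∈ D) : conn O D x y :=
  Relation.ReflTransGen.single ⟨hx, hy, h⟩

lemma conn.mono (h : conn O D x y) (hO : ∀ a ∈ D, ∀ b ∈ D, O a b → O' a b) (hD : D ⊆ D') :
    conn O' D' x y :=
  Relation.ReflTransGen.mono (p := fun a b => a ∈ D' ∧ b ∈ D' ∧ O' a b)
    (fun a b h => ⟨hD h.1, hD h.2.1, hO a h.1 b h.2.1 h.2.2⟩) _ _ h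

lemma conn.mono_set (h : conn O D x y) (hD : D ⊆ D') : conn O D' x y :=
  h.mono (fun _ _ _ _ h => h) hD

lemma conn.symm (h : conn O D x y) (hO : ∀ a b, O a b → O b a) : conn O D y x := by
  induction h with
  | refl => exact conn.refl
  | @tail b c _ h ih => exact (conn.single (hO _ _ h.2.2) h.2.1 h.1).trans ih

lemma conn.mem (h : conn O D x y) (hx : x ∈ D) : y ∈ D := by
  induction h with
  | refl => exact hx
  | tail _ h _ => exact h.2.1

lemma conn.mem_left (h : conn O D x y) (hy : y ∈ D) : x ∈ D := by
  induction h using Relation.ReflTransGen.head_induction_on with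
  | refl => exact hy
  | head h _ _ => exact h.1

/-- First exit from `S`. -/
lemma conn.exit (h : conn O D x y) (hx : x ∈ S) (hy : y ∉ S) :
    ∃ a b, conn O (D ∩ S) x a ∧ a ∈ S ∧ b ∉ S ∧ a ∈ D ∧ b ∈ D ∧ O a b ∧ conn O D b y := by
  induction h using Relation.ReflTransGen.head_induction_on with
  | refl => exact absurd hx hy
  | @head a c h h' ih =>
    by_cases hc : c ∈ S
    · obtain ⟨a', b', h1, h2⟩ := ih hc
      exact ⟨a', b', (conn.single (D := D ∩ S) h.2.2 ⟨h.1, hx⟩ ⟨h.2.1, hc⟩).trans h1, h2⟩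
    · exact ⟨a, c, conn.refl, hx, hc, h.1, h.2.1, h.2.2, h'⟩

/-- A set closed under steps contains everything reachable. -/
lemma conn.closed (h : conn O D x y) (hx : x ∈ S)
    (hS : ∀ a b, a ∈ S → a ∈ D → b ∈ D → O a b → b ∈ S) : y ∈ S := by
  induction h with
  | refl => exact hx
  | tail _ h ih => exact hS _ _ ih h.1 h.2.1 h.2.2

/-- the path lives in its own reachable set. -/
lemma conn.self (h : conn O D x y) :
    conn O {v | v ∈ D ∧ conn O D x v} x y := by
  induction h with
  | refl => exact conn.refl
  | @tail b c hb h ih =>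
    exact ih.trans (conn.single h.2.2 ⟨h.1, hb⟩ ⟨h.2.1, hb.tail h⟩)

lemma hit.mono (h : hit O D X T) {X' T' : Set α} (hO : ∀ a ∈ D, ∀ b ∈ D, O a b → O' a b)
    (hD : D ⊆ D') (hX : X ⊆ X') (hT : T ⊆ T') : hit O' D' X' T' := by
  obtain ⟨x, hx, y, hy, h⟩ := h
  exact ⟨x, hX hx, y, hT hy, h.mono hO hD⟩

end conn

variable {d : ℕ}

/-- Lattice adjacency. -/
def adj (a b : V d) : Prop := dist1 a b = 1

lemma dist1_comm (a b : V d) : dist1 a b = dist1 b a := by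
  unfold dist1
  exact Finset.sum_congr rfl fun i _ => by rw [← Int.natAbs_neg, neg_sub]

lemma adj.symm {a b : V d} (h : adj a b) : adj b a := by
  unfold adj at *; rw [dist1_comm]; exact h

/-- Lattice neighbours differ by one in a single coordinate. -/
lemma adj_iff {a b : V d} :
    adj a b ↔ ∃ i, |b i - a i| = 1 ∧ ∀ j, j ≠ i → b j = a j := by
  unfold adj dist1
  constructor
  · intro h
    have : ∃ i, (a i - b i).natAbs ≠ 0 := by
      by_contra hc
      push Not at hc
      rw [Finset.sum_eq_zero (fun i _ => hc i)] at h
      omega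
    obtain ⟨i, hi⟩ := this
    rw [← Finset.add_sum_erase _ _ (Finset.mem_univ i)] at h
    refine ⟨i, by rw [Int.abs_eq_natAbs]; omega, fun j hj => ?_⟩
    have h2 : ∑ x ∈ Finset.univ.erase i, (a x - b x).natAbs = 0 := by omega
    rw [Finset.sum_eq_zero_iff] at h2
    have := h2 j (by simp [hj])
    omega
  · rintro ⟨i, h1, h2⟩
    rw [Int.abs_eq_natAbs] at h1
    rw [Finset.sum_eq_single i]
    · omega
    · intro j _ hj
      rw [h2 j hj]; simp
    · simp

lemma adj.abs_le {a b : V d} (h : adj a b) (i : Fin d) : |b i - a i| ≤ 1 := by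
  obtain ⟨j, h1, h2⟩ := adj_iff.1 h
  by_cases hij : i = j
  · subst hij; exact h1.le
  · rw [h2 i hij]; simp

lemma adj_translate {a b c : V d} : adj (a + c) (b + c) ↔ adj a b := by
  unfold adj dist1
  simp

/-- Open lattice edge. -/
def op (ω : Sym2 (V d) → Bool) (a b : V d) : Prop := adj a b ∧ ω s(a, b) = true

lemma op.symm {ω : Sym2 (V d) → Bool} (a b : V d) (h : op ω a b) : op ω b a :=
  ⟨h.1.symm, by rw [Sym2.eq_swap]; exact h.2⟩

/-- sup-norm box. -/
def bx (c : V d) (r : ℤ) : Set (V d) := {v | ∀ i, |v i - c i| ≤ r}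

lemma bx_finite (c : V d) (r : ℤ) : (bx c r).Finite := by
  refine (Set.finite_Icc (fun i => c i - r) (fun i => c i + r)).subset ?_
  intro v hv
  constructor
  · intro i; have := abs_le.1 (hv i); simp only; linarith
  · intro i; have := abs_le.1 (hv i); simp only; linarith

lemma bx_mono {c : V d} {r s : ℤ} (h : r ≤ s) : bx c r ⊆ bx c s := fun _ hv i => (hv i).trans h

lemma bx_sub {c c' : V d} {r s : ℤ} (h : ∀ i, |c i - c' i| + r ≤ s) : bx c r ⊆ bx c' s := by
  intro v hv i
  have := abs_add_le (v i - c i) (c i - c' i)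
  have e : v i - c i + (c i - c' i) = v i - c' i := by ring
  rw [e] at this
  linarith [hv i, h i]

lemma self_mem_bx {c : V d} {r : ℤ} (h : 0 ≤ r) : c ∈ bx c r := fun i => by simpa using h

/-- sphere of the sup norm. -/
def sph (c : V d) (r : ℤ) : Set (V d) := {v | v ∈ bx c r ∧ ∃ i, |v i - c i| = r}

/-- A path leaving the box crosses every sphere. -/
lemma conn.sphere {O : V d → V d → Prop} (hO : ∀ a b, O a b → adj a b) {D : Set (V d)} {x y c : V d}
    {m : ℤ} (h : conn O D x y) (hx : x ∈ bx c m) (hy : y ∉ bx c (m - 1)) :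
    ∃ v ∈ sph c m, conn O (D ∩ bx c m) x v := by
  by_cases hx' : x ∈ bx c (m - 1)
  · obtain ⟨a, b, h1, h2, h3, h4, h5, h6, -⟩ := h.exit hx' hy
    have hb : b ∈ bx c m := by
      intro i
      have e1 := (hO a b h6).abs_le i
      have e2 := h2 i
      rw [abs_le] at *
      omega
    refine ⟨b, ⟨hb, ?_⟩, ?_⟩
    · simp only [bx, Set.mem_ofPred_eq, not_forall, not_le] at h3
      obtain ⟨i, hi⟩ := h3
      exact ⟨i, le_antisymm (hb i) (by omega)⟩
    · refine (h1.mono_set ?_).trans (conn.single h6 ⟨h4, bx_mono (by omega) h2⟩ ⟨h5, hb⟩)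
      exact Set.inter_subset_inter_right _ (bx_mono (by omega))
  · simp only [bx, Set.mem_ofPred_eq, not_forall, not_le] at hx'
    obtain ⟨i, hi⟩ := hx'
    exact ⟨x, ⟨hx, i, le_antisymm (hx i) (by omega)⟩, conn.refl⟩

/-- Edges inside `D`. -/
def ED (D : Set (V d)) : Set (Sym2 (V d)) := {e | ∀ v ∈ e, v ∈ D}

lemma mem_ED {D : Set (V d)} {a b : V d} : s(a, b) ∈ ED D ↔ a ∈ D ∧ b ∈ D := by
  simp [ED]

lemma ED_finite {D : Set (V d)} (h : D.Finite) : (ED D).Finite := by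
  refine ((h.prod h).image (fun x : V d × V d => s(x.1, x.2))).subset ?_
  intro e
  induction e using Sym2.ind with
  | _ a b =>
    intro he
    exact ⟨(a, b), mem_ED.1 he, rfl⟩

/-- The event that `X` is connected to `T` inside `D`. -/
def hitE (D X T : Set (V d)) : Set (Sym2 (V d) → Bool) := {ω | hit (op ω) D X T}

lemma hitE_dep (D X T : Set (V d)) : Dep (ED D) (hitE D X T) := by
  intro ω ω' e h
  refine h.mono (fun a ha b hb hab => ⟨hab.1, ?_⟩) le_rfl le_rfl le_rfl
  rw [← e _ (mem_ED.2 ⟨ha, hb⟩)]; exact hab.2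

lemma op_mono {ω ω' : Sym2 (V d) → Bool} (h : ω ≤ ω') {a b : V d} (hab : op ω a b) : op ω' a b :=
  ⟨hab.1, by have := h s(a, b); rw [hab.2] at this; exact top_unique this⟩

lemma hitE_upper (D X T : Set (V d)) : IsUpperSet (hitE D X T) := by
  intro ω ω' h hω
  exact hω.mono (fun a ha b hb hab => op_mono h hab) le_rfl le_rfl le_rfl

lemma hitE_mono {D X T D' X' T' : Set (V d)} (hD : D ⊆ D') (hX : X ⊆ X') (hT : T ⊆ T') :
    hitE D X T ⊆ hitE D' X' T' := fun _ h => h.mono (fun _ _ _ _ h => h) hD hX hT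

/-- Probability in the homogeneous edge model. -/
noncomputable def Pq (q : unitInterval) (A : Set (Sym2 (V d) → Bool)) : ℝ :=
  Pr (fun _ : Sym2 (V d) => q) A

/-- Invariance of connection probabilities under lattice automorphisms. -/
lemma Pq_auto (q : unitInterval) (φ : V d ≃ V d) (hφ : ∀ a b, adj (φ a) (φ b) ↔ adj a b)
    {D X T : Set (V d)} (hD : D.Finite) :
    Pq q (hitE (φ '' D) (φ '' X) (φ '' T)) = Pq q (hitE D X T) := by
  have hinj : Function.Injective (Sym2.map φ) := Sym2.map.injective φ.injective
  have h := Pr_comap (p := fun _ : Sym2 (V d) => q) hinj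
    ((hitE_dep D X T).meas (ED_finite hD))
  unfold Pq
  rw [← h]
  congr 1
  ext ω
  have key : ∀ a b, op (fun k => ω (Sym2.map φ k)) a b ↔ op ω (φ a) (φ b) := by
    intro a b
    simp only [op, Sym2.map_mk, hφ]
  constructor
  · rintro ⟨_, ⟨x, hx, rfl⟩, _, ⟨y, hy, rfl⟩, hc⟩
    refine ⟨x, hx, y, hy, ?_⟩
    have h2 := Relation.ReflTransGen.lift (p := fun a b => a ∈ D ∧ b ∈ D ∧
      op (fun k => ω (Sym2.map φ k)) a b) φ.symm (fun a b hab => ?_) _ _ hc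
    · simp only [Function.onFun, Equiv.symm_apply_apply] at h2; exact h2
    · obtain ⟨⟨a, ha, rfl⟩, ⟨b, hb, rfl⟩, hab⟩ := hab
      simp only [Function.onFun, Equiv.symm_apply_apply]
      exact ⟨ha, hb, (key a b).2 hab⟩
  · rintro ⟨x, hx, y, hy, hc⟩
    refine ⟨φ x, ⟨x, hx, rfl⟩, φ y, ⟨y, hy, rfl⟩, ?_⟩
    exact Relation.ReflTransGen.lift (p := fun a b => a ∈ φ '' D ∧ b ∈ φ '' D ∧ op ω a b) φ (fun a b hab =>
      ⟨⟨a, hab.1, rfl⟩, ⟨b, hab.2.1, rfl⟩, (key a b).1 hab.2.2⟩) _ _ hc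

lemma Pq_translate (q : unitInterval) (c : V d) {D X T : Set (V d)} (hD : D.Finite) :
    Pq q (hitE ((· + c) '' D) ((· + c) '' X) ((· + c) '' T)) = Pq q (hitE D X T) :=
  Pq_auto q (Equiv.addRight c) (fun _ _ => adj_translate) hD

lemma image_bx (c e : V d) (r : ℤ) : (· + c) '' (bx e r) = bx (e + c) r := by
  ext v
  simp only [Set.mem_image, bx, Set.mem_ofPred_eq, Pi.add_apply]
  constructor
  · rintro ⟨w, hw, rfl⟩ i
    simpa using hw i
  · intro h
    refine ⟨v - c, fun i => ?_, by simp⟩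
    have e : (v - c) i - e i = v i - (e i + c i) := by simp; ring
    rw [e]; exact h i

/-- Box-to-sphere probability. -/
noncomputable def aa (d : ℕ) (q : unitInterval) (r n : ℕ) : ℝ :=
  Pq q (hitE (bx (0 : V d) n) (bx 0 r) (sph 0 n))

lemma aa_anti (q : unitInterval) {r m n : ℕ} (h : r ≤ m) (hmn : m ≤ n) :
    aa d q r n ≤ aa d q r m := by
  refine Pr_mono ?_
  rintro ω ⟨x, hx, y, hy, hc⟩
  rcases hmn.eq_or_lt with rfl | hlt
  · exact ⟨x, hx, y, hy, hc⟩
  obtain ⟨v, hv, h2⟩ := hc.sphere (fun a b h => h.1) (m := m)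
    (bx_mono (by exact_mod_cast h) hx) (by
      intro hy'
      obtain ⟨i, hi⟩ := hy.2
      have := hy' i
      omega)
  exact ⟨x, hx, v, hv, h2.mono_set Set.inter_subset_right⟩

/-- Submultiplicativity. -/
lemma aa_mul (q : unitInterval) {r m n : ℕ} (h : r ≤ m) (hmn : m < n) :
    aa d q r n ≤ aa d q r m * aa d q m n := by
  set O' : (Sym2 (V d) → Bool) → V d → V d → Prop := fun ω a b =>
    op ω a b ∧ s(a, b) ∉ ED (bx (0 : V d) m) with hO'
  set E' : Set (Sym2 (V d) → Bool) := {ω | hit (O' ω) (bx (0 : V d) n) (bx 0 m) (sph 0 n)}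
    with hE'
  have dE : Dep (ED (bx (0 : V d) n) \ ED (bx (0 : V d) m)) E' := by
    intro ω ω' e h
    refine h.mono (fun a ha b hb hab => ⟨⟨hab.1.1, ?_⟩, hab.2⟩) le_rfl le_rfl le_rfl
    rw [← e _ ⟨mem_ED.2 ⟨ha, hb⟩, hab.2⟩]; exact hab.1.2
  have fin := ED_finite (bx_finite (0 : V d) m)
  have fin2 := ED_finite (bx_finite (0 : V d) n)
  have hind := Pr_indep (p := fun _ : Sym2 (V d) => q)
    (hitE_dep (bx (0 : V d) m) (bx 0 r) (sph 0 m)) dE fin fin2.sdiff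
    Set.disjoint_sdiff_right
  have h1 : Pq q E' ≤ aa d q m n := by
    refine Pr_mono ?_
    intro ω hω
    exact hω.mono (fun _ _ _ _ h => h.1) le_rfl le_rfl le_rfl
  have h2 : hitE (bx (0 : V d) n) (bx 0 r) (sph 0 n) ⊆
      hitE (bx (0 : V d) m) (bx 0 r) (sph 0 m) ∩ E' := by
    rintro ω ⟨x, hx, y, hy, hc⟩
    have hy' : y ∉ bx (0 : V d) m := by
      intro hy'
      obtain ⟨i, hi⟩ := hy.2
      have := hy' i
      omega
    have hxm : x ∈ bx (0 : V d) m := bx_mono (by exact_mod_cast h) hx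
    constructor
    · obtain ⟨v, hv, h2⟩ := hc.sphere (fun a b h => h.1) (m := m) hxm
        (fun h => hy' (bx_mono (by omega) h))
      exact ⟨x, hx, v, hv, h2.mono_set Set.inter_subset_right⟩
    · obtain ⟨a, b, h1, h2, h3, h4, h5, h6, -⟩ :=
        (hc.symm op.symm).exit (S := (bx (0 : V d) m)ᶜ) hy' (by simpa using hxm)
      refine ⟨b, by simpa using h3, y, hy, ?_⟩
      have hba : conn (O' ω) (bx (0 : V d) n) b a :=
        conn.single ⟨op.symm _ _ h6, fun h => h2 (mem_ED.1 h).2⟩ h5 h4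
      refine hba.trans ((h1.symm op.symm).mono (fun u hu v hv huv => ⟨huv, fun h => ?_⟩)
        Set.inter_subset_left)
      exact hu.2 (mem_ED.1 h).1
  calc aa d q r n ≤ Pq q (hitE (bx (0 : V d) m) (bx 0 r) (sph 0 m) ∩ E') := Pr_mono h2
    _ = aa d q r m * Pq q E' := hind
    _ ≤ _ := mul_le_mul_of_nonneg_left h1 Pr_nonneg

/-- Percolation at `q`. -/
def perc (d : ℕ) (q : unitInterval) : Prop := ∃ c > 0, ∀ n : ℕ, c ≤ aa d q 0 n

/-- Large boxes are connected far away with probability close to one. -/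
lemma big_box {q : unitInterval} (hq : perc d q) {δ : ℝ} (hδ : 0 < δ) :
    ∃ r : ℕ, ∀ n : ℕ, r ≤ n → 1 - δ ≤ aa d q r (n + 1) := by
  obtain ⟨c, hc, hcn⟩ := hq
  set a : ℕ → ℝ := fun n => aa d q 0 n
  have anti : Antitone a := fun m n h => aa_anti q (Nat.zero_le _) h
  have bdd : BddBelow (Set.range a) := ⟨c, by rintro _ ⟨n, rfl⟩; exact hcn n⟩
  set β := ⨅ n, a n
  have hβ : c ≤ β := le_ciInf hcn
  have hβ0 : 0 < β := hc.trans_le hβ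
  have : ∃ m, a m < β * (1 + δ) := exists_lt_of_ciInf_lt (by nlinarith)
  obtain ⟨m, hm⟩ := this
  refine ⟨m, fun n hn => ?_⟩
  have h1 := aa_mul (d := d) q (Nat.zero_le m) (Nat.lt_succ_of_le hn)
  have h2 : β ≤ a (n + 1) := ciInf_le bdd _
  have h3 : 0 ≤ aa d q m (n + 1) := Pr_nonneg
  have h4 : β ≤ β * (1 + δ) * aa d q m (n + 1) :=
    h2.trans (h1.trans (mul_le_mul_of_nonneg_right hm.le h3))
  have h5 : 1 ≤ (1 + δ) * aa d q m (n + 1) := by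
    by_contra hcon
    push Not at hcon
    nlinarith
  nlinarith

/-! ## Part C: corners (square root trick), Part D: connected sets reach prescribed corners -/

section fam
variable {ι κ : Type*} {p : ι → unitInterval} {S : Set ι}

lemma fkg_down {A B : Set (ι → Bool)} (hA : Dep S A) (hB : Dep S B) (hS : S.Finite)
    (uA : IsLowerSet A) (uB : IsLowerSet B) : Pr p A * Pr p B ≤ Pr p (A ∩ B) := by
  have h := fkg_up (p := p) hA.compl hB.compl hS uA.compl uB.compl
  have mA := hA.meas hS
  have mB := hB.meas hS
  rw [Pr_compl mA, Pr_compl mB] at h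
  have h2 : Pr p (Aᶜ ∩ Bᶜ) = 1 - Pr p (A ∪ B) := by
    rw [← Set.compl_union, Pr_compl (mA.union mB)]
  have h3 : Pr p (A ∪ B) + Pr p (A ∩ B) = Pr p A + Pr p B := by
    unfold Pr; exact measureReal_union_add_inter mB
  nlinarith

lemma fkg_down_finset (s : Finset κ) (A : κ → Set (ι → Bool)) (hA : ∀ k, Dep S (A k))
    (hS : S.Finite) (uA : ∀ k, IsLowerSet (A k)) :
    ∏ k ∈ s, Pr p (A k) ≤ Pr p (⋂ k ∈ s, A k) := by
  classical
  induction s using Finset.induction_on with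
  | empty => simp [Pr_univ]
  | insert a s ha ih =>
    rw [Finset.prod_insert ha, Finset.set_biInter_insert]
    refine (mul_le_mul_of_nonneg_left ih Pr_nonneg).trans ?_
    exact fkg_down (hA a) (Dep.iInter fun k => Dep.iInter fun _ => hA k) hS (uA a)
      (isLowerSet_iInter₂ fun k _ => uA k)

lemma Pr_indep_finset (s : Finset κ) (A : κ → Set (ι → Bool)) (S : κ → Set ι)
    (hA : ∀ k ∈ s, Dep (S k) (A k)) (hS : ∀ k ∈ s, (S k).Finite)
    (hd : (s : Set κ).PairwiseDisjoint S) :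
    Pr p (⋂ k ∈ s, A k) = ∏ k ∈ s, Pr p (A k) := by
  classical
  induction s using Finset.induction_on with
  | empty => simp [Pr_univ]
  | insert a s ha ih =>
    rw [Finset.prod_insert ha, Finset.set_biInter_insert,
      ← ih (fun k hk => hA k (by simp [hk])) (fun k hk => hS k (by simp [hk]))
        (hd.subset (by simp))]
    refine Pr_indep (T := ⋃ k ∈ s, S k) (hA a (by simp)) ?_ (hS a (by simp)) ?_ ?_
    · refine Dep.iInter fun k => Dep.iInter fun hk => (hA k (by simp [hk])).mono ?_
      exact Set.subset_biUnion_of_mem (u := S) hk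
    · exact Set.Finite.biUnion s.finite_toSet fun k hk => hS k (by simpa using Or.inr hk)
    · rw [Set.disjoint_iUnion₂_right]
      intro k hk
      exact hd (by simp) (by simp [hk]) (by rintro rfl; exact ha hk)

end fam

variable {d : ℕ}

/-- Signed permutation. -/
def sperm (τ : Fin d → ℤˣ) (σ : Equiv.Perm (Fin d)) : V d ≃ V d where
  toFun v := fun i => (τ i : ℤ) * v (σ i)
  invFun w := fun i => (τ (σ.symm i) : ℤ) * w (σ.symm i)
  left_inv v := by
    funext i
    simp only [Equiv.apply_symm_apply, ← mul_assoc]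
    rcases Int.units_eq_one_or (τ (σ.symm i)) with h | h <;> simp [h]
  right_inv v := by
    funext i
    simp only [Equiv.symm_apply_apply, ← mul_assoc]
    rcases Int.units_eq_one_or (τ i) with h | h <;> simp [h]

lemma sperm_adj (τ : Fin d → ℤˣ) (σ : Equiv.Perm (Fin d)) (a b : V d) :
    adj (sperm τ σ a) (sperm τ σ b) ↔ adj a b := by
  unfold adj dist1
  rw [← Equiv.sum_comp σ (fun i => (a i - b i).natAbs)]
  have : ∀ i, (sperm τ σ a i - sperm τ σ b i).natAbs = (a (σ i) - b (σ i)).natAbs := by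
    intro i
    change ((τ i : ℤ) * a (σ i) - (τ i : ℤ) * b (σ i)).natAbs = _
    rcases Int.units_eq_one_or (τ i) with h | h
    · simp [h]
    · rw [h]; simp only [Units.val_neg, Units.val_one]; omega
  simp only [this]

lemma unit_mul_abs (u : ℤˣ) (a : ℤ) : |(u : ℤ) * a| = |a| := by
  rcases Int.units_eq_one_or u with h | h <;> simp [h]

/-- Piece of the sphere. -/
def corner (j : Fin d) (τ : Fin d → ℤˣ) (n : ℤ) : Set (V d) :=
  {v | v ∈ bx 0 n ∧ (τ j : ℤ) * v j = n ∧ ∀ i, 0 ≤ (τ i : ℤ) * v i}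

lemma sperm_bx (τ : Fin d → ℤˣ) (σ : Equiv.Perm (Fin d)) (n : ℤ) :
    sperm τ σ '' (bx 0 n) = bx 0 n := by
  have h1 : ∀ (τ : Fin d → ℤˣ) (σ : Equiv.Perm (Fin d)) v, v ∈ bx 0 n → sperm τ σ v ∈ bx 0 n := by
    intro τ σ v hv i
    change |(τ i : ℤ) * v (σ i) - 0| ≤ n
    rw [sub_zero, unit_mul_abs]
    simpa using hv (σ i)
  refine Set.Subset.antisymm ?_ ?_
  · rintro _ ⟨v, hv, rfl⟩; exact h1 _ _ v hv
  · intro v hv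
    refine ⟨(sperm τ σ).symm v, ?_, by simp⟩
    intro i
    change |(τ (σ.symm i) : ℤ) * v (σ.symm i) - 0| ≤ n
    rw [sub_zero, unit_mul_abs]
    simpa using hv (σ.symm i)

lemma sperm_corner (j₀ j : Fin d) (τ : Fin d → ℤˣ) (n : ℤ) :
    sperm τ (Equiv.swap j j₀) '' (corner j₀ 1 n) = corner j τ n := by
  have hval : ∀ (v : V d) i, (τ i : ℤ) * sperm τ (Equiv.swap j j₀) v i = v (Equiv.swap j j₀ i) := by
    intro v i
    change (τ i : ℤ) * ((τ i : ℤ) * v _) = _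
    rcases Int.units_eq_one_or (τ i) with h | h <;> simp [h]
  have hb : ∀ v, sperm τ (Equiv.swap j j₀) v ∈ bx 0 n ↔ v ∈ bx 0 n := by
    intro v
    conv_lhs => rw [← sperm_bx τ (Equiv.swap j j₀) n]
    exact (sperm τ (Equiv.swap j j₀)).injective.mem_set_image
  ext w
  constructor
  · rintro ⟨v, ⟨h1, h2, h3⟩, rfl⟩
    refine ⟨(hb v).2 h1, ?_, fun i => ?_⟩
    · rw [hval]; simpa using h2
    · rw [hval]; simpa using h3 (Equiv.swap j j₀ i)
  · rintro ⟨h1, h2, h3⟩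
    obtain ⟨v, rfl⟩ := (sperm τ (Equiv.swap j j₀)).surjective w
    refine ⟨v, ⟨(hb v).1 h1, ?_, fun i => ?_⟩, rfl⟩
    · rw [hval] at h2; simpa using h2
    · have := h3 (Equiv.swap j j₀ i)
      rw [hval] at this; simpa using this

/-- Square root trick. -/
lemma corner_hit {q : unitInterval} (hq : perc d q) {δ : ℝ} (hδ : 0 < δ) :
    ∃ r : ℕ, ∀ n : ℕ, r ≤ n → ∀ (j : Fin d) (τ : Fin d → ℤˣ),
      1 - δ ≤ Pq q (hitE (bx 0 n) (bx 0 r) (corner j τ n)) := by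
  set K : ℕ := Fintype.card (Fin d × (Fin d → ℤˣ)) with hK
  obtain ⟨r, hr⟩ := big_box hq (pow_pos hδ K)
  refine ⟨r + 1, fun n hn j τ => ?_⟩
  obtain ⟨m, rfl⟩ : ∃ m, n = m + 1 := ⟨n - 1, by omega⟩
  have h1 := hr m (by omega)
  set D : Set (V d) := bx 0 ((m + 1 : ℕ) : ℤ) with hD
  have hDf : D.Finite := bx_finite _ _
  set N : Fin d × (Fin d → ℤˣ) → Set (Sym2 (V d) → Bool) := fun k =>
    (hitE D (bx 0 r) (corner k.1 k.2 ((m + 1 : ℕ) : ℤ)))ᶜ with hN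
  have heq : ∀ k, Pr (fun _ : Sym2 (V d) => q) (N k) = Pr (fun _ : Sym2 (V d) => q) (N (j, τ)) := by
    have hh : ∀ k : Fin d × (Fin d → ℤˣ), Pq q (hitE D (bx 0 r) (corner k.1 k.2 ((m + 1 : ℕ) : ℤ)))
        = Pq q (hitE D (bx 0 r) (corner j 1 ((m + 1 : ℕ) : ℤ))) := by
      intro k
      have := Pq_auto q (sperm k.2 (Equiv.swap k.1 j)) (sperm_adj _ _) (D := D) (X := bx 0 r)
        (T := corner j 1 ((m + 1 : ℕ) : ℤ)) hDf
      rw [hD, sperm_bx, sperm_bx, sperm_corner] at this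
      rw [hD]; exact this
    intro k
    rw [hN, Pr_compl ((hitE_dep _ _ _).meas (ED_finite hDf)),
      Pr_compl ((hitE_dep _ _ _).meas (ED_finite hDf))]
    have := (hh k).trans (hh (j, τ)).symm
    unfold Pq at this
    rw [this]
  have hf := fkg_down_finset (p := fun _ : Sym2 (V d) => q) Finset.univ N
    (fun k => (hitE_dep _ _ _).compl) (ED_finite hDf) (fun k => (hitE_upper _ _ _).compl)
  have hsub : (⋂ k ∈ Finset.univ, N k) ⊆ (hitE D (bx 0 r) (sph 0 ((m + 1 : ℕ) : ℤ)))ᶜ := by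
    intro ω hω hc
    obtain ⟨x, hx, y, ⟨hy, i, hi⟩, hc⟩ := hc
    simp only [Set.mem_iInter] at hω
    have hs : ∀ a : ℤ, ∃ u : ℤˣ, (u : ℤ) * a = |a| := by
      intro a
      rcases abs_cases a with ⟨h, _⟩ | ⟨h, _⟩
      · exact ⟨1, by simp [h]⟩
      · exact ⟨-1, by simp [h]⟩
    choose u hu using hs
    refine hω (i, fun l => u (y l)) (Finset.mem_univ _) ⟨x, hx, y, ⟨hy, ?_, fun l => ?_⟩, hc⟩
    · change (u (y i) : ℤ) * y i = _
      rw [hu]; simpa using hi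
    · change 0 ≤ (u (y l) : ℤ) * y l
      rw [hu]; exact abs_nonneg _
  have h2 := Pr_mono (p := fun _ : Sym2 (V d) => q) hsub
  rw [Pr_compl ((hitE_dep _ _ _).meas (ED_finite hDf))] at h2
  rw [Finset.prod_congr rfl (fun k _ => heq k), Finset.prod_const, Finset.card_univ, ← hK] at hf
  have h3 : Pr (fun _ : Sym2 (V d) => q) (N (j, τ)) ^ K ≤ δ ^ K := by
    have : 1 - δ ^ K ≤ Pr (fun _ : Sym2 (V d) => q) (hitE D (bx 0 r) (sph 0 ((m + 1 : ℕ) : ℤ))) := h1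
    linarith
  have hK0 : K ≠ 0 := by
    rw [hK]
    have : Nonempty (Fin d × (Fin d → ℤˣ)) := ⟨(j, τ)⟩
    exact Fintype.card_ne_zero
  have h4 := (pow_le_pow_iff_left₀ Pr_nonneg hδ.le hK0).1 h3
  rw [hN] at h4
  simp only at h4
  rw [Pr_compl ((hitE_dep _ _ _).meas (ED_finite hDf))] at h4
  have h5 : hitE D (bx 0 r) (corner j τ ((m + 1 : ℕ) : ℤ)) ⊆
      hitE D (bx 0 ((r + 1 : ℕ) : ℤ)) (corner j τ ((m + 1 : ℕ) : ℤ)) :=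
    hitE_mono le_rfl (bx_mono (by push_cast; omega)) le_rfl
  have h6 := Pr_mono (p := fun _ : Sym2 (V d) => q) h5
  unfold Pq
  linarith

/-- Boxes are connected. -/
lemma boxlike_conn {D : Set (V d)} (hD : ∀ u ∈ D, ∀ v ∈ D, ∀ w : V d,
      (∀ i, min (u i) (v i) ≤ w i ∧ w i ≤ max (u i) (v i)) → w ∈ D) :
    ∀ u ∈ D, ∀ v ∈ D, conn adj D u v := by
  suffices H : ∀ n : ℕ, ∀ u ∈ D, ∀ v ∈ D, dist1 u v = n → conn adj D u v from
    fun u hu v hv => H _ u hu v hv rfl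
  intro n
  induction n with
  | zero =>
    intro u hu v hv h
    have : u = v := by
      funext i
      unfold dist1 at h
      rw [Finset.sum_eq_zero_iff] at h
      have := h i (Finset.mem_univ i)
      omega
    rw [this]; exact conn.refl
  | succ n ih =>
    intro u hu v hv h
    have : ∃ i, u i ≠ v i := by
      by_contra hc
      push Not at hc
      have : u = v := funext hc
      subst this
      simp [dist1] at h
    obtain ⟨i, hi⟩ := this
    set s : ℤ := if u i < v i then 1 else -1 with hs
    set u' : V d := Function.update u i (u i + s) with hu'
    have hi' : u' i = u i + s := by simp [hu']
    have hj' : ∀ j, j ≠ i → u' j = u j := fun j hj => by simp [hu', hj]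
    have hmem : u' ∈ D := by
      refine hD u hu v hv u' fun j => ?_
      by_cases hj : j = i
      · subst hj
        rw [hi', hs]
        split_ifs <;> omega
      · rw [hj' j hj]; omega
    have hadj : adj u u' := by
      rw [adj_iff]
      refine ⟨i, ?_, hj'⟩
      rw [hi', hs]
      split_ifs <;> simp
    have hdist : dist1 u' v = n := by
      unfold dist1 at h ⊢
      rw [← Finset.add_sum_erase _ _ (Finset.mem_univ i)] at h ⊢
      have e : ∑ x ∈ Finset.univ.erase i, (u' x - v x).natAbs =
          ∑ x ∈ Finset.univ.erase i, (u x - v x).natAbs :=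
        Finset.sum_congr rfl fun j hj => by rw [hj' j (Finset.ne_of_mem_erase hj)]
      rw [e, hi', hs]
      split_ifs <;> omega
    exact (conn.single hadj hu hmem).trans (ih u' hmem v hv hdist)

lemma bx_conn {c : V d} {r : ℤ} : ∀ u ∈ bx c r, ∀ v ∈ bx c r, conn adj (bx c r) u v := by
  refine boxlike_conn fun u hu v hv w hw i => ?_
  have h1 := abs_le.1 (hu i)
  have h2 := abs_le.1 (hv i)
  have h3 := hw i
  rw [abs_le]
  omega

lemma ED_image (c : V d) (D : Set (V d)) : ED ((· + c) '' D) = Sym2.map (· + c) '' ED D := by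
  ext e
  induction e using Sym2.ind with
  | _ a b =>
    rw [mem_ED]
    constructor
    · rintro ⟨⟨a, ha, rfl⟩, ⟨b, hb, rfl⟩⟩
      exact ⟨s(a, b), mem_ED.2 ⟨ha, hb⟩, rfl⟩
    · rintro ⟨e, he, h⟩
      induction e using Sym2.ind with
      | _ u v =>
        rw [mem_ED] at he
        rw [Sym2.map_mk, Sym2.eq_iff] at h
        rcases h with ⟨rfl, rfl⟩ | ⟨rfl, rfl⟩
        · exact ⟨⟨u, he.1, rfl⟩, ⟨v, he.2, rfl⟩⟩
        · exact ⟨⟨v, he.2, rfl⟩, ⟨u, he.1, rfl⟩⟩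

lemma ncard_ED_bx (c : V d) (r : ℤ) : (ED (bx c r)).ncard = (ED (bx (0 : V d) r)).ncard := by
  have : bx c r = (· + c) '' bx 0 r := by rw [image_bx]; simp
  rw [this, ED_image, Set.ncard_image_of_injective]
  exact Sym2.map.injective (add_left_injective c)

/-- Target of a move from `z` of length `n` in direction `j` with signs `τ`. -/
def tgt (z : V d) (j : Fin d) (τ : Fin d → ℤˣ) (n M : ℤ) : Set (V d) :=
  {v | v ∈ bx z (n + 2 * M) ∧ (τ j : ℤ) * (v j - z j) = n ∧ ∀ i, -M ≤ (τ i : ℤ) * (v i - z i)}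

/-- lattice-connected set. -/
def LC (X : Set (V d)) : Prop := ∀ x ∈ X, ∀ y ∈ X, conn adj X x y

/-- Two-layer parameters. -/
noncomputable def lay2 (q ε : unitInterval) : Sym2 (V d) × Bool → unitInterval :=
  fun e => if e.2 then ε else q

lemma two_layer {q p : unitInterval} (hqp : q < p) :
    ∃ ε : unitInterval, 0 < (ε : ℝ) ∧ (1 - p : ℝ) ≤ (1 - q) * (1 - ε) := by
  have h0 := q.2.1
  have h1 := p.2.2
  have h : (q : ℝ) < p := hqp
  refine ⟨⟨p - q, by linarith, by linarith⟩, by simpa using h, ?_⟩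
  simp only
  nlinarith

/-- A lattice-connected set of large diameter reaches any corner. -/
lemma star_hit {q p : unitInterval} (hqp : q < p) (hq : perc d q) {δ : ℝ} (hδ : 0 < δ) :
    ∃ M : ℕ, ∀ n : ℕ, 2 * M ≤ n → ∀ X : Set (V d), LC X → ∀ z ∈ X,
      (∃ w ∈ X, w ∉ bx z (M - 1)) → ∀ (j : Fin d) (τ : Fin d → ℤˣ),
      1 - δ ≤ Pq p (hitE (bx z (n + 2 * M)) X (tgt z j τ n M)) := by
  obtain ⟨ε, hε, hεp⟩ := two_layer hqp
  obtain ⟨r, hr⟩ := corner_hit hq (half_pos hδ)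
  set K := (ED (bx (0 : V d) r)).ncard with hK
  have hh0 : 0 < (ε : ℝ) ^ K := pow_pos hε _
  have hh1 : (ε : ℝ) ^ K ≤ 1 := pow_le_one₀ hε.le ε.2.2
  obtain ⟨k, hk⟩ := exists_pow_lt_of_lt_one (half_pos hδ) (by linarith : 1 - (ε : ℝ) ^ K < 1)
  refine ⟨(2 * r + 1) * (k + 1), ?_⟩
  set M : ℕ := (2 * r + 1) * (k + 1) with hM
  intro n hn X hX z hz ⟨w, hw, hwz⟩ j τ
  -- the points
  have hx : ∀ i : ℕ, i < k → ∃ x ∈ X, x ∈ sph z (((2 * r + 1) * i : ℕ) : ℤ) := by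
    intro i hi
    have hle : (2 * r + 1) * i ≤ M := Nat.mul_le_mul_left _ (by omega)
    obtain ⟨v, hv, hc⟩ := (hX z hz w hw).sphere (fun a b h => h)
      (self_mem_bx (c := z) (r := (((2 * r + 1) * i : ℕ) : ℤ)) (by positivity))
      (fun h => hwz (bx_mono (by have : (((2 * r + 1) * i : ℕ) : ℤ) ≤ M := by exact_mod_cast hle
                                 linarith) h))
    exact ⟨v, (hc.mono_set Set.inter_subset_left).mem hz, hv⟩
  choose! x hxX hxs using hx
  have hxM : ∀ i < k, ∀ l, |x i l - z l| + r ≤ M := by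
    intro i hi l
    have h1 := (hxs i hi).1 l
    have hle : (2 * r + 1) * i + r ≤ M := by
      have : (2 * r + 1) * i ≤ (2 * r + 1) * k := Nat.mul_le_mul_left _ hi.le
      rw [hM, mul_add]; omega
    have : (((2 * r + 1) * i : ℕ) : ℤ) + r ≤ M := by exact_mod_cast hle
    linarith
  have hdisj : ∀ i < k, ∀ l < k, i < l → Disjoint (ED (bx (x i) r)) (ED (bx (x l) r)) := by
    intro i hi l hl hil
    rw [Set.disjoint_left]
    intro e
    induction e using Sym2.ind with
    | _ a b =>
      intro h1 h2
      have ha := (mem_ED.1 h1).1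
      have ha' := (mem_ED.1 h2).1
      obtain ⟨-, t, ht⟩ := hxs l hl
      have h3 := (hxs i hi).1 t
      have h4 := ha t
      have h5 := ha' t
      have h6 : (2 * r + 1) * i + (2 * r + 1) ≤ (2 * r + 1) * l := by
        rw [← Nat.mul_succ]; exact Nat.mul_le_mul_left _ hil
      have h7 : (((2 * r + 1) * i : ℕ) : ℤ) + (2 * r + 1) ≤ (((2 * r + 1) * l : ℕ) : ℤ) := by
        exact_mod_cast h6
      rw [Int.abs_eq_natAbs] at *
      omega
  set D : Set (V d) := bx z (n + 2 * M) with hD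
  have hDf : D.Finite := bx_finite _ _
  set T : Set (V d) := tgt z j τ n M with hT
  -- layer-0 estimate
  have hB : ∀ i < k, 1 - δ / 2 ≤ Pq q (hitE D (bx (x i) r) T) := by
    intro i hi
    have hb : |(τ j : ℤ) * (x i j - z j)| ≤ M := by
      rw [unit_mul_abs]; have := hxM i hi j; omega
    have hb' := abs_le.1 hb
    obtain ⟨m, hm⟩ : ∃ m : ℕ, (m : ℤ) = n - (τ j : ℤ) * (x i j - z j) :=
      ⟨(n - (τ j : ℤ) * (x i j - z j)).toNat, Int.toNat_of_nonneg (by omega)⟩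
    have hrM : (r : ℤ) ≤ M := by
      have := hxM i hi j
      have := abs_nonneg (x i j - z j)
      omega
    have h1 := hr m (by omega) j τ
    rw [← Pq_translate q (x i) (bx_finite _ _), image_bx, image_bx, zero_add] at h1
    refine h1.trans (Pr_mono (hitE_mono ?_ le_rfl ?_))
    · refine bx_sub fun l => ?_
      have := hxM i hi l
      omega
    · rintro _ ⟨v, ⟨h1, h2, h3⟩, rfl⟩
      refine ⟨?_, ?_, fun l => ?_⟩
      · intro l
        have e1 := h1 l
        have e2 := hxM i hi l
        simp only [Pi.add_apply, Pi.zero_apply, sub_zero] at e1 ⊢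
        have := abs_add_le (v l) (x i l - z l)
        have e : v l + (x i l - z l) = v l + x i l - z l := by ring
        rw [e] at this
        omega
      · simp only [Pi.add_apply]
        have : (τ j : ℤ) * (v j + x i j - z j) = (τ j : ℤ) * v j + (τ j : ℤ) * (x i j - z j) := by
          ring
        rw [this, h2]; omega
      · simp only [Pi.add_apply]
        have : (τ l : ℤ) * (v l + x i l - z l) = (τ l : ℤ) * v l + (τ l : ℤ) * (x i l - z l) := by
          ring
        rw [this]
        have e1 := h3 l
        have e2 : |(τ l : ℤ) * (x i l - z l)| ≤ M := by
          rw [unit_mul_abs]; have := hxM i hi l; omega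
        have := abs_le.1 e2
        omega
  -- layered space
  set P := lay2 (d := d) q ε with hP
  set Z : ℕ → Finset (Sym2 (V d) × Bool) := fun i =>
    ((ED_finite (bx_finite (x i) r)).toFinset).map ⟨fun e => (e, true), fun a b h =>
      (Prod.mk.inj h).1⟩ with hZ
  set H : ℕ → Set (Sym2 (V d) × Bool → Bool) := fun i => {ω | ∀ e ∈ Z i, ω e = true} with hH
  have hPH : ∀ i, Pr P (H i) = (ε : ℝ) ^ K := by
    intro i
    rw [hH]
    simp only
    rw [Pr_all_true, hZ, Finset.prod_map]
    refine (Finset.prod_congr rfl (g := fun _ => (ε : ℝ)) (fun e _ => by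
      change ((lay2 (d := d) q ε (e, true) : unitInterval) : ℝ) = _
      simp [lay2])).trans ?_
    rw [Finset.prod_const,
      ← Set.ncard_eq_toFinset_card _ (ED_finite (bx_finite (x i) r)), ncard_ED_bx]
  have hdH : ∀ i, Dep (Z i : Set (Sym2 (V d) × Bool)) (H i) := fun i => Dep_all _ _
  set W : Set (Sym2 (V d) × Bool) := ⋃ i ∈ Finset.range k, (Z i : Set (Sym2 (V d) × Bool)) with hW
  have hWf : W.Finite := Set.Finite.biUnion (Finset.finite_toSet _) fun i _ => (Z i).finite_toSet
  set G : ℕ → Set (Sym2 (V d) × Bool → Bool) := fun i =>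
    H i ∩ ⋂ l ∈ Finset.range i, (H l)ᶜ with hG
  have hex := Pr_explore (p := P) (Finset.range k) G
    (fun i => {ω | (fun e => ω (e, false)) ∈ hitE D (bx (x i) r) T})
    (fun _ => W) (fun _ => (fun e => (e, false)) '' ED D)
    (by
      intro i hi
      refine Dep.inter ((hdH i).mono ?_) (Dep.iInter fun l => Dep.iInter fun hl =>
        ((hdH l).compl.mono ?_))
      · exact Set.subset_biUnion_of_mem (u := fun i => (Z i : Set (Sym2 (V d) × Bool))) hi
      · refine Set.subset_biUnion_of_mem (u := fun i => (Z i : Set (Sym2 (V d) × Bool))) ?_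
        simp only [Finset.coe_range, Set.mem_Iio, Finset.mem_range] at *
        omega)
    (by
      intro i hi ω ω' e h
      exact hitE_dep _ _ _ _ _ (fun f hf => e _ ⟨f, hf, rfl⟩) h)
    (fun _ _ => hWf) (fun _ _ => (ED_finite hDf).image _)
    (by
      intro i hi
      rw [Set.disjoint_left]
      rintro ⟨e, b⟩ h1 ⟨f, hf, h2⟩
      simp only [hW, Set.mem_iUnion, hZ, Finset.coe_map, Function.Embedding.coeFn_mk,
        Set.mem_image] at h1
      obtain ⟨l, -, f', -, h3⟩ := h1
      rw [← h3] at h2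
      exact absurd (congrArg Prod.snd h2) (by simp))
    (by
      intro i _ l _ hil
      have key : ∀ i l, i < l → Disjoint (G i) (G l) := by
        intro i l h
        rw [Set.disjoint_left]
        rintro ω ⟨h1, -⟩ ⟨-, h2⟩
        simp only [Set.mem_iInter] at h2
        exact h2 i (Finset.mem_range.2 h) h1
      rcases lt_or_gt_of_ne hil with h | h
      · exact key i l h
      · exact (key l i h).symm)
    {ω | orL ω ∈ hitE D X T}
    (by
      rintro i hi ω ⟨⟨h1, -⟩, a, ha, y, hy, hc⟩
      have hi' := Finset.mem_range.1 hi
      refine ⟨x i, hxX i hi', y, hy, ?_⟩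
      have hsub : bx (x i) r ⊆ D := bx_sub fun l => by have := hxM i hi' l; omega
      refine conn.trans (y := a) ?_ (hc.mono (fun u _ v _ h => ⟨h.1, ?_⟩) le_rfl)
      · refine (bx_conn (x i) (self_mem_bx (by positivity)) a ha).mono (fun u hu v hv h =>
          ⟨h, ?_⟩) hsub
        have : ω (s(u, v), true) = true := h1 _ (by
          simp only [hZ, Finset.mem_map, Set.Finite.mem_toFinset]
          exact ⟨_, mem_ED.2 ⟨hu, hv⟩, rfl⟩)
        simp only [orL, decide_eq_true_eq]
        exact ⟨_, this⟩
      · simp only [orL, decide_eq_true_eq]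
        exact ⟨_, h.2⟩)
    (fun _ => 1 - δ / 2)
    (by
      intro i hi
      have h1 := Pr_comap (p := P) (f := fun e : Sym2 (V d) => (e, false))
        (fun a b h => (Prod.mk.inj h).1)
        ((hitE_dep D (bx (x i) r) T).meas (ED_finite hDf))
      rw [h1]
      have h2 : (fun e : Sym2 (V d) => P (e, false)) = fun _ => q := by
        funext e; simp [hP, lay2]
      rw [h2]
      exact hB i (Finset.mem_range.1 hi))
  rw [← Finset.sum_mul] at hex
  have hsum : 1 - (1 - (ε : ℝ) ^ K) ^ k ≤ ∑ i ∈ Finset.range k, Pr P (G i) := by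
    have h1 : (⋂ i ∈ Finset.range k, (H i)ᶜ)ᶜ ⊆ ⋃ i ∈ Finset.range k, G i := by
      intro ω hω
      simp only [Set.mem_compl_iff, Set.mem_iInter, not_forall, not_not] at hω
      have : ∃ i, i < k ∧ ω ∈ H i := by
        obtain ⟨i, hi, h⟩ := hω
        exact ⟨i, Finset.mem_range.1 hi, h⟩
      classical
      have hs := Nat.find_spec this
      simp only [Set.mem_iUnion]
      refine ⟨Nat.find this, Finset.mem_range.2 hs.1, hs.2, ?_⟩
      simp only [Set.mem_iInter]
      intro l hl hlH
      have hl' := Finset.mem_range.1 hl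
      exact Nat.find_min this hl' ⟨hl'.trans hs.1, hlH⟩
    have h2 := (Pr_mono (p := P) h1).trans (Pr_biUnion_le _ _)
    have h3 := Pr_indep_finset (p := P) (Finset.range k) (fun i => (H i)ᶜ)
      (fun i => (Z i : Set (Sym2 (V d) × Bool))) (fun i _ => (hdH i).compl)
      (fun i _ => (Z i).finite_toSet)
      (by
        intro i hi l hl hil
        have key : ∀ i < k, ∀ l < k, i < l → Disjoint (Z i : Set (Sym2 (V d) × Bool))
            (Z l : Set (Sym2 (V d) × Bool)) := by
          intro i hi l hl hil
          rw [Set.disjoint_left]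
          intro e h1 h2
          simp only [hZ, Finset.coe_map, Function.Embedding.coeFn_mk, Set.mem_image,
            Set.Finite.coe_toFinset] at h1 h2
          obtain ⟨f, hf, rfl⟩ := h1
          obtain ⟨g, hg, h⟩ := h2
          have := (Prod.mk.inj h).1
          subst this
          exact Set.disjoint_left.1 (hdisj i hi l hl hil) hf hg
        simp only [Finset.coe_range, Set.mem_Iio] at hi hl
        rcases lt_or_gt_of_ne hil with h | h
        · exact key i hi l hl h
        · exact (key l hl i hi h).symm)
    rw [Pr_compl, h3] at h2
    · rw [Finset.prod_congr rfl (g := fun _ => 1 - (ε : ℝ) ^ K) (fun i _ => by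
        rw [Pr_compl ((hdH i).meas (Z i).finite_toSet), hPH]), Finset.prod_const,
        Finset.card_range] at h2
      exact h2
    · exact Finset.measurableSet_biInter _ fun i _ =>
        ((hdH i).meas (Z i).finite_toSet).compl
  have hfin := Pr_or (p := P) (P := fun _ : Sym2 (V d) => p) (S := ED D) (by
    intro e _
    simp only [Fintype.prod_bool, hP, lay2]
    simp only [if_true, Bool.false_eq_true, if_false]
    rw [mul_comm]; exact hεp) (hitE_dep D X T) (ED_finite hDf) (hitE_upper D X T)
  have : Pq p (hitE D X T) = Pr (fun _ : Sym2 (V d) => p) (hitE D X T) := rfl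
  rw [this]
  refine le_trans ?_ (hex.trans hfin)
  by_cases hδ2 : δ ≤ 2
  · have h5 := mul_le_mul_of_nonneg_right hsum (by linarith : 0 ≤ 1 - δ / 2)
    nlinarith
  · have h6 : ∑ i ∈ Finset.range k, Pr P (G i) ≤ 1 := by
      rw [← Pr_biUnion]
      · exact Pr_le_one
      · intro i _ l _ hil
        have key : ∀ i l, i < l → Disjoint (G i) (G l) := by
          intro i l h
          rw [Set.disjoint_left]
          rintro ω ⟨h1, -⟩ ⟨-, h2⟩
          simp only [Set.mem_iInter] at h2
          exact h2 i (Finset.mem_range.2 h) h1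
        rcases lt_or_gt_of_ne hil with h | h
        · exact key i l h
        · exact (key l i h).symm
      · intro i _
        exact ((hdH i).meas (Z i).finite_toSet).inter (Finset.measurableSet_biInter _ fun i _ =>
          ((hdH i).meas (Z i).finite_toSet).compl)
    nlinarith

/-! ## Part S: the sprinkling lemma -/

section sprinkle
variable {d : ℕ} {Λ : Type*}

/-- The layer `l` of a layered configuration. -/
def lyr (ω : Sym2 (V d) × Λ → Bool) (l : Λ) : Sym2 (V d) → Bool := fun e => ω (e, l)

/-- From `R`, one edge of layer `l1` leads to a site connected to `T` in layer `l0` off `R`. -/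
def sprE (l0 l1 : Λ) (Dom R T : Set (V d)) : Set (Sym2 (V d) × Λ → Bool) :=
  {ω | ∃ a ∈ R ∩ Dom, ∃ b ∈ Dom \ R, adj a b ∧ ω (s(a, b), l1) = true ∧
    ∃ y ∈ T, conn (op (lyr ω l0)) (Dom \ R) b y}

lemma last_exit {O : V d → V d → Prop} (hO : ∀ a b, O a b → O b a) {Dom R T : Set (V d)}
    (hRT : Disjoint R T) (h : hit O Dom R T) :
    ∃ a ∈ R ∩ Dom, ∃ b ∈ Dom \ R, O a b ∧ ∃ y ∈ T, conn O (Dom \ R) b y := by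
  obtain ⟨x, hx, y, hy, h⟩ := h
  obtain ⟨a, b, h1, h2, h3, h4, h5, h6, -⟩ := (h.symm hO).exit (S := Rᶜ)
    (fun h => Set.disjoint_left.1 hRT h hy) (by simpa using hx)
  refine ⟨b, ⟨by simpa using h3, h5⟩, a, ⟨h4, h2⟩, hO _ _ h6, y, hy, (h1.symm hO)⟩

lemma conn_lyr_dep {ω ω' : Sym2 (V d) → Bool} {D : Set (V d)}
    (h : ∀ e ∈ ED D, ω e = ω' e) {a b : V d} (hc : conn (op ω) D a b) : conn (op ω') D a b :=
  hc.mono (fun x hx y hy hxy => ⟨hxy.1, by rw [← h _ (mem_ED.2 ⟨hx, hy⟩)]; exact hxy.2⟩) le_rfl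

lemma sprE_prob {l0 l1 : Λ} (hl : l0 ≠ l1) {P : Sym2 (V d) × Λ → unitInterval}
    {q ε : unitInterval} (hq1 : (q : ℝ) < 1) {Dom R T : Set (V d)} (hD : Dom.Finite)
    (hP0 : ∀ e ∈ ED Dom, P (e, l0) = q)
    (hP1 : ∀ e ∈ ED Dom, P (e, l1) = ε) (hRT : Disjoint R T) {δ : ℝ}
    (h : 1 - δ ≤ Pq q (hitE Dom R T)) (t : ℕ) :
    1 - (δ * ((1 - q : ℝ)⁻¹) ^ t + (1 - ε : ℝ) ^ t) ≤ Pr P (sprE l0 l1 Dom R T) := by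
  classical
  -- the boundary edges
  set BE : Finset (Sym2 (V d)) := (ED_finite hD).toFinset with hBE
  let good : (Sym2 (V d) × Λ → Bool) → Sym2 (V d) → Prop := fun ω e =>
    ∃ a ∈ R ∩ Dom, ∃ b ∈ Dom \ R, adj a b ∧ e = s(a, b) ∧
      ∃ y ∈ T, conn (op (lyr ω l0)) (Dom \ R) b y
  let Wf : (Sym2 (V d) × Λ → Bool) → Finset (Sym2 (V d)) := fun ω => BE.filter (good ω)
  let G : Finset (Sym2 (V d)) → Set (Sym2 (V d) × Λ → Bool) := fun w => {ω | Wf ω = w}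
  set N : Set (Sym2 (V d) × Λ) := (fun e => (e, l0)) '' ED (Dom \ R) with hN
  have hNf : N.Finite := (ED_finite (hD.subset Set.sdiff_subset)).image _
  have hgood : ∀ ω ω' : Sym2 (V d) × Λ → Bool, (∀ i ∈ N, ω i = ω' i) → ∀ e, good ω e → good ω' e := by
    rintro ω ω' e f ⟨a, ha, b, hb, h1, h2, y, hy, h3⟩
    exact ⟨a, ha, b, hb, h1, h2, y, hy, conn_lyr_dep (fun e' he' => e _ ⟨e', he', rfl⟩) h3⟩
  have hGdep : ∀ w, Dep N (G w) := by
    intro w ω ω' e hw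
    have : Wf ω' = Wf ω := by
      apply Finset.filter_congr
      intro f _
      exact ⟨hgood _ _ (fun i hi => (e i hi).symm) f, hgood _ _ e f⟩
    change Wf ω' = w
    rw [this]; exact hw
  set I : Finset (Finset (Sym2 (V d))) := BE.powerset with hI
  have hdisj : (I : Set (Finset (Sym2 (V d)))).PairwiseDisjoint G := by
    intro w _ w' _ hne
    rw [Function.onFun, Set.disjoint_left]
    intro ω h1 h2
    exact hne (h1.symm.trans h2)
  have hsum : ∑ w ∈ I, Pr P (G w) = 1 := by
    rw [← Pr_biUnion I G hdisj (fun w _ => (hGdep w).meas hNf), ← Pr_univ (p := P)]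
    congr 1
    ext ω
    simp only [Set.mem_iUnion, Set.mem_univ, iff_true]
    exact ⟨Wf ω, Finset.mem_powerset.2 (Finset.filter_subset _ _), rfl⟩
  -- w's that matter consist of edges crossing
  let cr : Set (Sym2 (V d)) := {e | ∃ a ∈ R ∩ Dom, ∃ b ∈ Dom \ R, e = s(a, b)}
  have hcr : ∀ e ∈ cr, e ∉ ED (Dom \ R) := by
    rintro e ⟨a, ha, b, hb, rfl⟩ h
    exact (mem_ED.1 h).1.2 ha.1
  have hGcr : ∀ w, (∃ e ∈ w, e ∉ cr) → G w = ∅ := by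
    rintro w ⟨e, he, hne⟩
    ext ω
    simp only [Set.mem_empty_iff_false, iff_false]
    intro hw
    have hw : Wf ω = w := hw
    rw [← hw] at he
    obtain ⟨a, ha, b, hb, h1, h2, -⟩ := (Finset.mem_filter.1 he).2
    exact hne ⟨a, ha, b, hb, h2⟩
  have hq0 : (0 : ℝ) ≤ 1 - q := by linarith
  have hε0 : (0 : ℝ) ≤ 1 - ε := by linarith [ε.2.2]
  have hε1 : (1 - ε : ℝ) ≤ 1 := by linarith [ε.2.1]
  let emb : Λ → Finset (Sym2 (V d)) → Finset (Sym2 (V d) × Λ) := fun l w => w.image (fun e => (e, l))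
  have hinj : ∀ l : Λ, Function.Injective (fun e : Sym2 (V d) => (e, l)) := fun l a b h =>
    (Prod.mk.inj h).1
  have hprod0 : ∀ w ∈ I, Pr P {ω | ∀ i ∈ emb l0 w, ω i = false} = (1 - q : ℝ) ^ w.card := by
    intro w hw
    rw [Pr_all_false, Finset.prod_image (fun a _ b _ h => hinj l0 h), Finset.prod_congr rfl
      (g := fun _ => (1 - q : ℝ)), Finset.prod_const]
    intro e he
    rw [hP0 e]
    have := Finset.mem_powerset.1 hw he
    simpa [hBE] using this
  have hprod1 : ∀ w ∈ I, Pr P {ω | ∀ i ∈ emb l1 w, ω i = false} = (1 - ε : ℝ) ^ w.card := by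
    intro w hw
    rw [Pr_all_false, Finset.prod_image (fun a _ b _ h => hinj l1 h), Finset.prod_congr rfl
      (g := fun _ => (1 - ε : ℝ)), Finset.prod_const]
    intro e he
    rw [hP1 e]
    have := Finset.mem_powerset.1 hw he
    simpa [hBE] using this
  -- restrict to crossing w
  set J : Finset (Finset (Sym2 (V d))) := I.filter (fun w => ∀ e ∈ w, e ∈ cr) with hJ
  have hJsum : ∀ f : Finset (Sym2 (V d)) → ℝ, ∑ w ∈ J, Pr P (G w) * f w = ∑ w ∈ I, Pr P (G w) * f w := by
    intro f
    rw [hJ, Finset.sum_filter_of_ne]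
    intro w _ hne
    by_contra hcon
    push Not at hcon
    apply hne
    rw [hGcr w hcon, Pr_empty, zero_mul]
  have hJI : ∀ w ∈ J, w ∈ I := fun w hw => (Finset.mem_filter.1 hw).1
  have hJd : (J : Set (Finset (Sym2 (V d)))).PairwiseDisjoint G :=
    hdisj.subset (by intro w hw; exact hJI w hw)
  have key1 : ∑ w ∈ J, Pr P (G w) * (1 - q : ℝ) ^ w.card ≤
      Pr P {ω | lyr ω l0 ∈ (hitE Dom R T)ᶜ} := by
    refine Pr_explore J G (fun w => {ω | ∀ i ∈ emb l0 w, ω i = false}) (fun _ => N)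
      (fun w => (emb l0 w : Set _)) (fun w _ => hGdep w) (fun w _ => Dep_all _ _)
      (fun _ _ => hNf) (fun w _ => (emb l0 w).finite_toSet) ?_ hJd _ ?_ _
      (fun w hw => (hprod0 w (hJI w hw)).ge)
    · intro w hw
      rw [Set.disjoint_left]
      rintro i ⟨e, he, rfl⟩ h2
      simp only [emb, Finset.coe_image, Set.mem_image, Finset.mem_coe] at h2
      obtain ⟨f, hf, hfe⟩ := h2
      have := hinj l0 hfe
      subst this
      exact hcr _ ((Finset.mem_filter.1 hw).2 _ hf) he
    · rintro w hw ω ⟨h1, h2⟩ h3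
      obtain ⟨a, ha, b, hb, hab, y, hy, hc⟩ := last_exit (fun a b => op.symm a b) hRT h3
      have h1 : Wf ω = w := h1
      have hm : s(a, b) ∈ w := by
        rw [← h1]
        refine Finset.mem_filter.2 ⟨?_, a, ha, b, hb, hab.1, rfl, y, hy, hc⟩
        simp only [hBE, Set.Finite.mem_toFinset]
        exact mem_ED.2 ⟨ha.2, hb.1⟩
      have h4 := h2 (s(a, b), l0) (Finset.mem_image_of_mem _ hm)
      have h5 := hab.2
      simp only [lyr] at h5
      rw [h4] at h5
      simp at h5
  have key2 : ∑ w ∈ J, Pr P (G w) * (1 - (1 - ε : ℝ) ^ w.card) ≤ Pr P (sprE l0 l1 Dom R T) := by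
    refine Pr_explore J G (fun w => {ω | ∀ i ∈ emb l1 w, ω i = false}ᶜ) (fun _ => N)
      (fun w => (emb l1 w : Set _)) (fun w _ => hGdep w) (fun w _ => (Dep_all _ _).compl)
      (fun _ _ => hNf) (fun w _ => (emb l1 w).finite_toSet) ?_ hJd _ ?_ _ ?_
    · intro w hw
      rw [Set.disjoint_left]
      rintro i ⟨e, he, rfl⟩ h2
      simp only [emb, Finset.coe_image, Set.mem_image, Finset.mem_coe] at h2
      obtain ⟨f, hf, hfe⟩ := h2
      exact hl (Prod.mk.inj hfe).2.symm
    · rintro w hw ω ⟨h1, h2⟩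
      simp only [Set.mem_compl_iff, Set.mem_ofPred_eq] at h2
      push Not at h2
      obtain ⟨i, hi, hne⟩ := h2
      obtain ⟨e, he, rfl⟩ := Finset.mem_image.1 hi
      have h1 : Wf ω = w := h1
      rw [← h1] at he
      obtain ⟨a, ha, b, hb, hab, rfl, y, hy, hc⟩ := (Finset.mem_filter.1 he).2
      exact ⟨a, ha, b, hb, hab, by simpa using hne, y, hy, hc⟩
    · intro w hw
      rw [Pr_compl ((Dep_all _ _).meas (emb l1 w).finite_toSet), hprod1 w (hJI w hw)]
  have key0 : Pr P {ω | lyr ω l0 ∈ (hitE Dom R T)ᶜ} ≤ δ := by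
    have hm : MeasurableSet (hitE Dom R T) := (hitE_dep _ _ _).meas (ED_finite hD)
    have e := Pr_comap (p := P) (hinj l0) hm.compl
    have e' : Pr P {ω | lyr ω l0 ∈ (hitE Dom R T)ᶜ} = Pr (fun e => P (e, l0)) (hitE Dom R T)ᶜ := e
    rw [e', Pr_compl hm]
    have h1 : Pr (fun e => P (e, l0)) (hitE Dom R T) ≥ Pr (fun _ => q) (hitE Dom R T) :=
      Pr_mono_p (fun i hi => (hP0 i hi).ge) (hitE_dep _ _ _) (ED_finite hD) (hitE_upper _ _ _)
    unfold Pq at h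
    linarith
  rw [hJsum] at key1 key2
  have pw : ∀ k : ℕ, (1 - ε : ℝ) ^ k ≤ ((1 - q : ℝ)⁻¹) ^ t * (1 - q : ℝ) ^ k + (1 - ε : ℝ) ^ t := by
    intro k
    have hq' : (0 : ℝ) < 1 - q := by linarith
    rcases le_total t k with hk | hk
    · have := pow_le_pow_of_le_one hε0 hε1 hk
      have : 0 ≤ ((1 - q : ℝ)⁻¹) ^ t * (1 - q : ℝ) ^ k := by positivity
      linarith
    · have h1 : (1 - ε : ℝ) ^ k ≤ 1 := pow_le_one₀ hε0 hε1
      have h2 : (1 : ℝ) ≤ ((1 - q : ℝ)⁻¹) ^ t * (1 - q : ℝ) ^ k := by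
        rw [inv_pow, inv_mul_eq_div, one_le_div (by positivity)]
        exact pow_le_pow_of_le_one hq0 (by linarith [q.2.1]) hk
      have : 0 ≤ (1 - ε : ℝ) ^ t := by positivity
      linarith
  have fin : ∑ w ∈ I, Pr P (G w) * (1 - ε : ℝ) ^ w.card ≤
      ((1 - q : ℝ)⁻¹) ^ t * δ + (1 - ε : ℝ) ^ t := by
    calc ∑ w ∈ I, Pr P (G w) * (1 - ε : ℝ) ^ w.card
        ≤ ∑ w ∈ I, Pr P (G w) * (((1 - q : ℝ)⁻¹) ^ t * (1 - q : ℝ) ^ w.card + (1 - ε : ℝ) ^ t) :=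
          Finset.sum_le_sum fun w _ => mul_le_mul_of_nonneg_left (pw _) Pr_nonneg
      _ = ((1 - q : ℝ)⁻¹) ^ t * ∑ w ∈ I, Pr P (G w) * (1 - q : ℝ) ^ w.card +
          (∑ w ∈ I, Pr P (G w)) * (1 - ε : ℝ) ^ t := by
          rw [Finset.mul_sum, Finset.sum_mul, ← Finset.sum_add_distrib]
          exact Finset.sum_congr rfl fun w _ => by ring
      _ ≤ _ := by
          rw [hsum, one_mul]
          have : (0 : ℝ) ≤ ((1 - q : ℝ)⁻¹) ^ t := by positivity
          have := mul_le_mul_of_nonneg_left (key1.trans key0) this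
          linarith
  have e2 : ∑ w ∈ I, Pr P (G w) * (1 - (1 - ε : ℝ) ^ w.card) =
      1 - ∑ w ∈ I, Pr P (G w) * (1 - ε : ℝ) ^ w.card := by
    simp only [mul_sub, mul_one, Finset.sum_sub_distrib, hsum]
  rw [e2] at key2
  linarith

/-- The sprinkling lemma in `δ`-`η` form. -/
lemma sprE_exists {q ε : unitInterval} (hq1 : (q : ℝ) < 1) (hε : 0 < (ε : ℝ)) {η : ℝ} (hη : 0 < η) :
    ∃ δ > 0, ∀ (Λ : Type) (l0 l1 : Λ), l0 ≠ l1 → ∀ P : Sym2 (V d) × Λ → unitInterval,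
      ∀ Dom R T : Set (V d), Dom.Finite → (∀ e ∈ ED Dom, P (e, l0) = q) →
      (∀ e ∈ ED Dom, P (e, l1) = ε) → Disjoint R T →
      1 - δ ≤ Pq q (hitE Dom R T) → 1 - η ≤ Pr P (sprE l0 l1 Dom R T) := by
  obtain ⟨t, ht⟩ := exists_pow_lt_of_lt_one (half_pos hη) (show (1 - ε : ℝ) < 1 by linarith)
  have hq' : (0 : ℝ) < 1 - q := by linarith
  refine ⟨η / 2 * (1 - q : ℝ) ^ t, by positivity, ?_⟩
  intro Λ l0 l1 hl P Dom R T hD h0 h1 hRT h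
  refine le_trans ?_ (sprE_prob hl hq1 hD h0 h1 hRT h t)
  have : η / 2 * (1 - q : ℝ) ^ t * ((1 - q : ℝ)⁻¹) ^ t = η / 2 := by
    rw [inv_pow, mul_assoc, mul_inv_cancel₀ (by positivity), mul_one]
  rw [this]
  linarith

/-! ### Exploration of a cluster -/

/-- The cluster of `X` in `D`. -/
def clus (O : V d → V d → Prop) (D X : Set (V d)) : Set (V d) := {v | ∃ x ∈ X, conn O D x v}

lemma sub_clus {O : V d → V d → Prop} {D X : Set (V d)} : X ⊆ clus O D X :=
  fun x hx => ⟨x, hx, conn.refl⟩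

lemma clus_sub {O : V d → V d → Prop} {D X : Set (V d)} : clus O D X ⊆ X ∪ D := by
  rintro v ⟨x, hx, h⟩
  by_cases hxD : x ∈ D
  · exact Or.inr (h.mem hxD)
  · left
    rcases Relation.ReflTransGen.cases_head h with h | ⟨w, h, -⟩
    · exact h ▸ hx
    · exact absurd h.1 hxD

lemma clus_step {O : V d → V d → Prop} {D X : Set (V d)} {a b : V d} (ha : a ∈ clus O D X)
    (haD : a ∈ D) (hbD : b ∈ D) (h : O a b) : b ∈ clus O D X := by
  obtain ⟨x, hx, hc⟩ := ha
  exact ⟨x, hx, hc.trans (conn.single h haD hbD)⟩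

/-- The cluster is determined by the edges touching it. -/
lemma clus_dep {ω ω' : Sym2 (V d) → Bool} {D X ρ : Set (V d)}
    (h : ∀ e ∈ ED D, (∃ v ∈ e, v ∈ ρ) → ω e = ω' e) (hρ : clus (op ω) D X = ρ) :
    clus (op ω') D X = ρ := by
  have h1 : clus (op ω') D X ⊆ ρ := by
    rintro v ⟨x, hx, hc⟩
    refine hc.closed (hρ ▸ sub_clus hx) ?_
    intro a b ha haD hbD hab
    rw [← hρ] at ha ⊢
    refine clus_step ha haD hbD ⟨hab.1, ?_⟩
    rw [h _ (mem_ED.2 ⟨haD, hbD⟩) ⟨a, by simp, hρ ▸ ha⟩]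
    exact hab.2
  refine Set.Subset.antisymm h1 ?_
  intro v hv
  rw [← hρ] at hv
  obtain ⟨x, hx, hc⟩ := hv
  have : conn (op ω) {v | v ∈ D ∧ conn (op ω) D x v} x v := hc.self
  refine ⟨x, hx, this.mono ?_ (fun v hv => hv.1)⟩
  intro a ha b hb hab
  refine ⟨hab.1, ?_⟩
  rw [← h _ (mem_ED.2 ⟨ha.1, hb.1⟩) ⟨a, by simp, hρ ▸ ⟨x, hx, ha.2⟩⟩]
  exact hab.2

lemma clus_LC {O : V d → V d → Prop} (hO : ∀ a b, O a b → adj a b)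
    {D X : Set (V d)} (hX : LC X) : LC (clus O D X) := by
  have key : ∀ x ∈ X, ∀ v, conn O D x v → conn adj (clus O D X) x v := by
    intro x hx v h
    rcases Relation.ReflTransGen.cases_head h with h' | ⟨w, hw, -⟩
    · exact h' ▸ conn.refl
    have hxD := hw.1
    refine h.self.mono (fun a _ b _ h => hO a b h) ?_
    rintro u ⟨-, hu⟩
    exact ⟨x, hx, hu⟩
  rintro u ⟨x, hx, hu⟩ v ⟨y, hy, hv⟩
  exact ((key x hx u hu).symm (fun a b h => h.symm)).trans
    (((hX x hx y hy).mono_set sub_clus).trans (key y hy v hv))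

end sprinkle

/-! ## Part E: the walker -/

section walker
variable {d : ℕ}

lemma abs_step {a v z M n : ℤ} {u : ℤˣ} (hu : (u : ℤ) * a ≤ 0) 
    (h1 : -M ≤ (u : ℤ) * (v - z)) (h2 : |v - z| ≤ n + 2 * M) (hM : 2 * M ≤ n) (hM0 : 0 ≤ M) :
    max |a + (v - z)| (2 * n) ≤ max |a| (2 * n) + M := by
  generalize v - z = w at *
  rw [abs_le] at h2
  rcases Int.units_eq_one_or u with h | h <;> subst h <;>
    simp only [Units.val_one, one_mul, Units.val_neg, neg_mul] at * <;>
    · refine max_le ?_ (by have := le_max_right |a| (2 * n); omega)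
      have e1 := le_max_right |a| (2 * n)
      have e2 := le_max_left |a| (2 * n)
      have e3 := neg_le_abs a
      have e4 := le_abs_self a
      rw [abs_le]
      constructor <;> omega

/-- The walker potential. -/
def pot (c z : V d) (n : ℤ) : ℤ := ∑ i, max |z i - c i| (2 * n)

lemma pot_coord (c z : V d) {n : ℤ} (i : Fin d) :
    |z i - c i| + 2 * n * d ≤ pot c z n + 2 * n := by
  unfold pot
  rw [← Finset.add_sum_erase _ _ (Finset.mem_univ i)]
  have h : (∑ _j ∈ Finset.univ.erase i, (2 * n)) ≤
      ∑ j ∈ Finset.univ.erase i, max |z j - c j| (2 * n) :=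
    Finset.sum_le_sum fun j _ => le_max_right _ _
  rw [Finset.sum_const, Finset.card_erase_of_mem (Finset.mem_univ i), Finset.card_univ,
    Fintype.card_fin, nsmul_eq_mul] at h
  have hd : 1 ≤ d := i.pos
  rw [Nat.cast_sub hd] at h
  have := le_max_left |z i - c i| (2 * n)
  push_cast at h
  nlinarith

lemma walker_aux (j : ℕ) (hj : j ≤ 4 * d) : ∀ (q p : unitInterval), q < p → perc d q →
    ∀ η : ℝ, 0 < η → ∃ n0 : ℕ, ∀ n : ℕ, n0 ≤ n → ∀ (c : V d) (X : Set (V d)), X.Finite → LC X →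
    ∀ z ∈ X, (∃ w ∈ X, w ∉ bx z (n - 1)) → 2 * pot c z n ≤ 4 * d * n + j * n →
    1 - η ≤ Pq p (hitE (bx c ((2 * d + 4) * n)) X (bx c (3 * n))) := by
  induction j with
  | zero =>
    intro q p hqp hq η hη
    refine ⟨0, ?_⟩
    intro n _ c X hXf hX z hz hw hpot
    have : hitE (bx c ((2 * d + 4) * n)) X (bx c (3 * n)) = Set.univ := by
      ext ω
      simp only [Set.mem_univ, iff_true]
      refine ⟨z, hz, z, ?_, conn.refl⟩
      intro i
      have := pot_coord c z (n := n) i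
      push_cast at hpot
      nlinarith
    rw [this]
    unfold Pq
    rw [Pr_univ]
    linarith
  | succ j ih =>
    classical
    intro q p hqp hq η hη
    obtain ⟨q', hq1, hq2⟩ := exists_between hqp
    obtain ⟨ε, hε, hεp⟩ := two_layer hq2
    have hq'1 : (q' : ℝ) < 1 := lt_of_lt_of_le (by exact_mod_cast hq2) p.2.2
    obtain ⟨δ, hδ, hS⟩ := sprE_exists (d := d) hq'1 hε (half_pos hη)
    obtain ⟨n1, hn1⟩ := ih (by omega) q q' hq1 hq δ hδ
    obtain ⟨M, hM⟩ := star_hit hq1 hq (half_pos hη)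
    refine ⟨max n1 (2 * (d + 1) * M), ?_⟩
    intro n hn c X hXf hX z hz hw hpot
    have hnn1 : n1 ≤ n := le_trans (le_max_left _ _) hn
    have hnM : 2 * (d + 1) * M ≤ n := le_trans (le_max_right _ _) hn
    have hnM' : 2 * M ≤ n := by nlinarith
    set Dom := bx c ((2 * d + 4) * n) with hDom
    have hDf : Dom.Finite := bx_finite _ _
    set T := bx c (3 * (n : ℤ)) with hT
    by_cases hzT : ∃ x ∈ X, x ∈ T
    · obtain ⟨x, hx, hxT⟩ := hzT
      have : hitE Dom X T = Set.univ := by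
        ext ω
        simp only [Set.mem_univ, iff_true]
        exact ⟨x, hx, x, hxT, conn.refl⟩
      rw [this]
      unfold Pq
      rw [Pr_univ]
      linarith
    push Not at hzT
    have hzc := hzT z hz
    have : ∃ k, 3 * (n : ℤ) < |z k - c k| := by
      by_contra hcon
      push Not at hcon
      exact hzc hcon
    obtain ⟨k, hk⟩ := this
    -- signs
    let τ : Fin d → ℤˣ := fun i => if 0 ≤ z i - c i then -1 else 1
    have hτ : ∀ i, (τ i : ℤ) * (z i - c i) = -|z i - c i| := by
      intro i
      by_cases h : 0 ≤ z i - c i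
      · simp only [τ, h, if_true, Units.val_neg, Units.val_one, abs_of_nonneg h]; ring
      · simp only [τ, h, if_false, Units.val_one, abs_of_neg (not_le.1 h)]; ring
    have hbox : bx z (n + 2 * M) ⊆ Dom := by
      apply bx_sub
      intro i
      have h1 := pot_coord c z (n := n) i
      have h2 : ((j + 1 : ℕ) : ℤ) ≤ 4 * d := by exact_mod_cast hj
      have h3 : ((j + 1 : ℕ) : ℤ) * n ≤ 4 * d * n := mul_le_mul_of_nonneg_right h2 (by positivity)
      have h4 : (2 * M : ℤ) ≤ n := by exact_mod_cast hnM'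
      nlinarith
    have hn0 : 0 < n := by
      rcases Nat.eq_zero_or_pos n with h | h
      · exfalso
        subst h
        have hh := pot_coord c z (n := ((0 : ℕ) : ℤ)) k
        push_cast at hh hk hpot
        simp only [mul_zero] at hpot
        omega
      · exact h
    have hpot' : ∀ z' ∈ tgt z k τ n M, 2 * pot c z' n ≤ 4 * d * n + j * n := by
      rintro z' ⟨h1, h2, h3⟩
      have hn4 : (2 * M : ℤ) ≤ n := by exact_mod_cast hnM'
      have hn5 : (2 * (d + 1) * M : ℤ) ≤ n := by exact_mod_cast hnM
      have e1 : ∀ i, max |z' i - c i| (2 * (n : ℤ)) ≤ max |z i - c i| (2 * n) + M := by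
        intro i
        have := abs_step (a := z i - c i) (v := z' i) (z := z i) (M := M) (n := n) (u := τ i)
          (by rw [hτ]; simp) (h3 i) (h1 i) hn4 (by positivity)
        have e : z i - c i + (z' i - z i) = z' i - c i := by ring
        rwa [e] at this
      have e2 : max |z' k - c k| (2 * (n : ℤ)) + n ≤ max |z k - c k| (2 * n) := by
        have e4 := hτ k
        have hk' := hk
        rcases Int.units_eq_one_or (τ k) with h | h <;> rw [h] at h2 e4 <;>
          simp only [Units.val_one, one_mul, Units.val_neg, neg_mul] at h2 e4
        · have : |z' k - c k| = |z k - c k| - n := by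
            rw [abs_of_nonpos (a := z' k - c k)] <;> omega
          omega
        · have : |z' k - c k| = |z k - c k| - n := by
            rw [abs_of_nonneg (a := z' k - c k)] <;> omega
          omega
      have e3 : pot c z' n + n ≤ pot c z n + d * M := by
        unfold pot
        rw [← Finset.add_sum_erase _ (fun i => max |z' i - c i| (2 * (n : ℤ))) (Finset.mem_univ k),
          ← Finset.add_sum_erase _ (fun i => max |z i - c i| (2 * (n : ℤ))) (Finset.mem_univ k)]
        have h : ∑ i ∈ Finset.univ.erase k, max |z' i - c i| (2 * (n : ℤ)) ≤
            ∑ i ∈ Finset.univ.erase k, (max |z i - c i| (2 * n) + M) :=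
          Finset.sum_le_sum fun i _ => e1 i
        rw [Finset.sum_add_distrib, Finset.sum_const, Finset.card_erase_of_mem (Finset.mem_univ k),
          Finset.card_univ, Fintype.card_fin, nsmul_eq_mul] at h
        have h5 : ((d - 1 : ℕ) : ℤ) * M ≤ d * M :=
          mul_le_mul_of_nonneg_right (by exact_mod_cast Nat.sub_le d 1) (by positivity)
        linarith
      push_cast at hpot
      nlinarith
    -- the exploration
    set Bz := bx z (n + 2 * M) with hBz
    have hBf : Bz.Finite := bx_finite _ _
    set P := lay2 (d := d) q' ε with hP
    have hP0 : ∀ e, P (e, false) = q' := fun e => by simp [hP, lay2]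
    have hP1 : ∀ e, P (e, true) = ε := fun e => by simp [hP, lay2]
    set I : Finset (Set (V d)) := ((hXf.union hBf).finite_subsets.toFinset).filter
      (fun ρ => (∃ v ∈ ρ, v ∈ tgt z k τ n M) ∧ X ⊆ ρ ∧ LC ρ) with hI
    let G : Set (V d) → Set (Sym2 (V d) × Bool → Bool) := fun ρ =>
      {ω | clus (op (lyr ω false)) Bz X = ρ}
    let S : Set (V d) → Set (Sym2 (V d) × Bool) := fun ρ =>
      (fun e => (e, false)) '' {e | e ∈ ED Bz ∧ ∃ v ∈ e, v ∈ ρ}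
    have hSf : ∀ ρ, (S ρ).Finite := fun ρ => ((ED_finite hBf).subset fun e he => he.1).image _
    have hGd : ∀ ρ, Dep (S ρ) (G ρ) := by
      intro ρ ω ω' e h
      exact clus_dep (fun f hf hf' => e _ ⟨f, ⟨hf, hf'⟩, rfl⟩) h
    have hGdis : (I : Set (Set (V d))).PairwiseDisjoint G := by
      intro w _ w' _ hne
      rw [Function.onFun, Set.disjoint_left]
      intro ω h1 h2
      exact hne (h1.symm.trans h2)
    have hinj : Function.Injective (fun e : Sym2 (V d) => (e, false)) := fun a b h =>
      (Prod.mk.inj h).1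
    have hstar : 1 - η / 2 ≤ ∑ ρ ∈ I, Pr P (G ρ) := by
      rw [← Pr_biUnion I G hGdis (fun w _ => (hGd w).meas (hSf w))]
      have h1 := hM n hnM' X hX z hz (by
        obtain ⟨w, hw, hwz⟩ := hw
        refine ⟨w, hw, fun h => hwz (bx_mono ?_ h)⟩
        have : (2 * M : ℤ) ≤ n := by exact_mod_cast hnM'
        omega) k τ
      have hm : MeasurableSet (hitE Bz X (tgt z k τ n M)) := (hitE_dep _ _ _).meas (ED_finite hBf)
      have e := Pr_comap (p := P) hinj hm
      have e' : Pr P {ω | lyr ω false ∈ hitE Bz X (tgt z k τ n M)} =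
        Pq q' (hitE Bz X (tgt z k τ n M)) := by
        unfold Pq
        simp only [hP0] at e
        exact e
      rw [← e'] at h1
      refine h1.trans (Pr_mono ?_)
      rintro ω ⟨x, hx, y, hy, hc⟩
      simp only [Set.mem_iUnion]
      refine ⟨clus (op (lyr ω false)) Bz X, ?_, rfl⟩
      rw [hI, Finset.mem_filter, Set.Finite.mem_toFinset]
      exact ⟨clus_sub, ⟨y, ⟨x, hx, hc⟩, hy⟩, sub_clus,
        clus_LC (fun a b h => h.1) hX⟩
    have hex := Pr_explore (p := P) I G
      (fun ρ => if (∃ v ∈ ρ, v ∈ T) then Set.univ else sprE false true Dom ρ T) S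
      (fun ρ => (fun e => (e, false)) '' ED (Dom \ ρ) ∪ (fun e => (e, true)) '' ED Dom)
      (fun ρ _ => hGd ρ)
      (by
        intro ρ _
        split_ifs with h
        · intro ω ω' _ _; trivial
        · rintro ω ω' e ⟨a, ha, b, hb, hab, h1, y, hy, hc⟩
          refine ⟨a, ha, b, hb, hab, ?_, y, hy, conn_lyr_dep (fun f hf => ?_) hc⟩
          · rw [← e _ (Or.inr ⟨s(a, b), mem_ED.2 ⟨ha.2, hb.1⟩, rfl⟩)]; exact h1
          · exact e _ (Or.inl ⟨f, hf, rfl⟩))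
      (fun ρ _ => hSf ρ)
      (fun ρ _ => ((ED_finite (hDf.subset Set.sdiff_subset)).image _).union
        ((ED_finite hDf).image _))
      (by
        intro ρ _
        rw [Set.disjoint_left]
        rintro _ ⟨e, ⟨he, v, hv, hvρ⟩, rfl⟩ (⟨f, hf, hfe⟩ | ⟨f, hf, hfe⟩)
        · have := hinj hfe
          subst this
          exact (hf v hv).2 hvρ
        · exact absurd (congrArg Prod.snd hfe) (by simp))
      hGdis {ω | orL ω ∈ hitE Dom X T}
      (by
        rintro ρ hρ ω ⟨h1, h2⟩
        have h1 : clus (op (lyr ω false)) Bz X = ρ := h1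
        have hor : ∀ a b l, op (lyr ω l) a b → op (orL ω) a b := by
          intro a b l h
          refine ⟨h.1, ?_⟩
          simp only [orL, decide_eq_true_eq]
          exact ⟨l, h.2⟩
        have hto : ∀ v ∈ ρ, ∃ x ∈ X, conn (op (orL ω)) Dom x v := by
          intro v hv
          rw [← h1] at hv
          obtain ⟨x, hx, hc⟩ := hv
          exact ⟨x, hx, hc.mono (fun a _ b _ h => hor a b _ h) hbox⟩
        split_ifs at h2 with h
        · obtain ⟨v, hv, hvT⟩ := h
          obtain ⟨x, hx, hc⟩ := hto v hv
          exact ⟨x, hx, v, hvT, hc⟩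
        · obtain ⟨a, ha, b, hb, hab, h3, y, hy, hc⟩ := h2
          obtain ⟨x, hx, hxa⟩ := hto a ha.1
          refine ⟨x, hx, y, hy, hxa.trans ((conn.single (hor a b true ⟨hab, h3⟩) ha.2 hb.1).trans ?_)⟩
          exact hc.mono (fun a _ b _ h => hor a b _ h) Set.sdiff_subset)
      (fun _ => 1 - η / 2)
      (by
        intro ρ hρ
        rw [hI, Finset.mem_filter, Set.Finite.mem_toFinset] at hρ
        obtain ⟨hsub, ⟨v, hv, hvt⟩, hXρ, hLC⟩ := hρ
        split_ifs with h
        · rw [Pr_univ]; linarith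
        · push Not at h
          refine hS Bool false true (by simp) P Dom ρ T hDf (fun e _ => hP0 e) (fun e _ => hP1 e)
            (Set.disjoint_left.2 h) ?_
          refine hn1 n hnn1 c ρ ((hXf.union hBf).subset hsub) hLC v hv ⟨z, hXρ hz, ?_⟩ (hpot' v hvt)
          intro hzv
          have h4 := hzv k
          have h5 := hvt.2.1
          have h6 : |(τ k : ℤ) * (v k - z k)| = n := by rw [h5]; simp
          rw [unit_mul_abs, abs_sub_comm] at h6
          omega)
    have hfin := Pr_or (p := P) (P := fun _ => p) (S := ED Dom) (by
      intro i _
      rw [Fintype.prod_bool]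
      rw [hP0, hP1]
      linarith) (hitE_dep Dom X T) (ED_finite hDf) (hitE_upper _ _ _)
    rw [← Finset.sum_mul] at hex
    have : (1 - η / 2) * (1 - η / 2) ≤ (∑ ρ ∈ I, Pr P (G ρ)) * (1 - η / 2) ∨ 1 - η / 2 < 0 := by
      rcases le_or_gt 0 (1 - η / 2) with h | h
      · exact Or.inl (mul_le_mul_of_nonneg_right hstar h)
      · exact Or.inr h
    unfold Pq
    rcases this with h | h
    · nlinarith [sq_nonneg η]
    · have := Pr_nonneg (p := fun _ : Sym2 (V d) => p) (A := hitE Dom X T)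
      linarith

/-- A large connected set near a box gets connected to the box. -/
lemma walker {q p : unitInterval} (hqp : q < p) (hq : perc d q) {η : ℝ} (hη : 0 < η) :
    ∃ n0 : ℕ, ∀ n : ℕ, n0 ≤ n → ∀ (c : V d) (X : Set (V d)), X.Finite → LC X →
    ∀ z ∈ X, (∃ w ∈ X, w ∉ bx z (n - 1)) → z ∈ bx c (4 * n) →
    1 - η ≤ Pq p (hitE (bx c ((2 * d + 4) * n)) X (bx c (3 * n))) := by
  obtain ⟨n0, h⟩ := walker_aux (4 * d) le_rfl q p hqp hq η hη
  refine ⟨n0, fun n hn c X hXf hX z hz hw hzc => h n hn c X hXf hX z hz hw ?_⟩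
  have : pot c z n ≤ ∑ _i : Fin d, 4 * (n : ℤ) :=
    Finset.sum_le_sum fun i _ => max_le (hzc i) (by omega)
  rw [Finset.sum_const, Finset.card_univ, Fintype.card_fin, nsmul_eq_mul] at this
  push_cast
  nlinarith

end walker

/-! ## Part F: block dynamics -/

section blocks
variable {d : ℕ}

/-- Star adjacency (or equality). -/
def sadj (a b : V d) : Prop := ∀ i, |a i - b i| ≤ 1

lemma sadj.symm {a b : V d} (h : sadj a b) : sadj b a := fun i => by
  rw [abs_sub_comm]; exact h i

/-- Centre of the block `b`. -/
def cb (n : ℕ) (b : V d) : V d := fun i => (n : ℤ) * b i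

/-- Visited blocks. -/
def vis (n : ℕ) (R : Set (V d)) : Set (V d) := {b | ∃ v ∈ R, v ∈ bx (cb n b) (3 * n)}

lemma vis_mono {n : ℕ} {R R' : Set (V d)} (h : R ⊆ R') : vis n R ⊆ vis n R' :=
  fun _ ⟨v, hv, hb⟩ => ⟨v, h hv, hb⟩

/-- Site percolation event: `W` is star-connected to `t` by open sites of `U`. -/
def HE (U W : Set (V d)) (t : V d) : Set (V d → Bool) :=
  {σ | ∃ v ∈ W, conn sadj (W ∪ {u | u ∈ U ∧ σ u = true}) v t}

lemma HE_dep (U W : Set (V d)) (t : V d) : Dep U (HE U W t) := by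
  rintro σ σ' e ⟨v, hv, h⟩
  refine ⟨v, hv, h.mono_set ?_⟩
  rintro x (hx | hx)
  · exact Or.inl hx
  · exact Or.inr ⟨hx.1, by rw [← e x hx.1]; exact hx.2⟩

lemma HE_upper (U W : Set (V d)) (t : V d) : IsUpperSet (HE U W t) := by
  rintro σ σ' h ⟨v, hv, hc⟩
  refine ⟨v, hv, hc.mono_set ?_⟩
  rintro x (hx | hx)
  · exact Or.inl hx
  · refine Or.inr ⟨hx.1, ?_⟩
    have := h x
    rw [hx.2] at this
    exact top_le_iff.1 this

lemma HE_mono {U W U' W' : Set (V d)} (t : V d) (hW : W ⊆ W') (hU : U ⊆ U' ∪ W') :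
    HE U W t ⊆ HE U' W' t := by
  rintro σ ⟨v, hv, hc⟩
  refine ⟨v, hW hv, hc.mono_set ?_⟩
  rintro x (hx | hx)
  · exact Or.inl (hW hx)
  · rcases hU hx.1 with h | h
    · exact Or.inr ⟨h, hx.2⟩
    · exact Or.inl h

lemma LC_attach {R R' : Set (V d)} (hR : LC R) (hRR : R ⊆ R')
    (h : ∀ v ∈ R', ∃ r ∈ R, conn adj R' r v) : LC R' := by
  intro x hx y hy
  obtain ⟨r, hr, h1⟩ := h x hx
  obtain ⟨r', hr', h2⟩ := h y hy
  exact (h1.symm fun a b h => h.symm).trans (((hR r hr r' hr').mono_set hRR).trans h2)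

variable {n : ℕ} {Bk : Finset (V d)}

/-- The domain of a block. -/
def dom (n : ℕ) (b : V d) : Set (V d) := bx (cb n b) ((2 * d + 4) * n)

lemma dom_finite (n : ℕ) (b : V d) : (dom n b).Finite := bx_finite _ _

/-- The union of the block domains. -/
def QQ (n : ℕ) (Bk : Finset (V d)) : Set (V d) := ⋃ b ∈ Bk, dom n b

lemma QQ_finite (n : ℕ) (Bk : Finset (V d)) : (QQ n Bk).Finite :=
  Set.Finite.biUnion Bk.finite_toSet fun b _ => dom_finite n b

/-- Edges available when `R` is explored and the layers `U` are fresh. -/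
def OU (ω : Sym2 (V d) × Option Bk → Bool) (R : Set (V d)) (U : Finset (V d)) (a b : V d) : Prop :=
  (a ∉ R ∧ b ∉ R ∧ op (lyr ω none) a b) ∨ ∃ b' : Bk, b'.1 ∈ U ∧ op (lyr ω (some b')) a b

/-- The event that `R` is connected to `T` by the available edges. -/
def AE (n : ℕ) (Bk : Finset (V d)) (R : Set (V d)) (U : Finset (V d)) (T : Set (V d)) :
    Set (Sym2 (V d) × Option Bk → Bool) := {ω | hit (OU ω R U) (QQ n Bk) R T}

/-- The coordinates the event `AE` depends on. -/
def TT (n : ℕ) (Bk : Finset (V d)) (R : Set (V d)) (U : Finset (V d)) :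
    Set (Sym2 (V d) × Option Bk) :=
  {i | i.1 ∈ ED (QQ n Bk) ∧ ((i.2 = none ∧ i.1 ∈ ED Rᶜ) ∨ ∃ b' : Bk, b'.1 ∈ U ∧ i.2 = some b')}

lemma TT_finite (R : Set (V d)) (U : Finset (V d)) : (TT n Bk R U).Finite := by
  refine ((ED_finite (QQ_finite n Bk)).prod (Set.finite_univ (α := Option Bk))).subset ?_
  rintro ⟨e, l⟩ h
  exact ⟨h.1, trivial⟩

lemma AE_dep (R : Set (V d)) (U : Finset (V d)) (T : Set (V d)) :
    Dep (TT n Bk R U) (AE n Bk R U T) := by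
  rintro ω ω' e ⟨x, hx, y, hy, h⟩
  refine ⟨x, hx, y, hy, h.mono ?_ le_rfl⟩
  rintro a ha b hb (⟨h1, h2, h3⟩ | ⟨b', hb', h3⟩)
  · refine Or.inl ⟨h1, h2, h3.1, ?_⟩
    have := e (s(a, b), none) ⟨mem_ED.2 ⟨ha, hb⟩, Or.inl ⟨rfl, mem_ED.2 ⟨h1, h2⟩⟩⟩
    unfold lyr
    rw [← this]
    exact h3.2
  · refine Or.inr ⟨b', hb', h3.1, ?_⟩
    have := e (s(a, b), some b') ⟨mem_ED.2 ⟨ha, hb⟩, Or.inr ⟨b', hb', rfl⟩⟩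
    unfold lyr
    rw [← this]
    exact h3.2

/-- Sites reached from `R` by an edge of layer `u`. -/
def YY (ω : Sym2 (V d) × Option Bk → Bool) (n : ℕ) (u : Bk) (R : Set (V d)) : Set (V d) :=
  {b | b ∈ dom n u.1 \ R ∧ ∃ a ∈ R ∩ dom n u.1, adj a b ∧ ω (s(a, b), some u) = true}

/-- The explored set after trying block `u`. -/
def newR (ω : Sym2 (V d) × Option Bk → Bool) (n : ℕ) (u : Bk) (R : Set (V d)) : Set (V d) :=
  R ∪ clus (op (lyr ω none)) (dom n u.1 \ R) (YY ω n u R)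

/-- Coordinates determining `newR = ρ`. -/
def SS (n : ℕ) (u : Bk) (R ρ : Set (V d)) : Set (Sym2 (V d) × Option Bk) :=
  {i | i.1 ∈ ED (dom n u.1) ∧ (i.2 = some u ∨ (i.2 = none ∧ ∃ v ∈ i.1, v ∈ ρ \ R))}

lemma SS_finite (u : Bk) (R ρ : Set (V d)) : (SS n u R ρ).Finite := by
  refine ((ED_finite (dom_finite n u.1)).prod (Set.finite_univ (α := Option Bk))).subset ?_
  rintro ⟨e, l⟩ h
  exact ⟨h.1, trivial⟩

lemma newR_dep (u : Bk) (R ρ : Set (V d)) :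
    Dep (SS n u R ρ) {ω : Sym2 (V d) × Option Bk → Bool | newR ω n u R = ρ} := by
  intro ω ω' e h
  have h : newR ω n u R = ρ := h
  have hY : YY ω' n u R = YY ω n u R := by
    ext b
    constructor
    · rintro ⟨hb, a, ha, hab, h1⟩
      refine ⟨hb, a, ha, hab, ?_⟩
      rw [e (s(a, b), some u) ⟨mem_ED.2 ⟨ha.2, hb.1⟩, Or.inl rfl⟩]; exact h1
    · rintro ⟨hb, a, ha, hab, h1⟩
      refine ⟨hb, a, ha, hab, ?_⟩
      rw [← e (s(a, b), some u) ⟨mem_ED.2 ⟨ha.2, hb.1⟩, Or.inl rfl⟩]; exact h1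
  change newR ω' n u R = ρ
  rw [← h]
  unfold newR
  rw [hY]
  congr 1
  refine clus_dep (ω := lyr ω none) ?_ rfl
  rintro f hf ⟨v, hv, hvρ⟩
  refine e (f, none) ⟨fun w hw => (hf w hw).1, Or.inr ⟨rfl, v, hv, ?_, (hf v hv).2⟩⟩
  rw [← h]
  exact Or.inr hvρ

lemma newR_LC (ω : Sym2 (V d) × Option Bk → Bool) (u : Bk) {R : Set (V d)} (hR : LC R) :
    LC (newR ω n u R) := by
  refine LC_attach hR Set.subset_union_left ?_
  intro v hv
  rcases hv with hv | ⟨b, ⟨hb, a, ha, hab, h1⟩, hc⟩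
  · exact ⟨v, hv, conn.refl⟩
  · have hbn : b ∈ newR ω n u R := Or.inr (sub_clus ⟨hb, a, ha, hab, h1⟩)
    refine ⟨a, ha.1, (conn.single hab (Or.inl ha.1) hbn).trans ?_⟩
    refine hc.self.mono (fun x _ y _ hxy => hxy.1) ?_
    intro x hx
    exact Or.inr ⟨b, ⟨hb, a, ha, hab, h1⟩, hx.2⟩

lemma newR_sub (ω : Sym2 (V d) × Option Bk → Bool) (u : Bk) (R : Set (V d)) :
    newR ω n u R ⊆ R ∪ dom n u.1 := by
  rintro v (hv | hv)
  · exact Or.inl hv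
  · rcases clus_sub hv with h | h
    · exact Or.inr h.1.1
    · exact Or.inr h.1

lemma dyn {P : Sym2 (V d) × Option Bk → unitInterval} {sp : unitInterval}
    (hS : ∀ (u : Bk) (R : Set (V d)), R.Finite → LC R → (∃ c0, bx c0 n ⊆ R) →
      (∃ z ∈ R, z ∈ bx (cb n u.1) (4 * n)) → Disjoint R (bx (cb n u.1) (3 * n)) →
      (sp : ℝ) ≤ Pr P (sprE none (some u) (dom n u.1) R (bx (cb n u.1) (3 * n)))) (t : V d) :
    ∀ U : Finset (V d), U ⊆ Bk → ∀ R : Set (V d), R.Finite → LC R → (∃ c0, bx c0 n ⊆ R) →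
      Pr (fun _ => sp) (HE U (vis n R) t) ≤ Pr P (AE n Bk R U (bx (cb n t) (3 * n))) := by
  classical
  intro U
  induction U using Finset.strongInduction with
  | H U ih =>
  intro hU R hRf hR hbox
  by_cases ht : t ∈ vis n R
  · have : AE n Bk R U (bx (cb n t) (3 * n)) = Set.univ := by
      ext ω
      simp only [Set.mem_univ, iff_true]
      obtain ⟨v, hv, hvt⟩ := ht
      exact ⟨v, hv, v, hvt, conn.refl⟩
    rw [this, Pr_univ]
    exact Pr_le_one
  by_cases hex : ∃ u ∈ U, u ∉ vis n R ∧ ∃ v ∈ vis n R, sadj v u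
  swap
  · have : HE U (vis n R) t = ∅ := by
      ext σ
      simp only [Set.mem_empty_iff_false, iff_false]
      rintro ⟨v, hv, hc⟩
      refine ht (hc.closed hv ?_)
      intro a b ha _ hb hab
      by_contra hb'
      rcases hb with hb | hb
      · exact hb' hb
      · exact hex ⟨b, hb.1, hb', a, ha, hab⟩
    rw [this, Pr_empty]
    exact Pr_nonneg
  obtain ⟨u, huU, huV, v, hv, hvu⟩ := hex
  set u' : Bk := ⟨u, hU huU⟩ with hu'
  have hsub : U.erase u ⊂ U := Finset.erase_ssubset huU
  set T := bx (cb n u) (3 * n) with hT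
  have hRT : Disjoint R T := by
    rw [Set.disjoint_left]
    intro w hw hwT
    exact huV ⟨w, hw, hwT⟩
  have hz : ∃ z ∈ R, z ∈ bx (cb n u) (4 * n) := by
    obtain ⟨z, hz, hzv⟩ := hv
    refine ⟨z, hz, bx_sub ?_ hzv⟩
    intro i
    have h1 := hvu i
    have : cb n v i - cb n u i = n * (v i - u i) := by simp [cb]; ring
    rw [this, abs_mul, Nat.abs_cast]
    nlinarith
  have hspr := hS u' R hRf hR hbox hz hRT
  set I : Finset (Set (V d)) := ((hRf.union (dom_finite n u)).finite_subsets.toFinset).filter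
      (fun ρ => R ⊆ ρ ∧ LC ρ) with hI
  let G : Set (V d) → Set (Sym2 (V d) × Option Bk → Bool) := fun ρ => {ω | newR ω n u' R = ρ}
  have hGd : ∀ ρ, Dep (SS n u' R ρ) (G ρ) := fun ρ => newR_dep u' R ρ
  have hGm : ∀ ρ, MeasurableSet (G ρ) := fun ρ => (hGd ρ).meas (SS_finite u' R ρ)
  have hGdis : (I : Set (Set (V d))).PairwiseDisjoint G := by
    intro w _ w' _ hne
    rw [Function.onFun, Set.disjoint_left]
    intro ω h1 h2
    exact hne (h1.symm.trans h2)
  have hmemI : ∀ ω : Sym2 (V d) × Option Bk → Bool, newR ω n u' R ∈ I := by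
    intro ω
    rw [hI, Finset.mem_filter, Set.Finite.mem_toFinset]
    exact ⟨newR_sub ω u' R, Set.subset_union_left, newR_LC ω u' hR⟩
  have hsum : ∑ ρ ∈ I, Pr P (G ρ) = 1 := by
    rw [← Pr_biUnion I G hGdis (fun w _ => hGm w), ← Pr_univ (p := P)]
    congr 1
    ext ω
    simp only [Set.mem_iUnion, Set.mem_univ, iff_true]
    exact ⟨_, hmemI ω, rfl⟩
  have hsum2 : (sp : ℝ) ≤ ∑ ρ ∈ I.filter (fun ρ => u ∈ vis n ρ), Pr P (G ρ) := by
    rw [← Pr_biUnion _ G (hGdis.subset (by intro w hw; exact (Finset.mem_filter.1 hw).1))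
      (fun w _ => hGm w)]
    refine hspr.trans (Pr_mono ?_)
    rintro ω ⟨a, ha, b, hb, hab, h1, y, hy, hc⟩
    simp only [Set.mem_iUnion]
    refine ⟨newR ω n u' R, Finset.mem_filter.2 ⟨hmemI ω, y, ?_, hy⟩, rfl⟩
    exact Or.inr ⟨b, ⟨hb, a, ha, hab, h1⟩, hc⟩
  set a1 := Pr (fun _ => sp) (force u true (HE U (vis n R) t)) with ha1
  set a0 := Pr (fun _ => sp) (force u false (HE U (vis n R) t)) with ha0
  have ha01 : a0 ≤ a1 := Pr_mono (force_mono (HE_upper _ _ _))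
  have hcond : Pr (fun _ => sp) (HE U (vis n R) t) = sp * a1 + (1 - sp) * a0 := by
    refine Pr_cond (S := ((U.erase u : Finset (V d)) : Set (V d))) (by simp)
      (Finset.finite_toSet _) ((HE_dep _ _ _).mono ?_)
    intro x hx
    by_cases hxu : x = u
    · exact Or.inl hxu
    · exact Or.inr (Finset.mem_coe.2 (Finset.mem_erase.2 ⟨hxu, hx⟩))
  have hexp := Pr_explore (p := P) I G (fun ρ => AE n Bk ρ (U.erase u) (bx (cb n t) (3 * n)))
    (fun ρ => SS n u' R ρ) (fun ρ => TT n Bk ρ (U.erase u)) (fun ρ _ => hGd ρ)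
    (fun ρ _ => AE_dep _ _ _) (fun ρ _ => SS_finite _ _ _) (fun ρ _ => TT_finite _ _)
    (by
      intro ρ _
      rw [Set.disjoint_left]
      rintro ⟨e, l⟩ ⟨h1, h2⟩ ⟨h3, h4⟩
      simp only at h1 h2 h3 h4
      rcases h2 with h2 | ⟨h2, w, hw, hwρ⟩ <;> rcases h4 with ⟨h4, h5⟩ | ⟨b', hb', h4⟩
      · rw [h2] at h4; simp at h4
      · rw [h2] at h4
        simp only [Option.some.injEq] at h4
        rw [← h4] at hb'
        simp [hu'] at hb'
      · exact h5 w hw hwρ.1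
      · rw [h2] at h4; simp at h4)
    hGdis (AE n Bk R U (bx (cb n t) (3 * n)))
    (by
      rintro ρ hρ ω ⟨h1, x, hx, y, hy, hc⟩
      have h1 : newR ω n u' R = ρ := h1
      have hRρ : R ⊆ ρ := h1 ▸ Set.subset_union_left
      rw [← h1] at hx
      have hdQ : dom n u ⊆ QQ n Bk := Set.subset_biUnion_of_mem (u := fun b => dom n b)
        (show u ∈ (Bk : Set (V d)) from hU huU)
      have p2 : conn (OU ω R U) (QQ n Bk) x y := by
        refine hc.mono ?_ le_rfl
        rintro a _ b _ (⟨e1, e2, e3⟩ | ⟨b', hb', e3⟩)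
        · exact Or.inl ⟨fun h => e1 (hRρ h), fun h => e2 (hRρ h), e3⟩
        · exact Or.inr ⟨b', Finset.mem_of_mem_erase hb', e3⟩
      rcases hx with hx | ⟨b, ⟨hb, a, ha, hab, h3⟩, hc3⟩
      · exact ⟨x, hx, y, hy, p2⟩
      · refine ⟨a, ha.1, y, hy, ?_⟩
        have hs : OU ω R U a b := Or.inr ⟨u', huU, hab, h3⟩
        refine (conn.single hs (hdQ ha.2) (hdQ hb.1)).trans (conn.trans ?_ p2)
        refine hc3.mono ?_ (Set.sdiff_subset.trans hdQ)
        intro v hv w hw hvw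
        exact Or.inl ⟨hv.2, hw.2, hvw⟩)
    (fun ρ => if u ∈ vis n ρ then a1 else a0)
    (by
      intro ρ hρ
      rw [hI, Finset.mem_filter, Set.Finite.mem_toFinset] at hρ
      obtain ⟨hsubρ, hRρ, hLC⟩ := hρ
      have := ih _ hsub ((Finset.erase_subset _ _).trans hU) ρ
        ((hRf.union (dom_finite n u)).subset hsubρ) hLC
        (by obtain ⟨c0, hc0⟩ := hbox; exact ⟨c0, hc0.trans hRρ⟩)
      refine le_trans ?_ this
      have hV := vis_mono (n := n) hRρ
      split_ifs with hu
      · refine Pr_mono ?_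
        rintro σ ⟨w, hw, hc⟩
        refine ⟨w, hV hw, hc.mono_set ?_⟩
        rintro x (hx | ⟨hx, hσ⟩)
        · exact Or.inl (hV hx)
        · by_cases hxu : x = u
          · exact Or.inl (hxu ▸ hu)
          · rw [Function.update_of_ne hxu] at hσ
            exact Or.inr ⟨Finset.mem_coe.2 (Finset.mem_erase.2 ⟨hxu, hx⟩), hσ⟩
      · refine Pr_mono ?_
        rintro σ ⟨w, hw, hc⟩
        refine ⟨w, hV hw, hc.mono_set ?_⟩
        rintro x (hx | ⟨hx, hσ⟩)
        · exact Or.inl (hV hx)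
        · by_cases hxu : x = u
          · subst hxu
            simp at hσ
          · rw [Function.update_of_ne hxu] at hσ
            exact Or.inr ⟨Finset.mem_coe.2 (Finset.mem_erase.2 ⟨hxu, hx⟩), hσ⟩)
  rw [hcond]
  refine le_trans ?_ hexp
  have e : ∑ ρ ∈ I, Pr P (G ρ) * (if u ∈ vis n ρ then a1 else a0) =
      a0 * ∑ ρ ∈ I, Pr P (G ρ) + (a1 - a0) * ∑ ρ ∈ I.filter (fun ρ => u ∈ vis n ρ), Pr P (G ρ) := by
    clear_value I
    rw [Finset.sum_filter, Finset.mul_sum, Finset.mul_sum, ← Finset.sum_add_distrib]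
    refine Finset.sum_congr rfl fun ρ _ => ?_
    split_ifs <;> ring
  rw [e, hsum]
  nlinarith

lemma ncard_bx_le (c : V d) (r : ℤ) : (bx c r).ncard ≤ (bx (0 : V d) r).ncard := by
  refine Set.ncard_le_ncard_of_injOn (fun v => v - c) ?_ ?_ (bx_finite _ _)
  · intro v hv i
    simpa using hv i
  · intro v _ w _ h
    simpa using h

lemma block_dyn (hd : 0 < d) {q0 p : unitInterval} (hqp : q0 < p) (hq : perc d q0)
    {sp : unitInterval} (hsp : (sp : ℝ) < 1) :
    ∃ n0 : ℕ, ∀ n : ℕ, n0 ≤ n → 1 ≤ n → ∀ (Bk : Finset (V d)) (R : Set (V d)), R.Finite → LC R →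
      (∃ c0, bx c0 n ⊆ R) → ∀ t : V d,
      Pr (fun _ => sp) (HE (Bk : Set (V d)) (vis n R) t) ≤
        Pq p (hitE (QQ n Bk) R (bx (cb n t) (3 * n))) := by
  classical
  obtain ⟨q, hq0, hq1⟩ := exists_between hqp
  obtain ⟨ε', hε', h2⟩ := two_layer hq1
  set κ : ℕ := (bx (0 : V d) (2 * (2 * d + 4))).ncard with hκ
  have hεI : (ε' : ℝ) / (κ + 1) ∈ Set.Icc (0 : ℝ) 1 := by
    refine ⟨by positivity, (div_le_one (by positivity)).2 ?_⟩
    have := ε'.2.2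
    have : (0 : ℝ) ≤ κ := by positivity
    linarith
  set ε : unitInterval := ⟨_, hεI⟩ with hε
  have hε0 : 0 < (ε : ℝ) := by
    simp only [hε]; positivity
  have hpow : (1 - ε' : ℝ) ≤ (1 - ε) ^ κ := by
    have := one_add_mul_le_pow (a := -(ε : ℝ)) (by linarith [ε.2.2]) κ
    rw [← sub_eq_add_neg] at this
    refine le_trans ?_ this
    have : (κ : ℝ) * ε ≤ ε' := by
      simp only [hε]
      rw [mul_div_assoc', div_le_iff₀ (by positivity)]
      nlinarith
    linarith
  have hqlt : (q : ℝ) < 1 := lt_of_lt_of_le (show (q : ℝ) < p from hq1) p.2.2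
  obtain ⟨δ, hδ, hsprE⟩ := sprE_exists (d := d) hqlt hε0 (sub_pos.2 hsp)
  obtain ⟨n0, hw⟩ := walker hq0 hq hδ
  refine ⟨n0, ?_⟩
  intro n hn hn1 Bk R hRf hR hbox t
  set P : Sym2 (V d) × Option Bk → unitInterval := fun i =>
    match i.2 with
    | none => q
    | some b => if i.1 ∈ ED (dom n b.1) then ε else 0 with hP
  have hS : ∀ (u : Bk) (R : Set (V d)), R.Finite → LC R → (∃ c0, bx c0 n ⊆ R) →
      (∃ z ∈ R, z ∈ bx (cb n u.1) (4 * n)) → Disjoint R (bx (cb n u.1) (3 * n)) →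
      (sp : ℝ) ≤ Pr P (sprE none (some u) (dom n u.1) R (bx (cb n u.1) (3 * n))) := by
    intro u R hRf hR ⟨c0, hc0⟩ ⟨z, hz, hzu⟩ hdis
    have := hsprE (Option Bk) none (some u) (by simp) P (dom n u.1) R (bx (cb n u.1) (3 * n))
      (dom_finite _ _) (fun e _ => rfl) (fun e he => by simp [hP, he]) hdis ?_
    · linarith
    · refine hw n hn _ R hRf hR z hz ?_ hzu
      let i : Fin d := ⟨0, hd⟩
      by_cases hzi : z i ≤ c0 i
      · refine ⟨Function.update c0 i (c0 i + n), hc0 ?_, ?_⟩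
        · intro j
          by_cases hj : j = i
          · subst hj; simp
          · rw [Function.update_of_ne hj]; simp
        · intro h
          have := (abs_le.1 (h i)).2
          rw [Function.update_self] at this
          omega
      · refine ⟨Function.update c0 i (c0 i - n), hc0 ?_, ?_⟩
        · intro j
          by_cases hj : j = i
          · subst hj; simp
          · rw [Function.update_of_ne hj]; simp
        · intro h
          have := (abs_le.1 (h i)).1
          rw [Function.update_self] at this
          omega
  refine (dyn hS t Bk le_rfl R hRf hR hbox).trans ?_
  refine le_trans (Pr_mono ?_) (Pr_or (Λ := Option Bk) (p := P) (P := fun _ => p)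
    (S := ED (QQ n Bk)) ?_ (hitE_dep _ _ _) (ED_finite (QQ_finite _ _)) (hitE_upper _ _ _))
  · intro ω h
    refine hit.mono h ?_ le_rfl le_rfl le_rfl
    rintro a _ b _ (⟨-, -, h⟩ | ⟨b', -, h⟩)
    · exact ⟨h.1, @decide_eq_true _ (Classical.dec _) ⟨none, h.2⟩⟩
    · exact ⟨h.1, @decide_eq_true _ (Classical.dec _) ⟨some b', h.2⟩⟩
  · intro e he
    rw [Fintype.prod_option]
    refine h2.trans ?_
    change (1 - q : ℝ) * (1 - ε') ≤ (1 - q) * _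
    refine mul_le_mul_of_nonneg_left (hpow.trans ?_) (by linarith)
    have e1 : ∀ b : Bk, (1 - P (e, some b) : ℝ) =
        if e ∈ ED (dom n b.1) then (1 - ε : ℝ) else 1 := by
      intro b
      simp only [hP]
      split_ifs <;> simp
    rw [Finset.prod_congr rfl (fun b _ => e1 b), Finset.prod_ite, Finset.prod_const_one, mul_one,
      Finset.prod_const]
    refine pow_le_pow_of_le_one (by linarith [ε.2.2]) (by linarith) ?_
    rcases (Finset.univ.filter (fun b : Bk => e ∈ ED (dom n b.1))).eq_empty_or_nonempty with h | ⟨b0, hb0⟩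
    · rw [h]; simp
    · refine le_trans ?_ (ncard_bx_le b0.1 _)
      rw [← Set.ncard_coe_finset]
      refine Set.ncard_le_ncard_of_injOn (fun b : Bk => b.1) ?_
        (fun _ _ _ _ h => Subtype.ext h) (bx_finite _ _)
      intro b hb i
      have hb : e ∈ ED (dom n b.1) := by simpa using hb
      have hb0 : e ∈ ED (dom n b0.1) := by simpa using hb0
      induction e with | _ x y =>
      have h1 := abs_le.1 (hb x (by simp) i)
      have h2 := abs_le.1 (hb0 x (by simp) i)
      simp only [cb] at h1 h2
      have hn' : (0 : ℤ) < n := by exact_mod_cast hn1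
      rw [abs_le]
      constructor
      · by_contra hc
        push Not at hc
        nlinarith
      · by_contra hc
        push Not at hc
        nlinarith

end blocks

/-! ## Part G: exactness, boundaries, animals -/

section exactness
variable {d : ℕ}

/-- The unit vector. -/
def ue (i : Fin d) : V d := Pi.single i 1

lemma ue_self (i : Fin d) : ue i i = 1 := by simp [ue]
lemma ue_ne {i j : Fin d} (h : j ≠ i) : ue i j = 0 := by simp [ue, h]

lemma adj_ue (x : V d) (i : Fin d) : adj x (x + ue i) := by
  refine adj_iff.2 ⟨i, by simp [ue_self], fun j hj => by simp [ue_ne hj]⟩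

lemma adj_ue_iff {x y : V d} (h : adj x y) : ∃ i, y = x + ue i ∨ x = y + ue i := by
  obtain ⟨i, h1, h2⟩ := adj_iff.1 h
  refine ⟨i, ?_⟩
  rcases (abs_eq (by norm_num : (0 : ℤ) ≤ 1)).1 h1 with h1 | h1
  · left
    ext j
    by_cases hj : j = i
    · subst hj; simp [ue_self]; omega
    · simp [ue_ne hj, h2 j hj]
  · right
    ext j
    by_cases hj : j = i
    · subst hj; simp [ue_self]; omega
    · simp [ue_ne hj, h2 j hj]

/-- One dimensional antiderivative. -/
def anti (f : ℤ → ℤ) (t : ℤ) : ℤ :=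
  ∑ k ∈ Finset.range t.toNat, f k - ∑ k ∈ Finset.range (-t).toNat, f (-(k : ℤ) - 1)

lemma anti_succ (f : ℤ → ℤ) (t : ℤ) : anti f (t + 1) = anti f t + f t := by
  unfold anti
  rcases lt_or_ge t 0 with h | h
  · have e1 : t.toNat = 0 := by omega
    have e2 : (t + 1).toNat = 0 := by omega
    have e3 : (-t).toNat = (-(t + 1)).toNat + 1 := by omega
    rw [e1, e2, e3, Finset.sum_range_succ]
    have e4 : -(((-(t + 1)).toNat : ℕ) : ℤ) - 1 = t := by omega
    rw [e4]; ring
  · have e1 : (-t).toNat = 0 := by omega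
    have e2 : (-(t + 1)).toNat = 0 := by omega
    have e3 : (t + 1).toNat = t.toNat + 1 := by omega
    rw [e1, e2, e3, Finset.sum_range_succ]
    have e4 : (t.toNat : ℤ) = t := by omega
    rw [e4]; ring

lemma exact_aux (g : V d → Fin d → ℤ)
    (hg : ∀ x i j, g x i + g (x + ue i) j = g x j + g (x + ue j) i) (m : ℕ) :
    ∃ h : V d → ℤ, ∀ x, ∀ i : Fin d, i.1 < m → h (x + ue i) = h x + g x i := by
  induction m with
  | zero => exact ⟨0, fun x i hi => absurd hi (Nat.not_lt_zero _)⟩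
  | succ m ih =>
    obtain ⟨h, hh⟩ := ih
    by_cases hm : m < d
    swap
    · exact ⟨h, fun x i _ => hh x i (by omega)⟩
    set k : Fin d := ⟨m, hm⟩ with hk
    set g' : V d → ℤ := fun x => g x k - (h (x + ue k) - h x) with hg'
    refine ⟨fun x => h x + anti (fun t => g' (Function.update x k t)) (x k), ?_⟩
    intro x i hi
    by_cases hik : i = k
    · subst i
      have e1 : ∀ t, Function.update (x + ue k) k t = Function.update x k t := by
        intro t
        ext j
        by_cases hj : j = k
        · rw [hj]; simp
        · rw [Function.update_of_ne hj, Function.update_of_ne hj]; simp [ue_ne hj]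
      simp only [e1, Pi.add_apply, ue_self, anti_succ, Function.update_eq_self]
      simp only [hg']
      ring
    · have hi' : i.1 < m := by
        have : i.1 ≠ m := fun h => hik (Fin.ext h)
        omega
      have e0 : (x + ue i) k = x k := by simp [ue_ne (Ne.symm hik)]
      have e1 : ∀ t, g' (Function.update (x + ue i) k t) = g' (Function.update x k t) := by
        intro t
        have e2 : Function.update (x + ue i) k t = Function.update x k t + ue i := by
          ext j
          by_cases hj : j = k
          · subst hj; simp [ue_ne (Ne.symm hik)]
          · simp [hj]
        rw [e2]
        simp only [hg']
        set y := Function.update x k t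
        have h1 := hg y i k
        have h2 := hh y i hi'
        have h3 := hh (y + ue k) i hi'
        have e3 : y + ue i + ue k = y + ue k + ue i := add_right_comm _ _ _
        rw [e3]
        linarith
      simp only [e0, e1]
      rw [hh x i hi']
      ring

/-- Closed integer cochains on the lattice are exact. -/
lemma exact_cochain (c : V d → V d → ℤ) (hc : ∀ x y, c x y = - c y x)
    (h4 : ∀ x i j, c x (x + ue i) + c (x + ue i) (x + ue i + ue j) =
      c x (x + ue j) + c (x + ue j) (x + ue j + ue i)) :
    ∃ h : V d → ℤ, ∀ x y, adj x y → h y = h x + c x y := by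
  obtain ⟨h, hh⟩ := exact_aux (fun x i => c x (x + ue i)) (fun x i j => h4 x i j) d
  refine ⟨h, fun x y hxy => ?_⟩
  obtain ⟨i, rfl | rfl⟩ := adj_ue_iff hxy
  · exact hh x i i.2
  · rw [hh y i i.2, hc (y + ue i) y]; ring

lemma sadj_of_plaq (x : V d) {i j : Fin d} (hij : i ≠ j) {a b a' b' : ℤ} (ha : a = 0 ∨ a = 1)
    (hb : b = 0 ∨ b = 1) (ha' : a' = 0 ∨ a' = 1) (hb' : b' = 0 ∨ b' = 1) :
    sadj (x + a • ue i + b • ue j) (x + a' • ue i + b' • ue j) := by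
  intro k
  simp only [Pi.add_apply, Pi.smul_apply, smul_eq_mul]
  by_cases hki : k = i
  · subst hki
    rw [ue_self, ue_ne hij, abs_le]
    omega
  · by_cases hkj : k = j
    · subst hkj
      rw [ue_self, ue_ne hki, abs_le]
      omega
    · rw [ue_ne hki, ue_ne hkj]; simp

/-- The outer boundary of a connected set, seen from one side, is star-connected. -/
lemma boundary_conn {K D : Set (V d)} (hK : LC K) (hD : LC D) (hDK : Disjoint D K)
    (hDc : ∀ a ∈ D, ∀ b, adj a b → b ∈ D ∨ b ∈ K) {u v : V d}
    (hu : u ∈ D ∧ ∃ k ∈ K, adj u k) (hv : v ∈ D ∧ ∃ k ∈ K, adj v k) :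
    conn sadj {w | w ∈ D ∧ ∃ k ∈ K, adj w k} u v := by
  classical
  set B : Set (V d) := {w | w ∈ D ∧ ∃ k ∈ K, adj w k} with hB
  by_contra hcon
  set B1 : Set (V d) := {w | w ∈ B ∧ conn sadj B u w} with hB1
  have hstep : ∀ a ∈ B1, ∀ b ∈ B, sadj a b → b ∈ B1 := fun a ha b hb hab =>
    ⟨hb, ha.2.trans (conn.single hab ha.1 hb)⟩
  set c : V d → V d → ℤ := fun x y => (if x ∈ B1 ∧ y ∈ K then 1 else 0) -
    (if y ∈ B1 ∧ x ∈ K then 1 else 0) with hc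
  have hDK' : ∀ w, w ∈ D → w ∉ K := fun w h1 h2 => Set.disjoint_left.1 hDK h1 h2
  have hB1D : ∀ w, w ∈ B1 → w ∈ D := fun w h => h.1.1
  let ind : V d → ℤ := fun x => if x ∈ D then 1 else 0
  -- on a family of mutually star-adjacent sites containing a site of `B1`
  have key : ∀ Q : Set (V d), (∀ a ∈ Q, ∀ b ∈ Q, sadj a b) → (∃ w ∈ Q, w ∈ B1) →
      ∀ x ∈ Q, ∀ y ∈ Q, adj x y → c x y = ind x - ind y := by
    rintro Q hQ ⟨w, hwQ, hw⟩ x hx y hy hxy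
    have hx1 : x ∈ B → x ∈ B1 := fun h => hstep w hw x h (hQ w hwQ x hx)
    have hy1 : y ∈ B → y ∈ B1 := fun h => hstep w hw y h (hQ w hwQ y hy)
    by_cases hxD : x ∈ D <;> by_cases hyD : y ∈ D
    · simp [hc, ind, hxD, hyD, hDK' x hxD, hDK' y hyD]
    · have hyK : y ∈ K := (hDc x hxD y hxy).resolve_left hyD
      have : x ∈ B1 := hx1 ⟨hxD, y, hyK, hxy⟩
      simp [hc, ind, hxD, hyD, hyK, this, hDK' x hxD]
    · have hxK : x ∈ K := (hDc y hyD x hxy.symm).resolve_left hxD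
      have : y ∈ B1 := hy1 ⟨hyD, x, hxK, hxy.symm⟩
      simp [hc, ind, hxD, hyD, hxK, this, hDK' y hyD]
    · have h1 : x ∉ B1 := fun h => hxD (hB1D x h)
      have h2 : y ∉ B1 := fun h => hyD (hB1D y h)
      simp [hc, ind, hxD, hyD, h1, h2]
  have key0 : ∀ x y, x ∉ B1 → y ∉ B1 → c x y = 0 := by
    intro x y h1 h2
    simp [hc, h1, h2]
  obtain ⟨h, hh⟩ := exact_cochain c (fun x y => by simp only [hc]; ring) (by
    intro x i j
    by_cases hij : i = j
    · subst hij; rfl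
    have e : x + ue j + ue i = x + ue i + ue j := add_right_comm _ _ _
    rw [e]
    set Q : Set (V d) := {x, x + ue i, x + ue j, x + ue i + ue j} with hQ
    have hQs : ∀ a ∈ Q, ∀ b ∈ Q, sadj a b := by
      have hrep : ∀ a ∈ Q, ∃ s t : ℤ, (s = 0 ∨ s = 1) ∧ (t = 0 ∨ t = 1) ∧
          a = x + s • ue i + t • ue j := by
        rintro a (rfl | rfl | rfl | rfl)
        · exact ⟨0, 0, by simp, by simp, by simp⟩
        · exact ⟨1, 0, by simp, by simp, by simp⟩
        · exact ⟨0, 1, by simp, by simp, by simp⟩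
        · exact ⟨1, 1, by simp, by simp, by simp⟩
      intro a ha b hb
      obtain ⟨s, t, h1, h2, rfl⟩ := hrep a ha
      obtain ⟨s', t', h3, h4, rfl⟩ := hrep b hb
      exact sadj_of_plaq x hij h1 h2 h3 h4
    have m1 : x ∈ Q := by simp [hQ]
    have m2 : x + ue i ∈ Q := by simp [hQ]
    have m3 : x + ue j ∈ Q := by simp [hQ]
    have m4 : x + ue i + ue j ∈ Q := by simp [hQ]
    by_cases hw : ∃ w ∈ Q, w ∈ B1
    · rw [key Q hQs hw _ m1 _ m2 (adj_ue _ _), key Q hQs hw _ m2 _ m4 (adj_ue _ _),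
        key Q hQs hw _ m1 _ m3 (adj_ue _ _),
        key Q hQs hw _ m3 _ m4 (by rw [← e]; exact adj_ue _ _)]
      ring
    · push Not at hw
      rw [key0 _ _ (hw _ m1) (hw _ m2), key0 _ _ (hw _ m2) (hw _ m4), key0 _ _ (hw _ m1) (hw _ m3),
        key0 _ _ (hw _ m3) (hw _ m4)])
  have hconst : ∀ X : Set (V d), (∀ x ∈ X, ∀ y ∈ X, c x y = 0) → ∀ x y, conn adj X x y →
      h x = h y := by
    intro X hX x y hxy
    refine hxy.closed (S := {z | h x = h z}) rfl ?_
    intro a b (ha : h x = h a) haX hbX hab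
    change h x = h b
    rw [hh a b hab, hX a haX b hbX, ← ha, add_zero]
  have hKc : ∀ x ∈ K, ∀ y ∈ K, h x = h y := fun x hx y hy =>
    hconst K (fun a ha b hb => key0 a b (fun h => hDK' a (hB1D a h) ha)
      (fun h => hDK' b (hB1D b h) hb)) x y (hK x hx y hy)
  have hDcst : ∀ x ∈ D, ∀ y ∈ D, h x = h y := fun x hx y hy =>
    hconst D (fun a ha b hb => by simp [hc, hDK' a ha, hDK' b hb]) x y (hD x hx y hy)
  obtain ⟨huD, k, hk, huk⟩ := hu
  obtain ⟨hvD, k', hk', hvk⟩ := hv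
  have hu1 : u ∈ B1 := ⟨⟨huD, k, hk, huk⟩, conn.refl⟩
  have hv1 : v ∉ B1 := fun h => hcon h.2
  have q1 := hh u k huk
  have q2 := hh v k' hvk
  have q3 : c u k = 1 := by simp [hc, hu1, hk, hDK' u huD]
  have q4 : c v k' = 0 := key0 _ _ hv1 (fun h => hDK' k' (hB1D _ h) hk')
  have q5 := hKc k hk k' hk'
  have q6 := hDcst u huD v hvD
  omega

end exactness

section animals
variable {d : ℕ}

lemma LC_card {S : Finset (V d)} (hS : LC (S : Set (V d))) {a v : V d} (ha : a ∈ S) (hv : v ∈ S)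
    (i : Fin d) : |v i - a i| + 1 ≤ S.card := by
  classical
  wlog h : a i ≤ v i generalizing a v
  · rw [abs_sub_comm]
    exact this hv ha (by omega)
  have : Finset.Icc (a i) (v i) ⊆ S.image (fun x => x i) := by
    intro t ht
    rw [Finset.mem_Icc] at ht
    by_contra hn
    have hno : ∀ x ∈ S, x i ≠ t := fun x hx he => hn (Finset.mem_image.2 ⟨x, hx, he⟩)
    have hlt : v i < t := by
      refine (hS a ha v hv).closed (S := {x : V d | x i < t})
        (show a i < t from lt_of_le_of_ne ht.1 (hno a ha)) ?_
      intro x y hx hxS hyS hxy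
      have hx : x i < t := hx
      have := abs_le.1 (hxy.abs_le i)
      exact lt_of_le_of_ne (by omega) (hno y hyS)
    omega
  have h1 := (Finset.card_le_card this).trans Finset.card_image_le
  rw [Int.card_Icc] at h1
  rw [abs_of_nonneg (by omega)]
  omega

lemma LC_insert {S : Set (V d)} (hS : LC S) {a b : V d} (ha : a ∈ S) (hab : adj a b) :
    LC (insert b S) := by
  refine LC_attach hS (Set.subset_insert _ _) ?_
  rintro v (rfl | hv)
  · exact ⟨a, ha, conn.single hab (Set.mem_insert_of_mem _ ha) (Set.mem_insert _ _)⟩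
  · exact ⟨v, hv, conn.refl⟩

/-- A connected set contains connected subsets of all intermediate sizes. -/
lemma LC_grow {C : Set (V d)} (hC : LC C) {S0 : Finset (V d)} (h0 : LC (S0 : Set (V d)))
    (hne : S0.Nonempty) (h0C : (S0 : Set (V d)) ⊆ C) {s : ℕ} (hs : S0.card ≤ s)
    (hbig : ∀ T : Finset (V d), (T : Set (V d)) = C → s ≤ T.card) :
    ∃ S : Finset (V d), S0 ⊆ S ∧ (S : Set (V d)) ⊆ C ∧ LC (S : Set (V d)) ∧ S.card = s := by
  classical
  induction s, hs using Nat.le_induction with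
  | base => exact ⟨S0, le_rfl, h0C, h0, rfl⟩
  | succ s hs ih =>
    obtain ⟨S, h1, h2, h3, h4⟩ := ih (fun T hT => (Nat.le_succ s).trans (hbig T hT))
    have hne' : ¬ C ⊆ S := by
      intro h
      have := hbig S (Set.Subset.antisymm h2 h)
      omega
    obtain ⟨w, hwC, hwS⟩ := Set.not_subset.1 hne'
    obtain ⟨x, hx⟩ := hne
    obtain ⟨a, b, -, ha, hb, -, hbC, hab, -⟩ :=
      (hC x (h0C hx) w hwC).exit (S := (S : Set (V d))) (h1 hx) hwS
    refine ⟨insert b S, h1.trans (Finset.subset_insert _ _), ?_, ?_, ?_⟩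
    · rw [Finset.coe_insert]
      exact Set.insert_subset hbC h2
    · rw [Finset.coe_insert]
      exact LC_insert h3 ha hab
    · rw [Finset.card_insert_of_notMem hb, h4]

/-- The volume of the unit box. -/
noncomputable def kap (d : ℕ) : ℕ := (bx (0 : V d) 1).ncard

/-- Counting lattice animals. -/
lemma animals_card (a : V d) (s : ℕ) (𝒜 : Finset (Finset (V d)))
    (h : ∀ S ∈ 𝒜, a ∈ S ∧ LC (S : Set (V d)) ∧ S.card = s) :
    (𝒜.card : ℝ) ≤ (2 : ℝ) ^ (kap d * s) := by
  classical
  have hI : (1 / 2 : ℝ) ∈ Set.Icc (0 : ℝ) 1 := by norm_num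
  let p : V d → unitInterval := fun _ => ⟨1 / 2, hI⟩
  let nb : Finset (V d) → Finset (V d) := fun S => S.biUnion fun u => (bx_finite u 1).toFinset
  have hnb : ∀ S : Finset (V d), S.card = s → (nb S).card ≤ kap d * s := by
    intro S hS
    refine (Finset.card_biUnion_le_card_mul _ _ (kap d) ?_).trans (by rw [hS, mul_comm])
    intro u _
    rw [← Set.ncard_eq_toFinset_card _ (bx_finite u 1)]
    exact ncard_bx_le u 1
  let bd : Finset (V d) → Finset (V d) := fun S => (nb S).filter fun v => v ∉ S ∧ ∃ u ∈ S, adj u v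
  let E : Finset (V d) → Set (V d → Bool) := fun S =>
    {ω | ∀ v ∈ S, ω v = true} ∩ {ω | ∀ v ∈ bd S, ω v = false}
  have hdep : ∀ S, Dep ((S ∪ bd S : Finset (V d)) : Set (V d)) (E S) := by
    intro S
    refine Dep.inter ((Dep_all S true).mono ?_) ((Dep_all (bd S) false).mono ?_)
    · exact Finset.coe_subset.2 Finset.subset_union_left
    · exact Finset.coe_subset.2 Finset.subset_union_right
  have hsub : ∀ S ∈ 𝒜, ∀ S' ∈ 𝒜, ∀ ω ∈ E S, ω ∈ E S' → S' ⊆ S := by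
    intro S hS S' hS' ω hω hω' v hv
    refine ((h S' hS').2.1 a (h S' hS').1 v hv).closed (S := (S : Set (V d))) (h S hS).1 ?_
    intro x y hx hx' hy hxy
    by_contra hyS
    have h1 : ω y = false := hω.2 y (by
      refine Finset.mem_filter.2 ⟨Finset.mem_biUnion.2 ⟨x, hx, ?_⟩, hyS, x, hx, hxy⟩
      rw [Set.Finite.mem_toFinset]
      exact hxy.abs_le)
    have h2 : ω y = true := hω'.1 y hy
    rw [h1] at h2
    simp at h2
  have hdis : (𝒜 : Set (Finset (V d))).PairwiseDisjoint E := by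
    intro S hS S' hS' hne
    rw [Function.onFun, Set.disjoint_left]
    intro ω h1 h2
    exact hne (Finset.Subset.antisymm (hsub S' hS' S hS ω h2 h1) (hsub S hS S' hS' ω h1 h2))
  have hpr : ∀ S ∈ 𝒜, (1 / 2 : ℝ) ^ (kap d * s) ≤ Pr p (E S) := by
    intro S hS
    have hd : Disjoint S (bd S) := by
      rw [Finset.disjoint_right]
      intro v hv
      exact (Finset.mem_filter.1 hv).2.1
    rw [Pr_indep (Dep_all S true) (Dep_all (bd S) false) S.finite_toSet (bd S).finite_toSet
      (by exact_mod_cast hd), Pr_all_true, Pr_all_false]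
    have e1 : ∏ i ∈ S, (p i : ℝ) = (1 / 2) ^ S.card := by simp [p]
    have e2 : ∏ i ∈ bd S, (1 - (p i : ℝ)) = (1 / 2) ^ (bd S).card := by
      rw [← Finset.prod_const]
      refine Finset.prod_congr rfl fun i _ => ?_
      simp only [p]; norm_num
    rw [e1, e2, ← pow_add]
    refine pow_le_pow_of_le_one (by norm_num) (by norm_num) ?_
    rw [← Finset.card_union_of_disjoint hd]
    refine (Finset.card_le_card ?_).trans (hnb S (h S hS).2.2)
    refine Finset.union_subset ?_ (Finset.filter_subset _ _)
    intro v hv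
    refine Finset.mem_biUnion.2 ⟨v, hv, ?_⟩
    rw [Set.Finite.mem_toFinset]
    exact fun i => by simp
  have htot : ∑ S ∈ 𝒜, Pr p (E S) ≤ 1 := by
    rw [← Pr_biUnion 𝒜 E hdis (fun S _ => (hdep S).meas (Finset.finite_toSet _))]
    exact Pr_le_one
  have h1 := (Finset.sum_le_sum hpr).trans htot
  rw [Finset.sum_const, nsmul_eq_mul] at h1
  rw [one_div, inv_pow, ← div_eq_mul_inv, div_le_one (by positivity)] at h1
  exact h1

/-- Probability of a large closed connected set containing a given site. -/
lemma animals_prob (sp : unitInterval) (a : V d) (s : ℕ) (U : Finset (V d)) :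
    Pr (fun _ : V d => sp) {σ | ∃ S : Finset (V d), S ⊆ U ∧ a ∈ S ∧ LC (S : Set (V d)) ∧ S.card = s ∧
      ∀ v ∈ S, σ v = false} ≤ ((2 : ℝ) ^ kap d * (1 - sp)) ^ s := by
  classical
  set 𝒜 := U.powerset.filter (fun S : Finset (V d) => a ∈ S ∧ LC (S : Set (V d)) ∧ S.card = s) with h𝒜
  have h1 := animals_card a s 𝒜 (fun S hS => (Finset.mem_filter.1 hS).2)
  have h2 : Pr (fun _ : V d => sp) (⋃ S ∈ 𝒜, {σ | ∀ v ∈ S, σ v = false}) ≤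
      ∑ S ∈ 𝒜, (1 - sp : ℝ) ^ s := by
    refine (Pr_biUnion_le _ _).trans (Finset.sum_le_sum fun S hS => ?_)
    rw [Pr_all_false, Finset.prod_const, (Finset.mem_filter.1 hS).2.2.2]
  refine (Pr_mono ?_).trans (h2.trans ?_)
  · rintro σ ⟨S, hU, ha, hS, hs, hσ⟩
    simp only [Set.mem_iUnion]
    exact ⟨S, Finset.mem_filter.2 ⟨Finset.mem_powerset.2 hU, ha, hS, hs⟩, hσ⟩
  · rw [Finset.sum_const, nsmul_eq_mul, mul_pow, ← pow_mul]
    exact mul_le_mul_of_nonneg_right h1 (pow_nonneg (by linarith [sp.2.2]) _)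

end animals

section strip

lemma conn.map {α β : Type*} {O : α → α → Prop} {O' : β → β → Prop} {D : Set α} {D' : Set β}
    {x y : α} (f : α → β) (h : conn O D x y)
    (hO : ∀ a ∈ D, ∀ b ∈ D, O a b → O' (f a) (f b)) (hD : ∀ a ∈ D, f a ∈ D') :
    conn O' D' (f x) (f y) := by
  induction h with
  | refl => exact conn.refl
  | @tail b c _ h ih =>
    exact ih.trans (conn.single (hO _ h.1 _ h.2.1 h.2.2) (hD _ h.1) (hD _ h.2.1))

lemma LC_reach {d : ℕ} {C : Set (V d)} (a : V d) : LC {v | v ∈ C ∧ conn adj C a v} := by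
  intro x hx y hy
  exact (hx.2.self.symm fun _ _ h => h.symm).trans hy.2.self

lemma animal_of_conn {d : ℕ} {C : Set (V d)} {U : Finset (V d)} (hCU : C ⊆ U) {a b : V d}
    (ha : a ∈ C) (h : conn adj C a b) (i : Fin d) {s : ℕ} (hs : 1 ≤ s)
    (hsb : (s : ℤ) ≤ |b i - a i| + 1) :
    ∃ S : Finset (V d), S ⊆ U ∧ a ∈ S ∧ LC (S : Set (V d)) ∧ S.card = s ∧ (S : Set (V d)) ⊆ C := by
  have hLC := LC_reach (C := C) a
  obtain ⟨S, h1, h2, h3, h4⟩ := LC_grow (s := s) hLC (S0 := {a}) (by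
      intro x hx y hy
      simp only [Finset.coe_singleton, Set.mem_singleton_iff] at hx hy
      rw [hx, hy]; exact conn.refl) (by simp) (by simpa using ⟨ha, conn.refl⟩)
    (by simpa using hs) (by
      intro T hT
      have := LC_card (S := T) (by rw [hT]; exact hLC) (a := a) (v := b)
        (by rw [← Finset.mem_coe, hT]; exact ⟨ha, conn.refl⟩)
        (by rw [← Finset.mem_coe, hT]; exact ⟨h.mem ha, h⟩) i
      omega)
  have h5 : (S : Set (V d)) ⊆ C := fun v hv => (h2 hv).1
  exact ⟨S, fun v hv => by exact_mod_cast hCU (h5 hv), h1 (by simp), h3, h4, h5⟩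

/-- Points of the plane. -/
def pt (j h : ℤ) : V 2 := ![j, h]

@[simp] lemma pt_zero (j h : ℤ) : pt j h 0 = j := rfl
@[simp] lemma pt_one (j h : ℤ) : pt j h 1 = h := rfl

lemma pt_eta (v : V 2) : pt (v 0) (v 1) = v := by
  ext i; fin_cases i <;> rfl

/-- The strip. -/
def rect (L W : ℤ) : Set (V 2) := {v | (0 ≤ v 0 ∧ v 0 ≤ L) ∧ 0 ≤ v 1 ∧ v 1 ≤ W}

lemma rect_finite (L W : ℤ) : (rect L W).Finite := by
  refine (Set.finite_Icc (pt 0 0) (pt L W)).subset ?_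
  rintro v ⟨⟨h1, h2⟩, h3, h4⟩
  constructor
  · intro i; fin_cases i
    · exact h1
    · exact h3
  · intro i; fin_cases i
    · exact h2
    · exact h4

lemma pt_adj_up (v : V 2) : adj (pt (v 0) (v 1 - 1)) v := by
  refine adj_iff.2 ⟨1, by simp, ?_⟩
  intro j hj
  fin_cases j
  · rfl
  · simp at hj

lemma strip_det {L W : ℤ} (hL : 0 ≤ L) (hW : 0 ≤ W) (σ : V 2 → Bool) {C : Set (V 2)}
    (hC : C = {v | v ∈ rect L W ∧ σ v = false})
    (H0 : ∀ t, ∀ w ∈ C, w 1 = 0 → pt 0 t ∈ C → ¬ conn adj C (pt 0 t) w)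
    (HL : ∀ t, ∀ w ∈ C, w 1 = 0 → pt L t ∈ C → ¬ conn adj C (pt L t) w)
    (HW : ∀ w ∈ C, w 1 = 0 → ∀ v ∈ C, v 1 = W → ¬ conn adj C w v) :
    conn sadj {v | v ∈ rect L W ∧ σ v = true} (pt 0 0) (pt L 0) := by
  set K : Set (V 2) := {v | v 1 ≤ -1 ∨ (v ∈ C ∧ ∃ w ∈ C, w 1 = 0 ∧ conn adj C w v)} with hK
  have hsy : ∀ a b : V 2, adj a b → adj b a := fun _ _ h => h.symm
  have hCr : ∀ v, v ∈ C → v ∈ rect L W ∧ σ v = false := fun v hv => by rw [hC] at hv; exact hv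
  have hKLC : LC K := by
    refine LC_attach (R := {v : V 2 | v 1 ≤ -1}) ?_ (fun v hv => Or.inl hv) ?_
    · refine boxlike_conn fun u (hu : u 1 ≤ -1) v (hv : v 1 ≤ -1) w hw => ?_
      have := (hw 1).2
      change w 1 ≤ -1
      omega
    · rintro v (hv | ⟨hv, w, hw, hw1, hc⟩)
      · exact ⟨v, hv, conn.refl⟩
      · refine ⟨pt (w 0) (w 1 - 1), by change w 1 - 1 ≤ -1; omega, ?_⟩
        refine (conn.single (pt_adj_up w) (Or.inl (by change w 1 - 1 ≤ -1; omega))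
          (Or.inr ⟨hw, w, hw, hw1, conn.refl⟩)).trans ?_
        exact hc.self.mono_set fun x hx => Or.inr ⟨hx.1, w, hw, hw1, hx.2⟩
  have col0 : ∀ v : V 2, v 0 = 0 → 0 ≤ v 1 → v ∉ K := by
    rintro v hv hv1 (h | ⟨h, w, hw, hw1, hc⟩)
    · omega
    · have e : v = pt 0 (v 1) := by rw [← hv, pt_eta]
      rw [e] at h hc
      exact H0 _ w hw hw1 h (hc.symm hsy)
  have colL : ∀ v : V 2, v 0 = L → 0 ≤ v 1 → v ∉ K := by
    rintro v hv hv1 (h | ⟨h, w, hw, hw1, hc⟩)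
    · omega
    · have e : v = pt L (v 1) := by rw [← hv, pt_eta]
      rw [e] at h hc
      exact HL _ w hw hw1 h (hc.symm hsy)
  have rowW : ∀ v : V 2, v 1 = W → v ∉ K := by
    rintro v hv (h | ⟨h, w, hw, hw1, hc⟩)
    · omega
    · exact HW w hw hw1 v h hv hc
  set D : Set (V 2) := {v | v ∈ Kᶜ ∧ conn adj Kᶜ (pt 0 0) v} with hD
  have hDLC : LC D := LC_reach _
  have hDc : ∀ a ∈ D, ∀ b, adj a b → b ∈ D ∨ b ∈ K := by
    intro a ha b hab
    by_cases hb : b ∈ K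
    · exact Or.inr hb
    · exact Or.inl ⟨hb, ha.2.trans (conn.single hab ha.1 hb)⟩
  have hseg : ∀ S : Set (V 2), (∀ u ∈ S, ∀ v ∈ S, ∀ w : V 2,
      (∀ i, min (u i) (v i) ≤ w i ∧ w i ≤ max (u i) (v i)) → w ∈ S) → (∀ v ∈ S, v ∉ K) →
      ∀ u ∈ S, ∀ v ∈ S, conn adj Kᶜ u v := fun S h1 h2 u hu v hv =>
    (boxlike_conn h1 u hu v hv).mono_set h2
  have c1 : conn adj Kᶜ (pt 0 0) (pt 0 W) := by
    refine hseg {v | v 0 = 0 ∧ 0 ≤ v 1} ?_ (fun v hv => col0 v hv.1 hv.2) _ ⟨rfl, le_rfl⟩ _ ⟨rfl, hW⟩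
    rintro u ⟨hu1, hu2⟩ v ⟨hv1, hv2⟩ w hw
    have h0 := hw 0
    have h1 := hw 1
    constructor <;> omega
  have c2 : conn adj Kᶜ (pt 0 W) (pt L W) := by
    refine hseg {v | v 1 = W} ?_ (fun v hv => rowW v hv) _ rfl _ rfl
    intro u (hu1 : u 1 = W) v (hv1 : v 1 = W) w hw
    have h1 := hw 1
    change w 1 = W
    omega
  have c3 : conn adj Kᶜ (pt L W) (pt L 0) := by
    refine hseg {v | v 0 = L ∧ 0 ≤ v 1} ?_ (fun v hv => colL v hv.1 hv.2) _ ⟨rfl, hW⟩ _ ⟨rfl, le_rfl⟩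
    rintro u ⟨hu1, hu2⟩ v ⟨hv1, hv2⟩ w hw
    have h0 := hw 0
    have h1 := hw 1
    constructor <;> omega
  have m0 : pt 0 0 ∉ K := col0 _ rfl le_rfl
  have mL : pt L 0 ∉ K := colL _ rfl le_rfl
  have b0 : pt 0 0 ∈ D ∧ ∃ k ∈ K, adj (pt 0 0) k :=
    ⟨⟨m0, conn.refl⟩, pt 0 (0 - 1), Or.inl (by simp), (pt_adj_up (pt 0 0)).symm⟩
  have bL : pt L 0 ∈ D ∧ ∃ k ∈ K, adj (pt L 0) k :=
    ⟨⟨mL, c1.trans (c2.trans c3)⟩, pt L (0 - 1), Or.inl (by simp), (pt_adj_up (pt L 0)).symm⟩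
  have hmain := boundary_conn hKLC hDLC (Set.disjoint_left.2 fun v hv => hv.1) hDc b0 bL
  have good : ∀ v : V 2, (v ∈ D ∧ ∃ k ∈ K, adj v k) → 0 ≤ v 0 → v 0 ≤ L →
      v ∈ rect L W ∧ σ v = true := by
    rintro v ⟨⟨hvK, -⟩, k, hk, hvk⟩ h0 h1
    have hv1 : 0 ≤ v 1 := by
      by_contra h
      exact hvK (Or.inl (by omega))
    have hk1 := abs_le.1 (hvk.abs_le 1)
    have hkW : k 1 ≤ W - 1 := by
      have hne : k 1 ≠ W := fun h => rowW k h hk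
      rcases hk with hk | ⟨hk, -⟩
      · omega
      · have := (hCr k hk).1.2.2
        omega
    have hr : v ∈ rect L W := ⟨⟨h0, h1⟩, hv1, by omega⟩
    refine ⟨hr, ?_⟩
    by_contra hσ
    have hvC : v ∈ C := by
      rw [hC]
      exact ⟨hr, by simpa using hσ⟩
    rcases hk with hk | ⟨hk, w, hw, hw1, hc⟩
    · exact hvK (Or.inr ⟨hvC, v, hvC, by omega, conn.refl⟩)
    · exact hvK (Or.inr ⟨hvC, w, hw, hw1, hc.trans (conn.single hvk.symm hk hvC)⟩)
  have g0 := good _ b0 le_rfl hL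
  have gL := good _ bL hL le_rfl
  have hfin := hmain.map (f := fun v => pt (max 0 (min L (v 0))) (v 1)) (O' := sadj)
    (D' := {v | v ∈ rect L W ∧ σ v = true}) ?_ ?_
  · have e1 : pt (max 0 (min L ((pt 0 0) 0))) ((pt 0 0) 1) = pt 0 0 := by simp [hL]
    have e2 : pt (max 0 (min L ((pt L 0) 0))) ((pt L 0) 1) = pt L 0 := by simp [hL]
    simp only [e1, e2] at hfin
    exact hfin
  · intro a _ b _ hab i
    have ha0 := abs_le.1 (hab 0)
    have ha1 := hab 1
    fin_cases i
    · change |max 0 (min L (a 0)) - max 0 (min L (b 0))| ≤ 1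
      rw [abs_le]; omega
    · exact ha1
  · intro v hv
    by_cases h0 : v 0 < 0
    · obtain ⟨⟨hvK, -⟩, k, hk, hvk⟩ := hv
      have hv1 : 0 ≤ v 1 := by
        by_contra h
        exact hvK (Or.inl (by omega))
      have k0 := abs_le.1 (hvk.abs_le 0)
      have k1 := abs_le.1 (hvk.abs_le 1)
      have hk1 : k 1 ≤ -1 := by
        by_contra hk1
        rcases hk with hk' | ⟨hk', hk''⟩
        · exact hk1 hk'
        · have := (hCr k hk').1.1.1
          exact col0 k (by omega) (by omega) (Or.inr ⟨hk', hk''⟩)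
      have e : pt (max 0 (min L (v 0))) (v 1) = pt 0 0 := by
        congr 1 <;> omega
      simp only [e]; exact g0
    · by_cases h1 : L < v 0
      · obtain ⟨⟨hvK, -⟩, k, hk, hvk⟩ := hv
        have hv1 : 0 ≤ v 1 := by
          by_contra h
          exact hvK (Or.inl (by omega))
        have k0 := abs_le.1 (hvk.abs_le 0)
        have k1 := abs_le.1 (hvk.abs_le 1)
        have hk1 : k 1 ≤ -1 := by
          by_contra hk1
          rcases hk with hk' | ⟨hk', hk''⟩
          · exact hk1 hk'
          · have := (hCr k hk').1.1.2
            exact colL k (by omega) (by omega) (Or.inr ⟨hk', hk''⟩)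
        have e : pt (max 0 (min L (v 0))) (v 1) = pt L 0 := by
          congr 1 <;> omega
        simp only [e]; exact gL
      · have e : pt (max 0 (min L (v 0))) (v 1) = v := by
          rw [min_eq_right (by omega), max_eq_right (by omega), pt_eta]
        simp only [e]
        exact good v hv (by omega) (by omega)

/-- The strip is crossed along its bottom. -/
def stripE (L W : ℤ) : Set (V 2 → Bool) :=
  {σ | conn sadj {v | v ∈ rect L W ∧ σ v = true} (pt 0 0) (pt L 0)}

lemma stripE_dep (L W : ℤ) : Dep (rect L W) (stripE L W) := by
  intro σ σ' e h
  refine conn.mono_set h ?_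
  rintro v ⟨h1, h2⟩
  exact ⟨h1, by rw [← e v h1]; exact h2⟩

lemma strip_prob {sp : unitInterval} (hr : (2 : ℝ) ^ kap 2 * (1 - sp) ≤ 1 / 16) (L W : ℕ)
    (hLW : L + 1 ≤ 2 ^ W) : 1 / 2 ≤ Pr (fun _ => sp) (stripE L W) := by
  classical
  set r : ℝ := (2 : ℝ) ^ kap 2 * (1 - sp) with hrdef
  have hr0 : 0 ≤ r := mul_nonneg (by positivity) (by linarith [sp.2.2])
  set U : Finset (V 2) := (rect_finite L W).toFinset with hU
  let An : V 2 → ℕ → Set (V 2 → Bool) := fun a s => {σ | ∃ S : Finset (V 2), S ⊆ U ∧ a ∈ S ∧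
    LC (S : Set (V 2)) ∧ S.card = s ∧ ∀ v ∈ S, σ v = false}
  have hAn : ∀ a s, Pr (fun _ => sp) (An a s) ≤ (1 / 16 : ℝ) ^ s := fun a s =>
    (animals_prob sp a s U).trans (pow_le_pow_left₀ hr0 hr s)
  let B0 : Set (V 2 → Bool) := ⋃ t ∈ Finset.range (W + 1), An (pt 0 t) (t + 1)
  let BL : Set (V 2 → Bool) := ⋃ t ∈ Finset.range (W + 1), An (pt L t) (t + 1)
  let BW : Set (V 2 → Bool) := ⋃ j ∈ Finset.range (L + 1), An (pt j 0) (W + 1)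
  have hcov : (Set.univ : Set (V 2 → Bool)) ⊆ stripE L W ∪ (B0 ∪ (BL ∪ BW)) := by
    intro σ _
    by_contra hn
    simp only [Set.mem_union, not_or] at hn
    obtain ⟨h1, h2, h3, h4⟩ := hn
    refine h1 ?_
    set C : Set (V 2) := {v | v ∈ rect L W ∧ σ v = false} with hC
    have hCU : C ⊆ U := fun v hv => by rw [hU, Set.Finite.coe_toFinset]; exact hv.1
    refine strip_det (by positivity) (by positivity) σ hC ?_ ?_ ?_
    · intro t w hw hw1 ht hc
      have ht1 : 0 ≤ t ∧ t ≤ W := ht.1.2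
      obtain ⟨t, rfl⟩ := Int.eq_ofNat_of_zero_le ht1.1
      obtain ⟨S, s1, s2, s3, s4, s5⟩ := animal_of_conn hCU ht hc 1 (s := t + 1) (by omega)
        (by rw [hw1]; simp)
      refine h2 (Set.mem_biUnion (x := t) ?_ ⟨S, s1, s2, s3, s4, fun v hv => (s5 hv).2⟩)
      simp only [Finset.coe_range, Set.mem_Iio]; omega
    · intro t w hw hw1 ht hc
      have ht1 : 0 ≤ t ∧ t ≤ W := ht.1.2
      obtain ⟨t, rfl⟩ := Int.eq_ofNat_of_zero_le ht1.1
      obtain ⟨S, s1, s2, s3, s4, s5⟩ := animal_of_conn hCU ht hc 1 (s := t + 1) (by omega)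
        (by rw [hw1]; simp)
      refine h3 (Set.mem_biUnion (x := t) ?_ ⟨S, s1, s2, s3, s4, fun v hv => (s5 hv).2⟩)
      simp only [Finset.coe_range, Set.mem_Iio]; omega
    · intro w hw hw1 v hv hv1 hc
      have hj : 0 ≤ w 0 ∧ w 0 ≤ L := hw.1.1
      obtain ⟨j, hj'⟩ := Int.eq_ofNat_of_zero_le hj.1
      obtain ⟨S, s1, s2, s3, s4, s5⟩ := animal_of_conn hCU hw hc 1 (s := W + 1) (by omega)
        (by rw [hw1, hv1]; simp)
      refine h4 (Set.mem_biUnion (x := j) ?_ ⟨S, s1, ?_, s3, s4, fun v hv => (s5 hv).2⟩)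
      · simp only [Finset.coe_range, Set.mem_Iio]; omega
      · have e : pt j 0 = w := by
          rw [← pt_eta w, hj', hw1]
        rw [e]; exact s2
  have h1 : (1 : ℝ) ≤ Pr (fun _ => sp) (stripE L W) + (Pr (fun _ => sp) B0 +
      (Pr (fun _ => sp) BL + Pr (fun _ => sp) BW)) := by
    rw [← Pr_univ (p := fun _ : V 2 => sp)]
    refine (Pr_mono hcov).trans (Pr_union_le.trans ?_)
    gcongr
    refine Pr_union_le.trans ?_
    gcongr
    exact Pr_union_le
  have hgeo : ∀ n : ℕ, ∑ t ∈ Finset.range n, (1 / 16 : ℝ) ^ (t + 1) ≤ 1 / 15 := by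
    intro n
    have : ∀ n : ℕ, ∑ t ∈ Finset.range n, (1 / 16 : ℝ) ^ (t + 1) = 1 / 15 * (1 - (1 / 16) ^ n) := by
      intro n
      induction n with
      | zero => simp
      | succ n ih => rw [Finset.sum_range_succ, ih, pow_succ]; ring
    rw [this]
    have : (0 : ℝ) ≤ (1 / 16) ^ n := by positivity
    linarith
  have hB0 : Pr (fun _ => sp) B0 ≤ 1 / 15 :=
    (Pr_biUnion_le _ _).trans ((Finset.sum_le_sum fun t _ => hAn _ _).trans (hgeo _))
  have hBL : Pr (fun _ => sp) BL ≤ 1 / 15 :=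
    (Pr_biUnion_le _ _).trans ((Finset.sum_le_sum fun t _ => hAn _ _).trans (hgeo _))
  have hBW : Pr (fun _ => sp) BW ≤ 1 / 16 := by
    refine (Pr_biUnion_le _ _).trans ((Finset.sum_le_sum fun t _ => hAn _ _).trans ?_)
    rw [Finset.sum_const, Finset.card_range, nsmul_eq_mul]
    have : ((L + 1 : ℕ) : ℝ) ≤ 2 ^ W := by exact_mod_cast hLW
    calc ((L + 1 : ℕ) : ℝ) * (1 / 16) ^ (W + 1) ≤ 2 ^ W * (1 / 16) ^ (W + 1) := by gcongr
      _ = (2 * (1 / 16)) ^ W * (1 / 16) := by rw [mul_pow, pow_succ]; ring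
      _ ≤ 1 * (1 / 16) := by
        gcongr
        exact pow_le_one₀ (by norm_num) (by norm_num)
      _ = 1 / 16 := by norm_num
  linarith

/-- Block percolation along a straight line. -/
lemma strip_HE {d : ℕ} {sp : unitInterval} (hr : (2 : ℝ) ^ kap 2 * (1 - sp) ≤ 1 / 16) {L W : ℕ}
    (hLW : L + 1 ≤ 2 ^ W) {a b : Fin d} (hab : a ≠ b) {s s' : ℤ} (hs : |s| = 1) (hs' : |s'| = 1)
    (x : V d) {Bk Wt : Set (V d)} (hx : x ∈ Wt)
    (hBk : ∀ j h : ℤ, 0 ≤ j → j ≤ L → 0 ≤ h → h ≤ W →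
      x + (s * j) • ue a + (s' * h) • ue b ∈ Bk) :
    1 / 2 ≤ Pr (fun _ => sp) (HE Bk Wt (x + (s * L) • ue a)) := by
  let φ : V 2 → V d := fun v => x + (s * v 0) • ue a + (s' * v 1) • ue b
  have e : ∀ v k, φ v k = x k + s * v 0 * ue a k + s' * v 1 * ue b k := by
    intro v k
    simp [φ]
  have ea : ∀ v, φ v a = x a + s * v 0 := fun v => by rw [e, ue_self, ue_ne hab]; ring
  have eb : ∀ v, φ v b = x b + s' * v 1 := fun v => by rw [e, ue_self, ue_ne hab.symm]; ring
  have hs0 : s ≠ 0 := by rintro rfl; simp at hs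
  have hs0' : s' ≠ 0 := by rintro rfl; simp at hs'
  have hinj : Function.Injective φ := by
    intro v w h
    have h1 := congrFun h a
    have h2 := congrFun h b
    rw [ea, ea] at h1
    rw [eb, eb] at h2
    have h1 : v 0 = w 0 := mul_left_cancel₀ hs0 (by linarith)
    have h2 : v 1 = w 1 := mul_left_cancel₀ hs0' (by linarith)
    rw [← pt_eta v, ← pt_eta w, h1, h2]
  refine (strip_prob hr L W hLW).trans ?_
  have := Pr_comap (p := fun _ : V d => sp) hinj
    ((stripE_dep L W).meas (rect_finite L W))
  rw [← this]
  refine Pr_mono ?_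
  intro σ h
  have h : conn sadj {v | v ∈ rect L W ∧ σ (φ v) = true} (pt 0 0) (pt L 0) := h
  refine ⟨x, hx, ?_⟩
  have h2 := h.map (O' := sadj) (D' := Wt ∪ {u | u ∈ Bk ∧ σ u = true}) φ ?_ ?_
  · have e1 : φ (pt 0 0) = x := by simp [φ]
    have e2 : φ (pt L 0) = x + (s * L) • ue a := by simp [φ]
    rw [e1, e2] at h2
    exact h2
  · intro v _ w _ hvw k
    by_cases hka : k = a
    · subst hka
      rw [ea, ea]
      have : x k + s * v 0 - (x k + s * w 0) = s * (v 0 - w 0) := by ring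
      rw [this, abs_mul, hs, one_mul]
      exact hvw 0
    · by_cases hkb : k = b
      · subst hkb
        rw [eb, eb]
        have : x k + s' * v 1 - (x k + s' * w 1) = s' * (v 1 - w 1) := by ring
        rw [this, abs_mul, hs', one_mul]
        exact hvw 1
      · rw [e, e, ue_ne hka, ue_ne hkb]; simp
  · rintro v ⟨⟨⟨h1, h2⟩, h3, h4⟩, h5⟩
    exact Or.inr ⟨hBk _ _ h1 h2 h3 h4, h5⟩

end strip

/-! ## Part H: gluing in shells -/

section glue
variable {d : ℕ}

/-- The connection event of two vertices. -/
def cE (D : Set (V d)) (u w : V d) : Set (Sym2 (V d) → Bool) := {ω | conn (op ω) D u w}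

lemma conn_dep {ω ω' : Sym2 (V d) → Bool} {D : Set (V d)} {u w : V d}
    (e : ∀ i ∈ ED D, ω i = ω' i) (h : conn (op ω) D u w) : conn (op ω') D u w := by
  refine h.mono (fun a ha b hb hab => ⟨hab.1, ?_⟩) le_rfl
  rw [← e _ (mem_ED.2 ⟨ha, hb⟩)]; exact hab.2

lemma conn_up {ω ω' : Sym2 (V d) → Bool} {D : Set (V d)} {u w : V d} (e : ω ≤ ω')
    (h : conn (op ω) D u w) : conn (op ω') D u w :=
  h.mono (fun _ _ _ _ hab => op_mono e hab) le_rfl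

/-- All vertices of the two block domains are connected in `Q`. -/
def CE (n : ℕ) (Q : Set (V d)) (b b' : V d) : Set (Sym2 (V d) → Bool) :=
  {ω | ∀ v ∈ dom n b, ∀ v' ∈ dom n b', conn (op ω) Q v v'}

lemma CE_dep (n : ℕ) (Q : Set (V d)) (b b' : V d) : Dep (ED Q) (CE n Q b b') :=
  fun _ _ e h v hv v' hv' => conn_dep e (h v hv v' hv')

lemma CE_upper (n : ℕ) (Q : Set (V d)) (b b' : V d) : IsUpperSet (CE n Q b b') :=
  fun _ _ e h v hv v' hv' => conn_up e (h v hv v' hv')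

lemma CE_symm {n : ℕ} {Q : Set (V d)} {b b' : V d} : CE n Q b b' ⊆ CE n Q b' b :=
  fun _ h v hv v' hv' => (h v' hv' v hv).symm op.symm

lemma cb_mem_dom (n : ℕ) (b : V d) : cb n b ∈ dom n b := fun i => by
  simp only [sub_self, abs_zero]; positivity

lemma CE_trans {n : ℕ} {Q : Set (V d)} {b b' b'' : V d} :
    CE n Q b b' ∩ CE n Q b' b'' ⊆ CE n Q b b'' :=
  fun _ h v hv v' hv' => (h.1 v hv _ (cb_mem_dom n b')).trans (h.2 _ (cb_mem_dom n b') v' hv')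

lemma CE_chain {p : unitInterval} {n : ℕ} {Q : Set (V d)} (hQ : Q.Finite) {b b' b'' : V d} {c c' : ℝ}
    (hc0 : 0 ≤ c) (hc0' : 0 ≤ c')
    (h : c ≤ Pq p (CE n Q b b')) (h' : c' ≤ Pq p (CE n Q b' b'')) :
    c * c' ≤ Pq p (CE n Q b b'') := by
  refine (mul_le_mul h h' hc0' (hc0.trans h)).trans ?_
  exact (fkg_up (CE_dep n Q b b') (CE_dep n Q b' b'') (ED_finite hQ) (CE_upper _ _ _ _)
    (CE_upper _ _ _ _)).trans (Pr_mono CE_trans)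

/-- All edges of a block domain are open. -/
def OE (n : ℕ) (b : V d) : Set (Sym2 (V d) → Bool) := {ω | ∀ e ∈ (ED_finite (dom_finite n b)).toFinset, ω e = true}

lemma OE_prob (p : unitInterval) (n : ℕ) (b : V d) :
    Pq p (OE n b) = (p : ℝ) ^ (ED (bx (0 : V d) ((2 * d + 4) * n))).ncard := by
  unfold Pq OE
  rw [Pr_all_true, Finset.prod_const, ← Set.ncard_eq_toFinset_card _ (ED_finite (dom_finite n b))]
  unfold dom
  rw [ncard_ED_bx]

lemma OE_upper (n : ℕ) (b : V d) : IsUpperSet (OE n b) := by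
  intro ω ω' h hω e he
  have := h e
  rw [hω e he] at this
  exact top_le_iff.1 this

lemma OE_dep (n : ℕ) (b : V d) : Dep (ED (dom n b)) (OE n b) := by
  have := Dep_all (ED_finite (dom_finite n b)).toFinset true
  rwa [Set.Finite.coe_toFinset] at this

lemma OE_conn {n : ℕ} {b : V d} {ω : Sym2 (V d) → Bool} (h : ω ∈ OE n b) {u v : V d}
    (hu : u ∈ dom n b) (hv : v ∈ dom n b) : conn (op ω) (dom n b) u v := by
  refine (bx_conn u hu v hv).mono ?_ le_rfl
  intro x hx y hy hxy
  refine ⟨hxy, h _ ?_⟩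
  rw [Set.Finite.mem_toFinset]
  exact mem_ED.2 ⟨hx, hy⟩

/-- The shell of blocks. -/
def Sh (d : ℕ) (k W : ℕ) : Set (V d) := {b | (∀ j, |b j| ≤ k + W) ∧ ∃ i, (k : ℤ) ≤ |b i|}

lemma Sh_finite (k W : ℕ) : (Sh d k W).Finite :=
  (bx_finite 0 (k + W)).subset fun b hb j => by simpa using hb.1 j

/-- The shell of vertices. -/
def Qs (d : ℕ) (ρ ρ' : ℤ) : Set (V d) := {v | v ∈ bx 0 ρ' ∧ v ∉ bx 0 ρ}

lemma Qs_finite (ρ ρ' : ℤ) : (Qs d ρ ρ').Finite := (bx_finite 0 ρ').subset fun _ h => h.1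

lemma dom_sub_Qs {n k W : ℕ} (hn : 1 ≤ n) {b : V d} (hb : b ∈ Sh d k W) {ρ ρ' : ℤ}
    (h1 : ρ + 1 ≤ (k - (2 * d + 4)) * n) (h2 : (k + W + (2 * d + 4)) * n ≤ ρ') :
    dom n b ⊆ Qs d ρ ρ' := by
  intro v hv
  have hn' : (0 : ℤ) < n := by exact_mod_cast hn
  have key : ∀ j, |(n : ℤ) * b j| = n * |b j| := fun j => by rw [abs_mul, Nat.abs_cast]
  refine ⟨fun j => ?_, fun h => ?_⟩
  · have e1 := hv j
    have e2 := abs_add_le (v j - cb n b j) (cb n b j)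
    have e3 : v j - cb n b j + cb n b j = v j - (0 : V d) j := by simp
    rw [e3] at e2
    have e4 : |cb n b j| = n * |b j| := key j
    have e5 := hb.1 j
    nlinarith
  · obtain ⟨i, hi⟩ := hb.2
    have e1 := hv i
    have e2 := abs_sub_abs_le_abs_sub (cb n b i) (v i)
    rw [abs_sub_comm] at e2
    have e4 : |cb n b i| = n * |b i| := key i
    have e5 : |v i| ≤ ρ := by simpa using h i
    nlinarith

lemma glue_step (hd : 0 < d) {q0 p : unitInterval} (hqp : q0 < p) (hq : perc d q0) :
    ∃ n0 : ℕ, ∀ n : ℕ, n0 ≤ n → 1 ≤ n → ∃ c > 0, ∀ k W : ℕ, 2 * k + 1 ≤ 2 ^ W →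
      ∀ ρ ρ' : ℤ, ρ + 1 ≤ (k - (2 * d + 4)) * n → (k + W + (2 * d + 4)) * n ≤ ρ' →
      ∀ (z : V d) (i a : Fin d), i ≠ a → |z i| = k → (∀ j, |z j| ≤ k) →
      c ≤ Pq p (CE n (Qs d ρ ρ') z (Function.update z a k)) := by
  have hspI : (1 - 1 / (16 * 2 ^ kap 2) : ℝ) ∈ Set.Icc (0 : ℝ) 1 := by
    have h1 : (1 : ℝ) ≤ 16 * 2 ^ kap 2 := by
      have : (1 : ℝ) ≤ 2 ^ kap 2 := one_le_pow₀ (by norm_num)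
      linarith
    have h2 : (1 : ℝ) / (16 * 2 ^ kap 2) ≤ 1 := (div_le_one (by positivity)).2 h1
    have h3 : (0 : ℝ) ≤ 1 / (16 * 2 ^ kap 2) := by positivity
    constructor <;> linarith
  set sp : unitInterval := ⟨_, hspI⟩ with hsp
  have hsp1 : (sp : ℝ) < 1 := by
    have h3 : (0 : ℝ) < 1 / (16 * 2 ^ kap 2) := by positivity
    simp only [hsp]; linarith
  have hspr : (2 : ℝ) ^ kap 2 * (1 - sp) ≤ 1 / 16 := by
    simp only [hsp]
    rw [sub_sub_cancel]
    apply le_of_eq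
    field_simp
  obtain ⟨n0, hblk⟩ := block_dyn hd hqp hq hsp1
  refine ⟨n0, fun n hn hn1 => ?_⟩
  have hp0 : 0 < (p : ℝ) := lt_of_le_of_lt q0.2.1 hqp
  set M := (ED (bx (0 : V d) ((2 * d + 4) * n))).ncard with hM
  refine ⟨(p : ℝ) ^ M * (p : ℝ) ^ M * (1 / 2), by positivity, ?_⟩
  intro k W hkW ρ ρ' hρ hρ' z i a hia hzi hz
  set z' := Function.update z a (k : ℤ) with hz'
  set Q := Qs d ρ ρ' with hQ
  have hzS : z ∈ Sh d k W := ⟨fun j => (hz j).trans (by omega), i, hzi.ge⟩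
  have hz'S : z' ∈ Sh d k W := by
    refine ⟨fun j => ?_, i, ?_⟩
    · by_cases hj : j = a
      · subst hj; rw [hz', Function.update_self, Nat.abs_cast]; omega
      · rw [hz', Function.update_of_ne hj]; exact (hz j).trans (by omega)
    · rw [hz', Function.update_of_ne hia]; exact hzi.ge
  set Bk : Finset (V d) := (Sh_finite k W).toFinset with hBk
  have hQQ : QQ n Bk ⊆ Q := by
    intro v hv
    simp only [QQ, Set.mem_iUnion] at hv
    obtain ⟨b, hb, hv⟩ := hv
    exact dom_sub_Qs hn1 (by simpa [hBk] using hb) hρ hρ' hv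
  have hdz := dom_sub_Qs hn1 hzS hρ hρ'
  have hdz' := dom_sub_Qs hn1 hz'S hρ hρ'
  have hza := abs_le.1 (hz a)
  obtain ⟨L, hL⟩ := Int.eq_ofNat_of_zero_le (show (0 : ℤ) ≤ k - z a by omega)
  obtain ⟨s', hs', hzs⟩ : ∃ s' : ℤ, |s'| = 1 ∧ z i = s' * k := by
    rcases abs_choice (z i) with h | h
    · exact ⟨1, by simp, by omega⟩
    · exact ⟨-1, by simp, by omega⟩
  have ez : z + ((1 : ℤ) * L) • ue a = z' := by
    ext j
    by_cases hj : j = a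
    · subst hj
      rw [hz', Function.update_self]
      simp only [Pi.add_apply, Pi.smul_apply, smul_eq_mul, ue_self]
      omega
    · rw [hz', Function.update_of_ne hj]
      simp [ue_ne hj]
  have hHE : 1 / 2 ≤ Pr (fun _ => sp) (HE (Bk : Set (V d)) (vis n (dom n z)) z') := by
    rw [← ez]
    refine strip_HE hspr (W := W) (L := L) ?_ hia.symm (by simp) hs' z ?_ ?_
    · have : (L : ℤ) ≤ 2 * k := by omega
      have : L ≤ 2 * k := by exact_mod_cast this
      omega
    · exact ⟨cb n z, cb_mem_dom n z, fun j => by simp⟩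
    · intro j h hj0 hjL hh0 hhW
      rw [hBk, Set.Finite.coe_toFinset]
      have ei : (z + ((1 : ℤ) * j) • ue a + (s' * h) • ue i) i = s' * (k + h) := by
        simp only [Pi.add_apply, Pi.smul_apply, smul_eq_mul, ue_self, ue_ne hia, hzs]
        ring
      have ei' : |s' * ((k : ℤ) + h)| = k + h := by
        rw [abs_mul, hs', one_mul, abs_of_nonneg (by omega)]
      refine ⟨fun m => ?_, i, ?_⟩
      · by_cases hm : m = i
        · rw [hm, ei, ei']; omega
        · by_cases hm' : m = a
          · subst hm'
            simp only [Pi.add_apply, Pi.smul_apply, smul_eq_mul, ue_self, ue_ne hia.symm]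
            rw [abs_le]
            omega
          · simp only [Pi.add_apply, Pi.smul_apply, smul_eq_mul, ue_ne hm, ue_ne hm', mul_zero,
              add_zero]
            exact (hz m).trans (by omega)
      · rw [ei, ei']; omega
  have hb := hHE.trans (hblk n hn hn1 Bk (dom n z) (dom_finite n z) bx_conn
    ⟨cb n z, bx_mono (by nlinarith)⟩ z')
  have hfin := ED_finite (Qs_finite (d := d) ρ ρ')
  have hED : ∀ {A B : Set (V d)}, A ⊆ B → ED A ⊆ ED B := fun h e he v hv => h (he v hv)
  have d1 : Dep (ED Q) (OE n z) := (OE_dep n z).mono (hED hdz)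
  have d2 : Dep (ED Q) (OE n z') := (OE_dep n z').mono (hED hdz')
  have d3 : Dep (ED Q) (hitE (QQ n Bk) (dom n z) (bx (cb n z') (3 * n))) :=
    (hitE_dep _ _ _).mono (hED hQQ)
  have f1 := fkg_up (p := fun _ => p) d1 d2 hfin (OE_upper n z) (OE_upper n z')
  have f2 := fkg_up (p := fun _ => p) (d1.inter d2) d3 hfin ((OE_upper n z).inter (OE_upper n z'))
    (hitE_upper _ _ _)
  have o1 := OE_prob p n z
  have o2 := OE_prob p n z'
  unfold Pq at o1 o2 hb
  rw [o1, o2] at f1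
  calc (p : ℝ) ^ M * (p : ℝ) ^ M * (1 / 2)
      ≤ Pr (fun _ => p) (OE n z ∩ OE n z') * Pr (fun _ => p) (hitE (QQ n Bk) (dom n z) (bx (cb n z') (3 * n))) :=
        mul_le_mul f1 hb (by norm_num) Pr_nonneg
    _ ≤ _ := f2
    _ ≤ _ := by
      refine Pr_mono ?_
      rintro ω ⟨⟨h1, h2⟩, x, hx, y, hy, hc⟩ v hv v' hv'
      have hy' : y ∈ dom n z' := bx_mono (by nlinarith) hy
      exact ((OE_conn h1 hv hx).mono_set hdz).trans ((hc.mono_set hQQ).trans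
        ((OE_conn h2 hy' hv').mono_set hdz'))

/-- Any two blocks on the sphere of radius `k` are glued with a fixed probability. -/
lemma glue_pair (hd : 2 ≤ d) {q0 p : unitInterval} (hqp : q0 < p) (hq : perc d q0) :
    ∃ n0 : ℕ, ∀ n : ℕ, n0 ≤ n → 1 ≤ n → ∃ c > 0, ∀ k W : ℕ, 2 * k + 1 ≤ 2 ^ W →
      ∀ ρ ρ' : ℤ, ρ + 1 ≤ (k - (2 * d + 4)) * n → (k + W + (2 * d + 4)) * n ≤ ρ' →
      ∀ x y : V d, (∃ i, |x i| = k) → (∀ j, |x j| ≤ k) → (∃ i, |y i| = k) → (∀ j, |y j| ≤ k) →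
      c ≤ Pq p (CE n (Qs d ρ ρ') x y) := by
  classical
  obtain ⟨n0, h⟩ := glue_step (by omega) hqp hq
  refine ⟨n0, fun n hn hn1 => ?_⟩
  obtain ⟨c, hc, h⟩ := h n hn hn1
  refine ⟨(c ^ (d - 1) * c) * (c ^ (d - 1) * c), by positivity, ?_⟩
  intro k W hkW ρ ρ' hρ hρ' x y hx1 hx2 hy1 hy2
  have hfin := Qs_finite (d := d) ρ ρ'
  have main : ∀ x : V d, (∃ i, |x i| = k) → (∀ j, |x j| ≤ k) →
      c ^ (d - 1) * c ≤ Pq p (CE n (Qs d ρ ρ') x (fun _ => (k : ℤ))) := by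
    rintro x ⟨i, hi⟩ hx
    let f : Finset (Fin d) → V d := fun T j => if j ∈ T then (k : ℤ) else x j
    have hf : ∀ T j, |f T j| ≤ k := by
      intro T j
      simp only [f]
      split_ifs
      · simp
      · exact hx j
    have hfu : ∀ (T : Finset (Fin d)) (a : Fin d), Function.update (f T) a (k : ℤ) = f (insert a T) := by
      intro T a
      ext j
      by_cases hj : j = a
      · subst hj; simp [f]
      · rw [Function.update_of_ne hj]; simp [f, hj]
    have hT : ∀ T : Finset (Fin d), T.Nonempty → i ∉ T →
        c ^ T.card ≤ Pq p (CE n (Qs d ρ ρ') x (f T)) := by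
      intro T hne
      induction hne using Finset.Nonempty.cons_induction with
      | singleton a =>
        intro hiT
        have := h k W hkW ρ ρ' hρ hρ' x i a (by simpa using hiT) hi hx
        have e : Function.update x a (k : ℤ) = f {a} := by
          have := hfu ∅ a
          simpa [f] using this
        rw [e] at this
        simpa using this
      | cons a T ha hne ih =>
        intro hiT
        rw [Finset.mem_cons, not_or] at hiT
        have h1 := ih hiT.2
        have h2 := h k W hkW ρ ρ' hρ hρ' (f T) i a hiT.1 (by simp [f, hiT.2, hi]) (hf T)
        rw [hfu] at h2
        have := CE_chain hfin (by positivity) hc.le h1 h2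
        rw [Finset.card_cons, pow_succ, Finset.cons_eq_insert]
        exact this
    have hcard : (Finset.univ.erase i).card = d - 1 := by
      rw [Finset.card_erase_of_mem (Finset.mem_univ _), Finset.card_univ, Fintype.card_fin]
    have hne : (Finset.univ.erase i).Nonempty := by
      rw [← Finset.card_pos, hcard]; omega
    have h1 := hT _ hne (by simp)
    rw [hcard] at h1
    obtain ⟨a, ha⟩ := hne
    have hai : a ≠ i := Finset.ne_of_mem_erase ha
    have h2 := h k W hkW ρ ρ' hρ hρ' (f (Finset.univ.erase i)) a i hai (by simp [f, hai]) (hf _)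
    have e : Function.update (f (Finset.univ.erase i)) i (k : ℤ) = fun _ => (k : ℤ) := by
      rw [hfu]
      ext j
      by_cases hj : j = i
      · simp [f, hj]
      · simp [f, hj]
    rw [e] at h2
    exact CE_chain hfin (by positivity) hc.le h1 h2
  have h1 := main x hx1 hx2
  have h2 := main y hy1 hy2
  exact CE_chain hfin (by positivity) (by positivity) h1 (h2.trans (Pr_mono CE_symm))

end glue

/-! ## Local uniqueness -/

section uniq
variable {d : ℕ}

/-- Two vertices reach the sphere of radius `ρ` without being connected in the box. -/
def SE (u w : V d) (ρ : ℤ) : Set (Sym2 (V d) → Bool) :=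
  {ω | (∃ v ∈ sph (0 : V d) ρ, conn (op ω) (bx 0 ρ) u v) ∧
    (∃ v ∈ sph (0 : V d) ρ, conn (op ω) (bx 0 ρ) w v) ∧ ¬ conn (op ω) (bx 0 ρ) u w}

lemma SE_dep (u w : V d) (ρ : ℤ) : Dep (ED (bx 0 ρ)) (SE u w ρ) := by
  rintro ω ω' e ⟨⟨v, hv, h1⟩, ⟨v', hv', h2⟩, h3⟩
  exact ⟨⟨v, hv, conn_dep e h1⟩, ⟨v', hv', conn_dep e h2⟩,
    fun h => h3 (conn_dep (fun i hi => (e i hi).symm) h)⟩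

lemma SE_anti {u w : V d} {ρ ρ' : ℤ} (h : ρ ≤ ρ') (hu : u ∈ bx 0 ρ) (hw : w ∈ bx 0 ρ) :
    SE u w ρ' ⊆ SE u w ρ := by
  have key : ∀ (ω : Sym2 (V d) → Bool) (u : V d), u ∈ bx 0 ρ → (∃ v ∈ sph (0 : V d) ρ', conn (op ω) (bx 0 ρ') u v) →
      ∃ v ∈ sph (0 : V d) ρ, conn (op ω) (bx 0 ρ) u v := by
    rintro ω u hu ⟨v, ⟨_, i, hi⟩, hc⟩
    obtain ⟨v', hv', hc'⟩ := hc.sphere (fun a b h => h.1) hu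
      (fun hv => by have := hv i; omega)
    exact ⟨v', hv', hc'.mono_set Set.inter_subset_right⟩
  rintro ω ⟨h1, h2, h3⟩
  exact ⟨key ω u hu h1, key ω w hw h2, fun hc => h3 (hc.mono_set (bx_mono h))⟩

lemma step_out {n k : ℕ} (hn : 1 ≤ n) (hk : 2 * d + 5 ≤ k) {u : V d}
    (hu : u ∈ sph (0 : V d) (((k : ℤ) - (2 * d + 4)) * n - 1)) :
    ∃ u' b : V d, adj u u' ∧ u' ∉ bx (0 : V d) (((k : ℤ) - (2 * d + 4)) * n - 1) ∧ u' ∈ dom n b ∧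
      (∃ i, |b i| = k) ∧ ∀ j, |b j| ≤ k := by
  obtain ⟨hu1, i, hi⟩ := hu
  have hn' : (0 : ℤ) < n := by exact_mod_cast hn
  have hk' : (2 * d + 5 : ℤ) ≤ k := by exact_mod_cast hk
  set m : ℤ := (k : ℤ) - (2 * d + 4) with hm
  have hm1 : 1 ≤ m := by omega
  have hmn : 1 ≤ m * n := by nlinarith
  simp only [Pi.zero_apply, sub_zero] at hi
  have hu2 : ∀ j, |u j| ≤ m * n - 1 := fun j => by simpa using hu1 j
  obtain ⟨s, hs, hsu⟩ : ∃ s : ℤ, (s = 1 ∨ s = -1) ∧ u i = s * (m * n - 1) := by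
    rcases abs_choice (u i) with h | h
    · exact ⟨1, Or.inl rfl, by rw [one_mul, ← hi, h]⟩
    · exact ⟨-1, Or.inr rfl, by rw [← hi, h]; ring⟩
  have hsabs : |s| = 1 := by rcases hs with rfl | rfl <;> simp
  refine ⟨Function.update u i (u i + s), Function.update (fun j => u j / n) i (s * k), ?_, ?_, ?_,
    ⟨i, ?_⟩, ?_⟩
  · refine adj_iff.2 ⟨i, by simpa using hsabs, fun j hj => by simp [hj]⟩
  · intro h
    have := h i
    simp only [Function.update_self, Pi.zero_apply, sub_zero] at this
    rw [hsu] at this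
    have e : s * (m * n - 1) + s = s * (m * n) := by ring
    rw [e, abs_mul, hsabs, one_mul, abs_of_nonneg (by omega)] at this
    omega
  · intro j
    by_cases hj : j = i
    · subst hj
      simp only [Function.update_self, cb]
      rw [hsu]
      have e : s * (m * n - 1) + s - n * (s * k) = s * (-((2 * d + 4) * n)) := by rw [hm]; ring
      rw [e, abs_mul, hsabs, one_mul, abs_neg, abs_of_nonneg (by positivity)]
    · simp only [Function.update_of_ne hj, cb]
      have e1 := Int.emod_add_mul_ediv (u j) n
      have e2 := Int.emod_nonneg (u j) hn'.ne'
      have e3 := Int.emod_lt_of_pos (u j) hn'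
      have e4 : (n : ℤ) ≤ (2 * d + 4) * n := by nlinarith [(Nat.cast_nonneg d : (0:ℤ) ≤ d)]
      rw [abs_le]
      constructor <;> linarith
  · simp [abs_mul, hsabs]
  · intro j
    by_cases hj : j = i
    · subst hj; simp [abs_mul, hsabs]
    · simp only [Function.update_of_ne hj]
      have := abs_le.1 (hu2 j)
      have e1 : u j / n < m := Int.ediv_lt_of_lt_mul hn' (by linarith)
      have e2 : -m ≤ u j / n := (Int.le_ediv_iff_mul_le hn').2 (by linarith)
      rw [abs_le]; constructor <;> linarith [(Nat.cast_nonneg d : (0:ℤ) ≤ d)]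

lemma SE_step {p : unitInterval} {n k W : ℕ} (hn : 1 ≤ n) (hk : 2 * d + 5 ≤ k) {c : ℝ} (hc : 0 ≤ c)
    {ρ ρ' : ℤ} (hρ : ρ = ((k : ℤ) - (2 * d + 4)) * n - 1) (hρ' : (k + W + (2 * d + 4)) * n ≤ ρ')
    (h : ∀ x y : V d, (∃ i, |x i| = k) → (∀ j, |x j| ≤ k) → (∃ i, |y i| = k) → (∀ j, |y j| ≤ k) →
      c ≤ Pq p (CE n (Qs d ρ ρ') x y)) {u w : V d} (hu : u ∈ bx 0 ρ) (hw : w ∈ bx 0 ρ) :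
    Pq p (SE u w ρ') ≤ (1 - p * p * c) * Pq p (SE u w ρ) := by
  classical
  have hn' : (0 : ℤ) < n := by exact_mod_cast hn
  have hd0 : (0 : ℤ) ≤ d := by positivity
  have hρρ : ρ + 1 ≤ ρ' := by
    rw [hρ]; nlinarith [(Nat.cast_nonneg W : (0:ℤ) ≤ W)]
  have hfin := bx_finite (0 : V d) ρ
  have ex : ∀ C : Set (V d), ∃ t : V d × V d × V d, (∃ v ∈ sph (0 : V d) ρ, v ∈ C) →
      (t.1 ∈ C ∧ t.1 ∈ bx 0 ρ ∧ adj t.1 t.2.1 ∧ t.2.1 ∉ bx 0 ρ ∧ t.2.1 ∈ dom n t.2.2 ∧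
        (∃ i, |t.2.2 i| = k) ∧ ∀ j, |t.2.2 j| ≤ k) := by
    intro C
    by_cases hC : ∃ v ∈ sph (0 : V d) ρ, v ∈ C
    · obtain ⟨v, hv, hvC⟩ := hC
      obtain ⟨u', b, h1, h2, h3, h4, h5⟩ := step_out hn hk (u := v) (by rw [← hρ]; exact hv)
      rw [← hρ] at h2
      exact ⟨(v, u', b), fun _ => ⟨hvC, hv.1, h1, h2, h3, h4, h5⟩⟩
    · exact ⟨(0, 0, 0), fun h => absurd h hC⟩
  choose t ht using ex
  set cl : (Sym2 (V d) → Bool) → V d → Set (V d) := fun ω u => {v | conn (op ω) (bx 0 ρ) u v} with hcl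
  have cldep : ∀ u ω ω', (∀ i ∈ ED (bx (0 : V d) ρ), ω i = ω' i) → cl ω u = cl ω' u := by
    intro u ω ω' e
    ext v
    exact ⟨fun h => conn_dep e h, fun h => conn_dep (fun i hi => (e i hi).symm) h⟩
  have hfp : (𝒫 (bx (0 : V d) ρ)).Finite := hfin.finite_subsets
  set I : Finset (Set (V d) × Set (V d)) := (hfp.toFinset ×ˢ hfp.toFinset).filter
    (fun C => (∃ v ∈ sph (0 : V d) ρ, v ∈ C.1) ∧ (∃ v ∈ sph (0 : V d) ρ, v ∈ C.2) ∧ w ∉ C.1) with hI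
  set G : Set (V d) × Set (V d) → Set (Sym2 (V d) → Bool) :=
    fun C => {ω | cl ω u = C.1 ∧ cl ω w = C.2} with hG
  set e1 : Set (V d) → Sym2 (V d) := fun C => s((t C).1, (t C).2.1) with he1
  set B : Set (V d) × Set (V d) → Set (Sym2 (V d) → Bool) := fun C =>
    ({ω | ω (e1 C.1) = true} ∩ {ω | ω (e1 C.2) = true}) ∩
      CE n (Qs d ρ ρ') (t C.1).2.2 (t C.2).2.2 with hB
  set T : Set (V d) × Set (V d) → Set (Sym2 (V d)) := fun C =>
    insert (e1 C.1) (insert (e1 C.2) (ED (Qs d ρ ρ'))) with hT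
  have hTfin : ∀ C, (T C).Finite := fun C =>
    ((ED_finite (Qs_finite ρ ρ')).insert _).insert _
  have d1 : ∀ C, Dep (T C) {ω : Sym2 (V d) → Bool | ω (e1 C.1) = true} := fun C =>
    (Dep_coord _ _).mono (by simp [hT])
  have d2 : ∀ C, Dep (T C) {ω : Sym2 (V d) → Bool | ω (e1 C.2) = true} := fun C =>
    (Dep_coord _ _).mono (by simp [hT])
  have d3 : ∀ C, Dep (T C) (CE n (Qs d ρ ρ') (t C.1).2.2 (t C.2).2.2) := fun C =>
    (CE_dep _ _ _ _).mono (fun x hx => by simp [hT, hx])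
  have up : ∀ e : Sym2 (V d), IsUpperSet {ω : Sym2 (V d) → Bool | ω e = true} := by
    intro e ω ω' h hω
    have := h e
    rw [show ω e = true from hω] at this
    exact top_le_iff.1 this
  have memI : ∀ C ∈ I, (∃ v ∈ sph (0 : V d) ρ, v ∈ C.1) ∧ (∃ v ∈ sph (0 : V d) ρ, v ∈ C.2) ∧ w ∉ C.1 :=
    fun C hC => (Finset.mem_filter.1 hC).2
  have main := Pr_explore (p := fun _ => p) I G B (fun _ => ED (bx (0 : V d) ρ)) T
    (fun C _ ω ω' e h => by
      have a := cldep u ω ω' e; have b := cldep w ω ω' e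
      exact ⟨a ▸ h.1, b ▸ h.2⟩)
    (fun C _ => ((d1 C).inter (d2 C)).inter (d3 C)) (fun _ _ => ED_finite hfin) (fun C _ => hTfin C)
    (fun C hC => by
      obtain ⟨g1, g2, -⟩ := memI C hC
      have h1 := ht _ g1
      have h2 := ht _ g2
      rw [Set.disjoint_right]
      intro e he he'
      rcases he with rfl | rfl | he
      · exact h1.2.2.2.1 (mem_ED.1 he').2
      · exact h2.2.2.2.1 (mem_ED.1 he').2
      · induction e using Sym2.ind with
        | _ a b => exact (mem_ED.1 he).1.2 (mem_ED.1 he').1)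
    (fun C _ C' _ hne => by
      rw [Function.onFun, Set.disjoint_left]
      intro ω h h'
      exact hne (Prod.ext (h.1.symm.trans h'.1) (h.2.symm.trans h'.2)))
    (SE u w ρ ∩ (SE u w ρ')ᶜ)
    (fun C hC => by
      rintro ω ⟨⟨c1, c2⟩, ⟨o1, o2⟩, o3⟩
      obtain ⟨g1, g2, g3⟩ := memI C hC
      have h1 := ht _ g1
      have h2 := ht _ g2
      refine ⟨⟨?_, ?_, ?_⟩, fun hS => hS.2.2 ?_⟩
      · obtain ⟨v, hv, hvC⟩ := g1
        rw [← c1] at hvC; exact ⟨v, hv, hvC⟩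
      · obtain ⟨v, hv, hvC⟩ := g2
        rw [← c2] at hvC; exact ⟨v, hv, hvC⟩
      · rw [← c1] at g3; exact g3
      · have a1 : conn (op ω) (bx 0 ρ) u (t C.1).1 := by
          have := h1.1; rw [← c1] at this; rw [← c1]; exact this
        have a2 : conn (op ω) (bx 0 ρ) w (t C.2).1 := by
          have := h2.1; rw [← c2] at this; rw [← c2]; exact this
        have inb : ∀ a b : V d, a ∈ bx (0 : V d) ρ → adj a b → b ∈ bx (0 : V d) ρ' := by
          intro a b ha hab i
          have q1 := abs_le.1 (ha i)
          have q2 := abs_le.1 (hab.abs_le i)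
          rw [abs_le]
          constructor <;> linarith
        have b1 : conn (op ω) (bx 0 ρ') (t C.1).1 (t C.1).2.1 :=
          conn.single ⟨h1.2.2.1, o1⟩ (bx_mono (by omega) h1.2.1) (inb _ _ h1.2.1 h1.2.2.1)
        have b2 : conn (op ω) (bx 0 ρ') (t C.2).1 (t C.2).2.1 :=
          conn.single ⟨h2.2.2.1, o2⟩ (bx_mono (by omega) h2.2.1) (inb _ _ h2.2.1 h2.2.2.1)
        have b3 : conn (op ω) (bx 0 ρ') (t C.1).2.1 (t C.2).2.1 :=
          (o3 _ h1.2.2.2.2.1 _ h2.2.2.2.2.1).mono_set fun v hv => hv.1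
        exact (((a1.mono_set (bx_mono (by omega))).trans b1).trans b3).trans
          ((((a2.mono_set (bx_mono (by omega))).trans b2)).symm op.symm))
    (fun _ => p * p * c)
    (fun C hC => by
      obtain ⟨g1, g2, -⟩ := memI C hC
      have h1 := ht _ g1
      have h2 := ht _ g2
      have f1 := fkg_up (p := fun _ => p) (d1 C) (d2 C) (hTfin C) (up _) (up _)
      have f2 := fkg_up (p := fun _ => p) ((d1 C).inter (d2 C)) (d3 C) (hTfin C)
        ((up _).inter (up _)) (CE_upper _ _ _ _)
      rw [Pr_true, Pr_true] at f1
      have f3 := h (t C.1).2.2 (t C.2).2.2 h1.2.2.2.2.2.1 h1.2.2.2.2.2.2 h2.2.2.2.2.2.1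
        h2.2.2.2.2.2.2
      refine le_trans ?_ f2
      exact mul_le_mul f1 f3 hc Pr_nonneg)
  rw [← Finset.sum_mul] at main
  have hcover : Pq p (SE u w ρ) ≤ ∑ C ∈ I, Pr (fun _ => p) (G C) := by
    refine le_trans (Pr_mono ?_) (Pr_biUnion_le I G)
    rintro ω ⟨h1, h2, h3⟩
    refine Set.mem_iUnion₂.2 ⟨(cl ω u, cl ω w), ?_, rfl, rfl⟩
    refine Finset.mem_filter.2 ⟨Finset.mem_product.2 ⟨?_, ?_⟩, h1, h2, h3⟩
    · exact hfp.mem_toFinset.2 fun v hv => conn.mem hv hu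
    · exact hfp.mem_toFinset.2 fun v hv => conn.mem hv hw
  have hsum : Pq p (SE u w ρ) = Pq p (SE u w ρ') + Pq p (SE u w ρ ∩ (SE u w ρ')ᶜ) := by
    have hsub := SE_anti (by omega : ρ ≤ ρ') hu hw
    have m1 := (SE_dep u w ρ').meas (ED_finite (bx_finite _ _))
    have := measureReal_inter_add_sdiff (μ := mu (fun _ : Sym2 (V d) => p)) (s := SE u w ρ) m1
    rw [Set.inter_eq_right.2 hsub] at this
    exact this.symm
  have hpc : (0 : ℝ) ≤ p * p * c := mul_nonneg (mul_nonneg p.2.1 p.2.1) hc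
  have := mul_le_mul_of_nonneg_right hcover hpc
  have main' : (∑ C ∈ I, Pr (fun _ => p) (G C)) * (p * p * c) ≤ Pq p (SE u w ρ ∩ (SE u w ρ')ᶜ) := main
  nlinarith

lemma bx_card (r : ℕ) : (bx (0 : V d) r).ncard = (2 * r + 1) ^ d := by
  have e : bx (0 : V d) r = ((Finset.Icc (fun _ => -(r : ℤ)) (fun _ => (r : ℤ)) : Finset (V d)) : Set (V d)) := by
    ext v
    simp only [bx, Set.mem_ofPred_eq, Pi.zero_apply, sub_zero, Finset.coe_Icc, Set.mem_Icc, abs_le,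
      Pi.le_def]
    exact forall_and
  rw [e, Set.ncard_coe_finset, Pi.card_Icc]
  simp only [Int.card_Icc, Finset.prod_const, Finset.card_univ, Fintype.card_fin]
  congr 1
  omega

/-- Failure of uniqueness of the crossing cluster, from `2N` to `4N`. -/
def LU (d N : ℕ) : Set (Sym2 (V d) → Bool) :=
  {ω | ∃ u ∈ bx (0 : V d) (2 * N), ∃ w ∈ bx (0 : V d) (2 * N), ω ∈ SE u w (4 * N)}

lemma LU_dep (N : ℕ) : Dep (ED (bx 0 (4 * N))) (LU d N) := by
  rintro ω ω' e ⟨u, hu, w, hw, h⟩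
  exact ⟨u, hu, w, hw, SE_dep u w _ ω ω' e h⟩

lemma nine_sq : ∀ m : ℕ, 10 ≤ m → 9 * m ^ 2 ≤ 2 ^ m := by
  intro m hm
  induction m, hm using Nat.le_induction with
  | base => norm_num
  | succ m hm ih => rw [pow_succ 2 m]; nlinarith

/-- Uniqueness holds with high probability on large scales. -/
lemma local_unique (hd : 2 ≤ d) {q0 p : unitInterval} (hqp : q0 < p) (hq : perc d q0) {ε : ℝ}
    (hε : 0 < ε) (N1 : ℕ) : ∃ N : ℕ, N1 ≤ N ∧ Pq p (LU d N) ≤ ε := by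
  classical
  obtain ⟨n0, h⟩ := glue_pair hd hqp hq
  set n := max n0 1 with hn
  have hn1 : 1 ≤ n := le_max_right _ _
  obtain ⟨c, hc, h⟩ := h n (le_max_left _ _) hn1
  clear_value n
  have hp0 : (0 : ℝ) < p := lt_of_le_of_lt q0.2.1 hqp
  set c2 : ℝ := p * p * c with hc2
  have hc2p : 0 < c2 := by positivity
  have hc1 : c ≤ 1 := by
    refine (h 0 0 (by norm_num) ((0 - (2 * d + 4)) * n - 1) _ (by simp) le_rfl 0 0 ?_ ?_ ?_ ?_).trans Pr_le_one
    · exact ⟨⟨0, by omega⟩, by simp⟩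
    · simp
    · exact ⟨⟨0, by omega⟩, by simp⟩
    · simp
  have hc21 : c2 ≤ 1 := by
    have := p.2.2
    have : (p : ℝ) * p ≤ 1 := by nlinarith
    calc c2 ≤ 1 * 1 := mul_le_mul this hc1 hc.le zero_le_one
      _ = 1 := by ring
  -- iteration
  have iter : ∀ m : ℕ, 10 ≤ m → 4 * d + 10 ≤ m → Pq p (LU d (m ^ 2 * n)) ≤
      ((4 * (m ^ 2 * n) + 1 : ℕ) : ℝ) ^ (2 * d) * (1 - c2) ^ m := by
    intro m hm10 hm
    set kk : ℕ → ℕ := fun j => 2 * m ^ 2 + (2 * d + 5) + j * (m + (4 * d + 9)) with hkk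
    set rr : ℕ → ℤ := fun j => ((kk j : ℤ) - (2 * d + 4)) * n - 1 with hrr
    have hn' : (1 : ℤ) ≤ n := by exact_mod_cast hn1
    have hm' : (4 * d + 10 : ℤ) ≤ m := by exact_mod_cast hm
    have hr0 : ∀ j, (2 * (m ^ 2 * n : ℕ) : ℤ) ≤ rr j := by
      intro j
      simp only [hrr, hkk]
      push_cast
      have : (0 : ℤ) ≤ j * (m + (4 * d + 9)) := by positivity
      nlinarith
    have one : ∀ u ∈ bx (0 : V d) (2 * (m ^ 2 * n : ℕ)), ∀ w ∈ bx (0 : V d) (2 * (m ^ 2 * n : ℕ)),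
        Pq p (SE u w (4 * (m ^ 2 * n : ℕ))) ≤ (1 - c2) ^ m := by
      intro u hu w hw
      have ind : ∀ j ≤ m, Pq p (SE u w (rr j)) ≤ (1 - c2) ^ j := by
        intro j
        induction j with
        | zero => intro _; rw [pow_zero]; exact Pr_le_one
        | succ j ih =>
          intro hj
          have hkj : 2 * kk j + 1 ≤ 2 ^ m := by
            refine le_trans ?_ (nine_sq m hm10)
            simp only [hkk]
            have : j * (m + (4 * d + 9)) + (m + (4 * d + 9)) ≤ m * (m + (4 * d + 9)) := by nlinarith
            nlinarith
          have st := SE_step (p := p) (W := m) hn1 (k := kk j) (by simp only [hkk]; nlinarith) hc.le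
            (ρ := rr j) (ρ' := rr (j + 1)) rfl (by simp only [hrr, hkk]; push_cast; nlinarith)
            (h (kk j) m hkj (rr j) (rr (j + 1)) (by simp only [hrr]; linarith)
              (by simp only [hrr, hkk]; push_cast; nlinarith)) (bx_mono (hr0 j) hu) (bx_mono (hr0 j) hw)
          refine st.trans ?_
          rw [pow_succ']
          exact mul_le_mul_of_nonneg_left (ih (by omega)) (by linarith)
      refine (Pr_mono (SE_anti ?_ (bx_mono (hr0 m) hu) (bx_mono (hr0 m) hw))).trans (ind m le_rfl)
      simp only [hrr, hkk]
      push_cast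
      have : (2 * (m:ℤ) ^ 2 + (2 * d + 5) + m * (m + (4 * d + 9)) - (2 * d + 4)) ≤ 4 * m ^ 2 := by nlinarith
      nlinarith
    set bf := (bx_finite (0 : V d) (2 * (m ^ 2 * n : ℕ))).toFinset with hbf
    have hcard : (bf.card : ℝ) = ((4 * (m ^ 2 * n) + 1 : ℕ) : ℝ) ^ d := by
      rw [hbf, ← Set.ncard_eq_toFinset_card _ (bx_finite _ _)]
      have := bx_card (d := d) (2 * (m ^ 2 * n))
      push_cast at this ⊢
      rw [this]
      push_cast
      ring
    calc Pq p (LU d (m ^ 2 * n)) ≤ Pq p (⋃ z ∈ bf ×ˢ bf, SE z.1 z.2 (4 * (m ^ 2 * n : ℕ))) := by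
          refine Pr_mono ?_
          rintro ω ⟨u, hu, w, hw, hS⟩
          exact Set.mem_iUnion₂.2 ⟨(u, w), Finset.mem_product.2 ⟨(bx_finite _ _).mem_toFinset.2 hu,
            (bx_finite _ _).mem_toFinset.2 hw⟩, hS⟩
      _ ≤ ∑ z ∈ bf ×ˢ bf, Pq p (SE z.1 z.2 (4 * (m ^ 2 * n : ℕ))) := Pr_biUnion_le _ _
      _ ≤ ∑ z ∈ bf ×ˢ bf, (1 - c2) ^ m := by
          refine Finset.sum_le_sum fun z hz => ?_
          rw [Finset.mem_product] at hz
          exact one _ ((bx_finite _ _).mem_toFinset.1 hz.1) _ ((bx_finite _ _).mem_toFinset.1 hz.2)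
      _ = _ := by
          rw [Finset.sum_const, Finset.card_product, nsmul_eq_mul]
          push_cast
          rw [hcard]
          push_cast
          ring
  have lim := tendsto_pow_const_mul_const_pow_of_abs_lt_one (4 * d) (r := 1 - c2)
    (by rw [abs_lt]; constructor <;> linarith)
  have lim2 := lim.const_mul (((5 * n : ℕ) : ℝ) ^ (2 * d))
  rw [mul_zero] at lim2
  obtain ⟨m, hm1, hm2⟩ := ((lim2.eventually (gt_mem_nhds hε)).and
    (eventually_ge_atTop (10 + (4 * d + 10) + N1))).exists
  refine ⟨m ^ 2 * n, ?_, ?_⟩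
  · have : m ≤ m ^ 2 := Nat.le_self_pow (by norm_num) m
    nlinarith
  refine (iter m (by omega) (by omega)).trans (le_trans ?_ hm1.le)
  have : ((4 * (m ^ 2 * n) + 1 : ℕ) : ℝ) ^ (2 * d) ≤ ((5 * n : ℕ) : ℝ) ^ (2 * d) * (m : ℝ) ^ (4 * d) := by
    have e : (m : ℝ) ^ (4 * d) = ((m : ℝ) ^ 2) ^ (2 * d) := by rw [← pow_mul]; congr 1; ring
    rw [e, ← mul_pow]
    refine pow_le_pow_left₀ (by positivity) ?_ _
    have : 4 * (m ^ 2 * n) + 1 ≤ 5 * n * m ^ 2 := by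
      have : 1 ≤ m ^ 2 * n := Nat.mul_pos (pow_pos (by omega) 2) hn1
      nlinarith
    exact_mod_cast this
  calc _ ≤ ((5 * n : ℕ) : ℝ) ^ (2 * d) * (m : ℝ) ^ (4 * d) * (1 - c2) ^ m :=
        mul_le_mul_of_nonneg_right this (pow_nonneg (by linarith) _)
    _ = _ := by ring

end uniq

/-! ## The renormalized picture -/

section renorm
variable {d : ℕ}

/-- Crossing part of a good block. -/
def GX (N : ℕ) (ω : Sym2 (V d) → Bool) (i : V d) : Prop :=
  ∃ x ∈ bx (cb N i) N, ∃ y ∈ sph (cb N i) (5 * N), conn (op ω) (bx (cb N i) (5 * N)) x y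

/-- Uniqueness part of a good block. -/
def GU (N : ℕ) (ω : Sym2 (V d) → Bool) (i : V d) : Prop :=
  ∀ u ∈ bx (cb N i) (2 * N), ∀ w ∈ bx (cb N i) (2 * N),
    (∃ v ∈ sph (cb N i) (4 * N), conn (op ω) (bx (cb N i) (4 * N)) u v) →
    (∃ v ∈ sph (cb N i) (4 * N), conn (op ω) (bx (cb N i) (4 * N)) w v) →
    conn (op ω) (bx (cb N i) (4 * N)) u w

/-- The macroscopic cell of a vertex. -/
def cell (N : ℕ) (v : V d) : V d := fun i => v i / N

lemma mem_cell {N : ℕ} (hN : 1 ≤ N) (v : V d) : v ∈ bx (cb N (cell N v)) N := by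
  intro i
  have hn' : (0 : ℤ) < N := by exact_mod_cast hN
  have e1 := Int.emod_add_mul_ediv (v i) N
  have e2 := Int.emod_nonneg (v i) hn'.ne'
  have e3 := Int.emod_lt_of_pos (v i) hn'
  simp only [cb, cell]
  rw [abs_le]
  constructor <;> linarith

lemma cell_adj {N : ℕ} (hN : 1 ≤ N) {v w : V d} (h : adj v w) :
    cell N v = cell N w ∨ adj (cell N v) (cell N w) := by
  have hn' : (0 : ℤ) < N := by exact_mod_cast hN
  obtain ⟨i, h1, h2⟩ := adj_iff.1 h
  have step : ∀ a : ℤ, (a + 1) / N = a / N ∨ (a + 1) / N = a / N + 1 := by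
    intro a
    have m1 : a / N ≤ (a + 1) / N := Int.ediv_le_ediv hn' (by linarith)
    have m2 : (a + 1) / N ≤ (a + 1 * N) / N := Int.ediv_le_ediv hn' (by linarith)
    rw [Int.add_mul_ediv_right _ _ hn'.ne'] at m2
    omega
  have key : w i / N = v i / N ∨ |w i / N - v i / N| = 1 := by
    rcases (abs_eq (by norm_num : (0 : ℤ) ≤ 1)).1 h1 with h | h
    · have e : w i = v i + 1 := by linarith
      rw [e]
      rcases step (v i) with h | h <;> rw [h] <;> simp
    · have e : v i = w i + 1 := by linarith
      rw [e]
      rcases step (w i) with h | h <;> rw [h] <;> simp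
  rcases key with h | h
  · left
    funext j
    by_cases hj : j = i
    · subst hj; exact h.symm
    · simp [cell, h2 j hj]
  · right
    exact adj_iff.2 ⟨i, h, fun j hj => by simp [cell, h2 j hj]⟩

/-- Boundary. -/
def bdy (K : Set (V d)) : Set (V d) := {w | w ∉ K ∧ ∃ k ∈ K, adj w k}

/-- The region in which the bypass lives. -/
def UK (N : ℕ) (K : Set (V d)) : Set (V d) := ⋃ i ∈ K ∪ bdy K, bx (cb N i) (4 * N)

lemma bypass {N : ℕ} (hN : 1 ≤ N) {ω : Sym2 (V d) → Bool} {K : Set (V d)} (hK : LC K)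
    (hX : ∀ w ∈ bdy K, GX N ω w) (hU : ∀ w ∈ bdy K, GU N ω w) {x y : V d}
    (hx : cell N x ∈ K) (hy : cell N y ∈ K) (h : conn (op ω) Set.univ x y) :
    conn (op ω) (UK N K) x y := by
  classical
  have hn' : (1 : ℤ) ≤ N := by exact_mod_cast hN
  have memU : ∀ v : V d, (cell N v ∈ K ∪ bdy K) → v ∈ UK N K := fun v hv =>
    Set.mem_iUnion₂.2 ⟨_, hv, bx_mono (by linarith) (mem_cell hN v)⟩
  have subU : ∀ w ∈ bdy K, bx (cb N w) (4 * N) ⊆ UK N K := fun w hw v hv =>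
    Set.mem_iUnion₂.2 ⟨w, Or.inr hw, hv⟩
  set C : Set (V d) := {v | conn (op ω) Set.univ x v} with hC
  by_cases hA : ∃ w ∈ bdy K, C ⊆ bx (cb N w) (4 * N)
  · obtain ⟨w, hw, hCw⟩ := hA
    exact h.self.mono_set fun v hv => subU w hw (hCw hv.2)
  push Not at hA
  -- cluster vertices near a boundary site reach the sphere
  have reach : ∀ w ∈ bdy K, ∀ v ∈ C, v ∈ bx (cb N w) (2 * N) →
      ∃ t ∈ sph (cb N w) (4 * N), conn (op ω) (bx (cb N w) (4 * N)) v t := by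
    intro w hw v hv hvb
    obtain ⟨z, hz, hzb⟩ := Set.not_subset.1 (hA w hw)
    have hvz : conn (op ω) Set.univ v z := (hv.symm op.symm).trans hz
    obtain ⟨t, ht, htc⟩ := hvz.sphere (m := 4 * N) (fun a b h => h.1) (bx_mono (by linarith) hvb)
      (fun h => hzb (bx_mono (by linarith) h))
    exact ⟨t, ht, htc.mono_set Set.inter_subset_right⟩
  have ex : ∀ w : V d, ∃ t : V d, w ∈ bdy K → t ∈ bx (cb N w) N ∧
      ∃ y ∈ sph (cb N w) (5 * N), conn (op ω) (bx (cb N w) (5 * N)) t y := by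
    intro w
    by_cases hw : w ∈ bdy K
    · obtain ⟨t, ht, h⟩ := hX w hw
      exact ⟨t, fun _ => ⟨ht, h⟩⟩
    · exact ⟨0, fun h => absurd h hw⟩
  choose t ht using ex
  have near : ∀ w ∈ bdy K, ∀ w' ∈ bdy K, sadj w w' → t w' ∈ bx (cb N w) (2 * N) ∧
      ∃ y ∈ sph (cb N w) (4 * N), conn (op ω) (bx (cb N w) (4 * N)) (t w') y := by
    intro w hw w' hw' hs
    obtain ⟨h1, z, ⟨-, i, hi⟩, hc⟩ := ht w' hw'
    have hdist : ∀ j, |cb N w j - cb N w' j| ≤ N := by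
      intro j
      simp only [cb]
      rw [← mul_sub, abs_mul, Nat.abs_cast]
      nlinarith [hs j]
    have hb : t w' ∈ bx (cb N w) (2 * N) := bx_sub (fun j => by
      have := hdist j; rw [abs_sub_comm]; linarith) h1
    refine ⟨hb, ?_⟩
    obtain ⟨y, hy, hyc⟩ := hc.sphere (c := cb N w) (m := 4 * N) (fun a b h => h.1)
      (bx_mono (by linarith) hb) (fun hz => by
        have q1 := hz i
        have q2 := hdist i
        have q3 := abs_add_le (z i - cb N w i) (cb N w i - cb N w' i)
        rw [sub_add_sub_cancel] at q3
        linarith)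
    exact ⟨y, hy, hyc.mono_set Set.inter_subset_right⟩
  have link : ∀ D : Set (V d), D ⊆ bdy K → ∀ a b, a ∈ D → conn sadj D a b →
      conn (op ω) (UK N K) (t a) (t b) := by
    intro D hD a b ha hab
    induction hab with
    | refl => exact conn.refl
    | @tail b c _ hs ih =>
      have hb := hD hs.1
      have hc := hD hs.2.1
      have n1 := near b hb b hb (fun i => by simp)
      have n2 := near b hb c hc hs.2.2
      exact ih.trans ((hU b hb _ n1.1 _ n2.1 n1.2 n2.2).mono_set (subU b hb))
  have tolink : ∀ v ∈ C, cell N v ∈ bdy K → conn (op ω) (UK N K) v (t (cell N v)) := by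
    intro v hv hb
    have hv2 : v ∈ bx (cb N (cell N v)) (2 * N) := bx_mono (by linarith) (mem_cell hN v)
    have n1 := near _ hb _ hb (fun i => by simp)
    exact (hU _ hb v hv2 _ n1.1 (reach _ hb v hv hv2) n1.2).mono_set (subU _ hb)
  have inv : (cell N y ∈ K → conn (op ω) (UK N K) x y) ∧ (cell N y ∉ K →
      ∃ v0 ∈ C, conn (op ω) (UK N K) x v0 ∧ cell N v0 ∈ bdy K ∧ conn adj Kᶜ (cell N v0) (cell N y)) := by
    clear hy
    induction h with
    | refl => exact ⟨fun _ => conn.refl, fun h => absurd hx h⟩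
    | @tail v v' hv hs ih =>
      have hvC : v ∈ C := hv
      have hvC' : v' ∈ C := Relation.ReflTransGen.tail hv hs
      have hop : op ω v v' := hs.2.2
      have hcell := cell_adj hN hop.1
      by_cases h1 : cell N v ∈ K <;> by_cases h2 : cell N v' ∈ K
      · exact ⟨fun _ => (ih.1 h1).trans (conn.single hop (memU _ (Or.inl h1)) (memU _ (Or.inl h2))),
          fun h => absurd h2 h⟩
      · have hb : cell N v' ∈ bdy K := by
          refine ⟨h2, cell N v, h1, ?_⟩
          rcases hcell with h | h
          · rw [h] at h1; exact absurd h1 h2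
          · exact h.symm
        exact ⟨fun h => absurd h h2, fun _ => ⟨v', hvC', (ih.1 h1).trans
          (conn.single hop (memU _ (Or.inl h1)) (memU _ (Or.inr hb))), hb, conn.refl⟩⟩
      · have hb : cell N v ∈ bdy K := by
          refine ⟨h1, cell N v', h2, ?_⟩
          rcases hcell with h | h
          · rw [h] at h1; exact absurd h2 h1
          · exact h
        refine ⟨fun _ => ?_, fun h => absurd h2 h⟩
        obtain ⟨v0, hv0, hc0, hb0, hcon⟩ := ih.2 h1
        set D : Set (V d) := {w | w ∈ Kᶜ ∧ conn adj Kᶜ (cell N v0) w} with hD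
        have bc := boundary_conn hK (LC_reach (cell N v0) : LC D)
          (Set.disjoint_left.2 fun w hw => hw.1)
          (fun a ha b hab => by
            by_cases hbK : b ∈ K
            · exact Or.inr hbK
            · exact Or.inl ⟨hbK, ha.2.trans (conn.single hab ha.1 hbK)⟩)
          (u := cell N v0) (v := cell N v) ⟨⟨hb0.1, conn.refl⟩, hb0.2⟩ ⟨⟨h1, hcon⟩, hb.2⟩
        have l := link _ (fun w hw => ⟨hw.1.1, hw.2⟩) _ _
          (show cell N v0 ∈ {w | w ∈ D ∧ ∃ k ∈ K, adj w k} from ⟨⟨hb0.1, conn.refl⟩, hb0.2⟩) bc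
        exact (((hc0.trans (tolink v0 hv0 hb0)).trans l).trans
          ((tolink v hvC hb).symm op.symm)).trans
          (conn.single hop (memU _ (Or.inr hb)) (memU _ (Or.inl h2)))
      · refine ⟨fun h => absurd h h2, fun _ => ?_⟩
        obtain ⟨v0, hv0, hc0, hb0, hcon⟩ := ih.2 h1
        refine ⟨v0, hv0, hc0, hb0, ?_⟩
        rcases hcell with h | h
        · rw [← h]; exact hcon
        · exact hcon.trans (conn.single h h1 h2)
  exact inv.1 hy

/-- The size of the bypass region. -/
lemma UK_card {N : ℕ} {K : Set (V d)} (hK : K.Finite) :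
    (UK N K).Finite ∧ (UK N K).ncard ≤ K.ncard * (kap d * (8 * N + 1) ^ d) := by
  classical
  set F : Finset (V d) := hK.toFinset.biUnion fun i => (bx_finite i 1).toFinset with hF
  set G : Finset (V d) := F.biUnion fun i => (bx_finite (cb N i) (4 * N)).toFinset with hG
  have c1 : F.card ≤ K.ncard * kap d := by
    rw [Set.ncard_eq_toFinset_card _ hK]
    refine Finset.card_biUnion_le_card_mul _ _ _ fun i _ => ?_
    rw [← Set.ncard_eq_toFinset_card _ (bx_finite i 1)]
    exact ncard_bx_le i 1
  have c2 : G.card ≤ F.card * (8 * N + 1) ^ d := by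
    refine Finset.card_biUnion_le_card_mul _ _ _ fun i _ => ?_
    rw [← Set.ncard_eq_toFinset_card _ (bx_finite _ _)]
    refine (ncard_bx_le _ _).trans ?_
    have := bx_card (d := d) (4 * N)
    push_cast at this
    rw [this]
    exact le_of_eq (by ring)
  have sub : UK N K ⊆ (G : Set (V d)) := by
    intro v hv
    obtain ⟨i, hi, hv⟩ := Set.mem_iUnion₂.1 hv
    refine Finset.mem_coe.2 (Finset.mem_biUnion.2 ⟨i, ?_, (bx_finite _ _).mem_toFinset.2 hv⟩)
    rcases hi with hi | ⟨-, k, hk, hik⟩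
    · exact Finset.mem_biUnion.2 ⟨i, hK.mem_toFinset.2 hi, (bx_finite _ _).mem_toFinset.2
        (self_mem_bx (by norm_num))⟩
    · exact Finset.mem_biUnion.2 ⟨k, hK.mem_toFinset.2 hk, (bx_finite _ _).mem_toFinset.2
        (fun j => hik.symm.abs_le j)⟩
  refine ⟨G.finite_toSet.subset sub, (Set.ncard_le_ncard sub G.finite_toSet).trans ?_⟩
  rw [Set.ncard_coe_finset]
  calc G.card ≤ F.card * (8 * N + 1) ^ d := c2
    _ ≤ K.ncard * kap d * (8 * N + 1) ^ d := Nat.mul_le_mul_right _ c1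
    _ = _ := by ring

/-- A short path in a finite region. -/
lemma short_path {O : V d → V d → Prop} (hO : ∀ a b, O a b → O b a) (hirr : ∀ a b, O a b → a ≠ b)
    {U : Set (V d)} (hU : U.Finite) {x y : V d} (hx : x ∈ U) (h : conn O U x y) :
    ∃ (n : ℕ) (f : ℕ → V d), n ≤ U.ncard ∧ f 0 = x ∧ f n = y ∧ ∀ i < n, O (f i) (f (i + 1)) := by
  classical
  let G : SimpleGraph (V d) :=
    { Adj := fun a b => a ∈ U ∧ b ∈ U ∧ O a b
      symm := ⟨fun a b h => ⟨h.2.1, h.1, hO _ _ h.2.2⟩⟩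
      loopless := ⟨fun a h => hirr _ _ h.2.2 rfl⟩ }
  have hr : G.Reachable x y := (SimpleGraph.reachable_iff_reflTransGen x y).2 h
  obtain ⟨w⟩ := hr
  let P := w.toPath
  refine ⟨P.1.length, P.1.getVert, ?_, P.1.getVert_zero, P.1.getVert_length, fun i hi =>
    (P.1.adj_getVert_succ hi).2.2⟩
  have hsub : (P.1.support.toFinset : Set (V d)) ⊆ U := by
    intro v hv
    have hv' : v ∈ P.1.support := by simpa using hv
    obtain ⟨i, hi, hi2⟩ := SimpleGraph.Walk.mem_support_iff_exists_getVert.1 hv'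
    rcases Nat.eq_zero_or_pos i with rfl | hpos
    · rw [← hi, SimpleGraph.Walk.getVert_zero]; exact hx
    · have := P.1.adj_getVert_succ (i := i - 1) (by omega)
      rw [Nat.sub_add_cancel hpos, hi] at this
      exact this.2.1
  have := Set.ncard_le_ncard hsub hU
  rw [Set.ncard_coe_finset, List.toFinset_card_of_nodup P.2.support_nodup,
    SimpleGraph.Walk.length_support] at this
  omega

end renorm

/-! ## Probability estimates for bad blocks -/

section prob
variable {d : ℕ}

/-- The block `i` is bad. -/
def BadE (N : ℕ) (i : V d) : Set (Sym2 (V d) → Bool) := {ω | ¬ (GX N ω i ∧ GU N ω i)}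

lemma GX_dep {N : ℕ} {i : V d} {ω ω' : Sym2 (V d) → Bool}
    (e : ∀ f ∈ ED (bx (cb N i) (5 * N)), ω f = ω' f) (h : GX N ω i) : GX N ω' i := by
  obtain ⟨x, hx, y, hy, hc⟩ := h
  exact ⟨x, hx, y, hy, conn_dep e hc⟩

lemma ED_mono {D D' : Set (V d)} (h : D ⊆ D') : ED D ⊆ ED D' := fun _ he v hv => h (he v hv)

lemma GU_dep {N : ℕ} {i : V d} {ω ω' : Sym2 (V d) → Bool}
    (e : ∀ f ∈ ED (bx (cb N i) (5 * N)), ω f = ω' f) (h : GU N ω i) : GU N ω' i := by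
  have e1 : ∀ f ∈ ED (bx (cb N i) (4 * N)), ω f = ω' f := fun f hf =>
    e f (ED_mono (bx_mono (by linarith [(Nat.cast_nonneg N : (0:ℤ) ≤ N)])) hf)
  have e2 : ∀ f ∈ ED (bx (cb N i) (4 * N)), ω' f = ω f := fun f hf => (e1 f hf).symm
  rintro u hu w hw ⟨v, hv, hc⟩ ⟨v', hv', hc'⟩
  exact conn_dep e1 (h u hu w hw ⟨v, hv, conn_dep e2 hc⟩ ⟨v', hv', conn_dep e2 hc'⟩)

lemma BadE_dep (N : ℕ) (i : V d) : Dep (ED (bx (cb N i) (5 * N))) (BadE N i) := by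
  intro ω ω' e h hg
  have e2 := fun f hf => (e f hf).symm
  exact h ⟨GX_dep e2 hg.1, GU_dep e2 hg.2⟩

/-- Shifted configuration. -/
def shf (c : V d) (ω : Sym2 (V d) → Bool) : Sym2 (V d) → Bool := fun e => ω (Sym2.map (· + c) e)

lemma conn_shf {c e a b : V d} {r : ℤ} {ω : Sym2 (V d) → Bool} :
    conn (op (shf c ω)) (bx e r) a b ↔ conn (op ω) (bx (e + c) r) (a + c) (b + c) := by
  constructor
  · intro h
    refine h.map (· + c) (fun a _ b _ h => ⟨adj_translate.2 h.1, h.2⟩) (fun a ha i => ?_)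
    simpa using ha i
  · intro h
    have := h.map (O' := op (shf c ω)) (D' := bx e r) (· - c) (fun a _ b _ h => ?_) (fun a ha i => ?_)
    · simpa using this
    · refine ⟨?_, ?_⟩
      · have := adj_translate (a := a) (b := b) (c := -c)
        simp only [← sub_eq_add_neg] at this
        exact this.2 h.1
      · have := h.2
        simp only [shf, Sym2.map_mk, sub_add_cancel]
        exact this
    · have := ha i
      simp only [Pi.add_apply, Pi.sub_apply] at this ⊢
      rwa [show a i - c i - e i = a i - (e i + c i) by ring]

lemma Bad_shift (p : unitInterval) (N : ℕ) (i : V d) :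
    Pq p (BadE N i) ≤ Pq p (BadE N (0 : V d)) := by
  have hinj : Function.Injective (Sym2.map (· + cb N i)) := Sym2.map.injective (add_left_injective _)
  have h := Pr_comap (p := fun _ : Sym2 (V d) => p) hinj
    ((BadE_dep N (0 : V d)).meas (ED_finite (bx_finite _ _)))
  unfold Pq
  rw [← h]
  refine Pr_mono ?_
  intro ω hω hg
  apply hω
  have hg : GX N (shf (cb N i) ω) 0 ∧ GU N (shf (cb N i) ω) 0 := hg
  have c0 : cb N (0 : V d) = 0 := by funext j; simp [cb]
  unfold GX GU at hg
  rw [c0] at hg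
  obtain ⟨⟨x, hx, y, hy, hc⟩, h2⟩ := hg
  have sp : ∀ {v : V d} {r : ℤ}, v - cb N i ∈ sph (0 : V d) r ↔ v ∈ sph (cb N i) r := by
    intro v r; simp [sph, bx]
  have bp : ∀ {v : V d} {r : ℤ}, v - cb N i ∈ bx (0 : V d) r ↔ v ∈ bx (cb N i) r := by
    intro v r; simp [bx]
  have cs : ∀ {a b : V d} {r : ℤ}, conn (op (shf (cb N i) ω)) (bx 0 r) (a - cb N i) (b - cb N i) ↔
      conn (op ω) (bx (cb N i) r) a b := by
    intro a b r
    rw [conn_shf]; simp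
  have e : ∀ v : V d, v = (v + cb N i) - cb N i := fun v => by simp
  refine ⟨⟨x + cb N i, ?_, y + cb N i, ?_, ?_⟩, ?_⟩
  · rw [e x] at hx; exact bp.1 hx
  · rw [e y] at hy; exact sp.1 hy
  · rw [e x, e y] at hc; exact cs.1 hc
  · rintro u hu w hw ⟨v, hv, hc⟩ ⟨v', hv', hc'⟩
    exact cs.1 (h2 _ (bp.2 hu) _ (bp.2 hw) ⟨_, sp.2 hv, cs.2 hc⟩ ⟨_, sp.2 hv', cs.2 hc'⟩)

lemma good_scale (hd : 2 ≤ d) {q0 p : unitInterval} (hqp : q0 < p) (hq : perc d q0) {ε : ℝ}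
    (hε : 0 < ε) : ∃ N : ℕ, 1 ≤ N ∧ Pq p (BadE N (0 : V d)) < ε := by
  obtain ⟨r, hr⟩ := big_box hq (δ := ε / 3) (by linarith)
  obtain ⟨N, hN, hL⟩ := local_unique hd hqp hq (ε := ε / 3) (by linarith) (r + 1)
  refine ⟨N, by omega, ?_⟩
  have c0 : cb N (0 : V d) = 0 := by funext j; simp [cb]
  set H := hitE (bx (0 : V d) (5 * N)) (bx 0 N) (sph 0 (5 * N)) with hH
  have hHd : Dep (ED (bx (0 : V d) (5 * N))) H := hitE_dep _ _ _
  have h1 : 1 - ε / 3 ≤ Pq p H := by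
    refine (hr (5 * N - 1) (by omega)).trans ?_
    have e : 5 * N - 1 + 1 = 5 * N := by omega
    rw [e]
    unfold aa
    refine le_trans (b := Pq q0 H) (Pr_mono ?_) (Pr_mono_p (fun _ _ => hqp.le) hHd
      (ED_finite (bx_finite _ _)) (hitE_upper _ _ _))
    push_cast
    exact hitE_mono le_rfl (bx_mono (by omega)) le_rfl
  have h2 : BadE N (0 : V d) ⊆ Hᶜ ∪ LU d N := by
    intro ω hω
    by_contra hcon
    simp only [Set.mem_union, Set.mem_compl_iff, not_or, not_not] at hcon
    apply hω
    unfold GX GU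
    rw [c0]
    refine ⟨hcon.1, fun u hu w hw hu' hw' => ?_⟩
    by_contra hc
    exact hcon.2 ⟨u, hu, w, hw, hu', hw', hc⟩
  have h3 : Pq p Hᶜ = 1 - Pq p H := Pr_compl (hHd.meas (ED_finite (bx_finite _ _)))
  have h4 : Pq p (Hᶜ ∪ LU d N) ≤ Pq p Hᶜ + Pq p (LU d N) := Pr_union_le
  have h5 : Pq p (BadE N (0 : V d)) ≤ _ := Pr_mono h2
  have h6 : Pq p (BadE N (0 : V d)) ≤ Pq p (Hᶜ ∪ LU d N) := h5
  linarith

lemma good_scales (hd : 2 ≤ d) {q0 p0 : unitInterval} (hqp : q0 < p0) (hq : perc d q0) {ε : ℝ}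
    (hε : 0 < ε) : ∃ M : ℕ, ∀ p : unitInterval, p0 ≤ p → ∃ N : ℕ, 1 ≤ N ∧ N ≤ M ∧
      Pq p (BadE N (0 : V d)) < ε := by
  classical
  have hcomp : IsCompact (Set.Icc p0 1) := isCompact_Icc
  set W : ℕ → Set unitInterval := fun N => {p | 1 ≤ N ∧ Pq p (BadE N (0 : V d)) < ε} with hW
  have hopen : ∀ N, IsOpen (W N) := by
    intro N
    have hc := Pr_continuous (BadE_dep N (0 : V d)) (ED_finite (bx_finite _ _))
    have : W N = {p | 1 ≤ N} ∩ {p | Pq p (BadE N (0 : V d)) < ε} := rfl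
    rw [this]
    refine IsOpen.inter ?_ (isOpen_lt hc continuous_const)
    by_cases h : 1 ≤ N <;> simp [h]
  obtain ⟨t, ht⟩ := hcomp.elim_finite_subcover W hopen (by
    intro p hp
    obtain ⟨N, h1, h2⟩ := good_scale hd (lt_of_lt_of_le hqp hp.1) hq hε
    exact Set.mem_iUnion.2 ⟨N, h1, h2⟩)
  refine ⟨t.sup id, fun p hp => ?_⟩
  obtain ⟨N, hN, hN'⟩ := Set.mem_iUnion₂.1 (ht ⟨hp, p.2.2⟩)
  exact ⟨N, hN'.1, Finset.le_sup (f := id) hN, hN'.2⟩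

/-- Many bad blocks are unlikely. -/
lemma many_bad {p : unitInterval} {N : ℕ} (hN : 1 ≤ N) {η : ℝ} (h0 : 0 ≤ η) (h1 : η ≤ 1)
    (h : Pq p (BadE N (0 : V d)) ≤ η ^ (11 ^ d)) (S : Finset (V d)) :
    Pq p (⋂ i ∈ S, BadE N i) ≤ η ^ S.card := by
  classical
  let col : V d → (Fin d → ZMod 11) := fun v i => (v i : ZMod 11)
  have hcardcol : Fintype.card (Fin d → ZMod 11) = 11 ^ d := by
    rw [Fintype.card_fun, ZMod.card, Fintype.card_fin]
  obtain ⟨κ, hκ⟩ : ∃ κ, S.card ≤ 11 ^ d * (S.filter fun v => col v = κ).card := by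
    by_contra hcon
    push Not at hcon
    have e1 := Finset.card_eq_sum_card_fiberwise (s := S) (t := Finset.univ) (f := col) (by simp)
    have e2 : ∑ κ : Fin d → ZMod 11, 11 ^ d * (S.filter fun v => col v = κ).card <
        ∑ κ : Fin d → ZMod 11, S.card :=
      Finset.sum_lt_sum_of_nonempty Finset.univ_nonempty fun κ _ => hcon κ
    rw [← Finset.mul_sum, ← e1, Finset.sum_const, Finset.card_univ, hcardcol, smul_eq_mul] at e2
    exact lt_irrefl _ e2
  set S' := S.filter fun v => col v = κ with hS'
  have hn' : (1 : ℤ) ≤ N := by exact_mod_cast hN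
  have disj : (S' : Set (V d)).PairwiseDisjoint (fun i => ED (bx (cb N i) (5 * N))) := by
    intro i hi j hj hij
    rw [Function.onFun, Set.disjoint_left]
    intro e he he'
    obtain ⟨m, hm⟩ := Function.ne_iff.1 hij
    have ci := (Finset.mem_filter.1 hi).2
    have cj := (Finset.mem_filter.1 hj).2
    have cc : ((i m : ℤ) : ZMod 11) = ((j m : ℤ) : ZMod 11) := congrFun (ci.trans cj.symm) m
    rw [ZMod.intCast_eq_intCast_iff_dvd_sub] at cc
    obtain ⟨t, ht⟩ := cc
    have ht0 : t ≠ 0 := by rintro rfl; apply hm; push_cast at ht; linarith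
    induction e using Sym2.ind with
    | _ a b =>
      have q1 := abs_le.1 ((mem_ED.1 he).1 m)
      have q2 := abs_le.1 ((mem_ED.1 he').1 m)
      simp only [cb] at q1 q2
      push_cast at ht
      have ej : j m = i m + 11 * t := by linarith
      rw [ej] at q2
      rcases lt_or_gt_of_ne ht0 with h | h
      · nlinarith
      · nlinarith
  calc Pq p (⋂ i ∈ S, BadE N i) ≤ Pq p (⋂ i ∈ S', BadE N i) := by
        refine Pr_mono ?_
        intro ω hω
        simp only [Set.mem_iInter] at hω ⊢
        exact fun i hi => hω i (Finset.mem_filter.1 hi).1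
    _ = ∏ i ∈ S', Pq p (BadE N i) := Pr_indep_finset S' _ _ (fun i _ => BadE_dep N i)
        (fun i _ => ED_finite (bx_finite _ _)) disj
    _ ≤ ∏ i ∈ S', η ^ (11 ^ d) := Finset.prod_le_prod (fun i _ => Pr_nonneg)
        (fun i _ => (Bad_shift p N i).trans h)
    _ = η ^ (11 ^ d * S'.card) := by rw [Finset.prod_const, ← pow_mul]
    _ ≤ η ^ S.card := pow_le_pow_of_le_one h0 h1 hκ

/-- A lattice path of sites. -/
lemma exists_gamma : ∀ (L : ℕ) (X : V d), dist1 X 0 = L → ∃ Γ : Finset (V d), LC (Γ : Set (V d)) ∧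
    (0 : V d) ∈ Γ ∧ X ∈ Γ ∧ Γ.card ≤ L + 1 := by
  classical
  intro L
  induction L with
  | zero =>
    intro X hX
    have : X = 0 := by
      funext i
      have := (Finset.sum_eq_zero_iff.1 hX) i (Finset.mem_univ i)
      simpa using this
    subst this
    refine ⟨{0}, ?_, by simp, by simp, by simp⟩
    intro x hx y hy
    simp only [Finset.coe_singleton, Set.mem_singleton_iff] at hx hy
    rw [hx, hy]; exact conn.refl
  | succ L ih =>
    intro X hX
    obtain ⟨i, hi⟩ : ∃ i, X i ≠ 0 := by
      by_contra hcon
      push Not at hcon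
      have : dist1 X 0 = 0 := Finset.sum_eq_zero fun i _ => by simp [hcon i]
      omega
    set Y : V d := Function.update X i (X i - (X i).sign) with hY
    have hsplit : ∀ Z : V d, dist1 Z 0 = (Z i).natAbs + ∑ j ∈ Finset.univ.erase i, (Z j).natAbs := by
      intro Z
      unfold dist1
      rw [← Finset.add_sum_erase _ _ (Finset.mem_univ i)]
      simp
    have hYd : dist1 Y 0 = L := by
      have e1 := hsplit X
      have e2 := hsplit Y
      have e3 : ∑ j ∈ Finset.univ.erase i, (Y j).natAbs = ∑ j ∈ Finset.univ.erase i, (X j).natAbs :=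
        Finset.sum_congr rfl fun j hj => by rw [hY, Function.update_of_ne (Finset.ne_of_mem_erase hj)]
      have e4 : (Y i).natAbs + 1 = (X i).natAbs := by
        rw [hY, Function.update_self]
        rcases lt_or_gt_of_ne hi with h | h
        · rw [Int.sign_eq_neg_one_of_neg h]; omega
        · rw [Int.sign_eq_one_of_pos h]; omega
      omega
    obtain ⟨Γ, h1, h2, h3, h4⟩ := ih Y hYd
    refine ⟨insert X Γ, ?_, by simp [h2], by simp, (Finset.card_insert_le _ _).trans (by omega)⟩
    rw [Finset.coe_insert]
    refine LC_insert h1 (a := Y) h3 (adj_iff.2 ⟨i, ?_, fun j hj => ?_⟩)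
    · rw [hY, Function.update_self, sub_sub_cancel]
      rcases lt_or_gt_of_ne hi with h | h
      · rw [Int.sign_eq_neg_one_of_neg h]; norm_num
      · rw [Int.sign_eq_one_of_pos h]; norm_num
    · rw [hY, Function.update_of_ne hj]

/-- Deterministic dichotomy. -/
lemma dichotomy {N : ℕ} (hN : 1 ≤ N) {ω : Sym2 (V d) → Bool} {x : V d} {Γ : Finset (V d)}
    (hΓ : LC (Γ : Set (V d))) (h0 : (0 : V d) ∈ Γ) (hx : cell N x ∈ Γ) {s : ℕ} (hs : Γ.card ≤ s)
    (h : conn (op ω) Set.univ 0 x) :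
    (∃ (n : ℕ) (f : ℕ → V d), n ≤ s * (kap d * (8 * N + 1) ^ d) ∧ f 0 = 0 ∧ f n = x ∧
      ∀ i < n, op ω (f i) (f (i + 1))) ∨
    ∃ S : Finset (V d), Γ ⊆ S ∧ LC (S : Set (V d)) ∧ S.card = s ∧ ∀ i ∈ S, i ∉ Γ → ω ∈ BadE N i := by
  classical
  set C : Set (V d) := {v | v ∈ Γ ∨ ω ∈ BadE N v} with hC
  set K : Set (V d) := {v | v ∈ C ∧ conn adj C 0 v} with hK
  have hKLC : LC K := LC_reach 0
  have hΓK : (Γ : Set (V d)) ⊆ K := fun v hv =>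
    ⟨Or.inl hv, (hΓ 0 h0 v hv).mono_set fun w hw => Or.inl hw⟩
  by_cases hbig : ∀ T : Finset (V d), (T : Set (V d)) = K → s ≤ T.card
  · right
    obtain ⟨S, h1, h2, h3, h4⟩ := LC_grow hKLC hΓ ⟨0, h0⟩ hΓK hs hbig
    exact ⟨S, h1, h3, h4, fun i hi hiΓ => (h2 hi).1.resolve_left hiΓ⟩
  · left
    push Not at hbig
    obtain ⟨T, hT, hTs⟩ := hbig
    have hKfin : K.Finite := hT ▸ T.finite_toSet
    have hKc : K.ncard ≤ s := by rw [← hT, Set.ncard_coe_finset]; exact hTs.le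
    have good : ∀ w ∈ bdy K, GX N ω w ∧ GU N ω w := by
      rintro w ⟨hw, k, hk, hwk⟩
      by_contra hcon
      have hwC : w ∈ C := Or.inr hcon
      exact hw ⟨hwC, hk.2.trans (conn.single hwk.symm hk.1 hwC)⟩
    have c0 : cell N (0 : V d) = 0 := by funext i; simp [cell]
    have hb := bypass hN hKLC (fun w hw => (good w hw).1) (fun w hw => (good w hw).2)
      (x := 0) (y := x) (by rw [c0]; exact hΓK h0) (hΓK hx) h
    obtain ⟨u1, u2⟩ := UK_card (N := N) hKfin
    have h0U : (0 : V d) ∈ UK N K := by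
      refine Set.mem_iUnion₂.2 ⟨0, Or.inl (hΓK h0), ?_⟩
      have : cb N (0 : V d) = 0 := by funext j; simp [cb]
      rw [this]; exact self_mem_bx (by positivity)
    obtain ⟨n, f, hn, hf0, hfn, hf⟩ := short_path op.symm (fun a b hab => by
      rintro rfl
      have := hab.1
      simp [adj, dist1] at this) u1 h0U hb
    exact ⟨n, f, hn.trans (u2.trans (Nat.mul_le_mul_right _ hKc)), hf0, hfn, hf⟩

lemma cell_norm (N : ℕ) (x : V d) : dist1 (cell N x) 0 ≤ dist1 x 0 := by
  unfold dist1
  refine Finset.sum_le_sum fun i _ => ?_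
  simpa [cell] using Int.natAbs_ediv_le_natAbs (x i) N

/-- The main estimate. -/
lemma main_est {p : unitInterval} {N : ℕ} (hN : 1 ≤ N) {η : ℝ} (h0 : 0 ≤ η) (h1 : η ≤ 1)
    (h : Pq p (BadE N (0 : V d)) ≤ η ^ (11 ^ d)) {x : V d} {L : ℕ} (hx : dist1 x 0 = L) (hL : 1 ≤ L) :
    ∃ A : Set (Sym2 (V d) → Bool), MeasurableSet A ∧ Pq p A ≤ ((2 : ℝ) ^ (kap d * 4) * η ^ 2) ^ L ∧
      (∀ ω ω' : Sym2 (V d) → Bool, op ω = op ω' → ω ∈ A → ω' ∈ A) ∧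
      ∀ ω, conn (op ω) Set.univ 0 x → ω ∉ A →
        ∃ (n : ℕ) (f : ℕ → V d), n ≤ 4 * L * (kap d * (8 * N + 1) ^ d) ∧ f 0 = 0 ∧ f n = x ∧
          ∀ i < n, op ω (f i) (f (i + 1)) := by
  classical
  obtain ⟨Γ, g1, g2, g3, g4⟩ := exists_gamma _ (cell N x) rfl
  have g5 : Γ.card ≤ L + 1 := g4.trans (by have := cell_norm N x; omega)
  set 𝒜 := ((bx_finite (0 : V d) (4 * L : ℕ)).toFinset.powerset).filter
    (fun S : Finset (V d) => Γ ⊆ S ∧ LC (S : Set (V d)) ∧ S.card = 4 * L) with h𝒜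
  have hm : ∀ S ∈ 𝒜, Γ ⊆ S ∧ LC (S : Set (V d)) ∧ S.card = 4 * L := fun S hS =>
    (Finset.mem_filter.1 hS).2
  refine ⟨⋃ S ∈ 𝒜, ⋂ i ∈ S \ Γ, BadE N i, ?_, ?_, ?_, ?_⟩
  · refine Finset.measurableSet_biUnion _ fun S _ => Finset.measurableSet_biInter _ fun i _ => ?_
    exact (BadE_dep N i).meas (ED_finite (bx_finite _ _))
  · have hc := animals_card (0 : V d) (4 * L) 𝒜 (fun S hS => ⟨(hm S hS).1 g2, (hm S hS).2⟩)
    calc Pq p (⋃ S ∈ 𝒜, ⋂ i ∈ S \ Γ, BadE N i) ≤ ∑ S ∈ 𝒜, Pq p (⋂ i ∈ S \ Γ, BadE N i) :=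
          Pr_biUnion_le _ _
      _ ≤ ∑ S ∈ 𝒜, η ^ (2 * L) := by
          refine Finset.sum_le_sum fun S hS => (many_bad hN h0 h1 h _).trans ?_
          refine pow_le_pow_of_le_one h0 h1 ?_
          have := Finset.le_card_sdiff Γ S
          have := (hm S hS).2.2
          omega
      _ = 𝒜.card * η ^ (2 * L) := by rw [Finset.sum_const, nsmul_eq_mul]
      _ ≤ (2 : ℝ) ^ (kap d * (4 * L)) * η ^ (2 * L) :=
          mul_le_mul_of_nonneg_right hc (pow_nonneg h0 _)
      _ = _ := by rw [mul_pow, ← pow_mul, ← pow_mul, mul_assoc]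
  · intro ω ω' e hω
    simp only [Set.mem_iUnion, Set.mem_iInter] at hω ⊢
    obtain ⟨S, hS, hb⟩ := hω
    refine ⟨S, hS, fun i hi => ?_⟩
    have := hb i hi
    simp only [BadE, GX, GU, Set.mem_ofPred_eq] at this ⊢
    rw [← e]; exact this
  · intro ω hc hω
    rcases dichotomy hN g1 g2 g3 (s := 4 * L) (by omega) hc with h | ⟨S, s1, s2, s3, s4⟩
    · exact h
    · exfalso
      apply hω
      simp only [Set.mem_iUnion, Set.mem_iInter]
      refine ⟨S, ?_, fun i hi => s4 i (Finset.mem_sdiff.1 hi).1 (Finset.mem_sdiff.1 hi).2⟩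
      refine Finset.mem_filter.2 ⟨Finset.mem_powerset.2 fun v hv => ?_, s1, s2, s3⟩
      refine (bx_finite _ _).mem_toFinset.2 fun i => ?_
      have := LC_card s2 (s1 g2) hv i
      rw [s3] at this
      linarith

end prob

/-! ## Transfer to the given family of measures -/

section transfer
variable {d : ℕ}

/-- Extension of a configuration to all unordered pairs. -/
noncomputable def ext (σ : Config d) : Sym2 (V d) → Bool :=
  fun e => if h : sym2dist1 e = 1 then σ ⟨e, h⟩ else false

lemma op_ext {σ : Config d} {a b : V d} : op (ext σ) a b ↔ edgeOpen σ a b := by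
  unfold op edgeOpen openE ext adj
  constructor
  · rintro ⟨h1, h2⟩
    have h1' : sym2dist1 s(a, b) = 1 := h1
    rw [dif_pos h1'] at h2
    exact ⟨h1', h2⟩
  · rintro ⟨h1, h2⟩
    exact ⟨h1, by rw [dif_pos h1]; exact h2⟩

lemma measurable_ext : Measurable (ext : Config d → Sym2 (V d) → Bool) := by
  refine measurable_pi_iff.2 fun e => ?_
  unfold ext
  by_cases h : sym2dist1 e = 1
  · simp only [h, dif_pos]; exact measurable_pi_apply _
  · simp only [h, dif_neg, not_false_iff]; exact measurable_const

lemma transfer (F : BernoulliFamily d) (p : unitInterval) {A : Set (Sym2 (V d) → Bool)}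
    (hA : MeasurableSet A) (hi : ∀ ω ω' : Sym2 (V d) → Bool, op ω = op ω' → ω ∈ A → ω' ∈ A) :
    F.P p (ext ⁻¹' A) = ENNReal.ofReal (Pq p A) := by
  have h := Pr_comap (p := fun _ : Sym2 (V d) => p) (κ := Edge d) (f := Subtype.val)
    Subtype.val_injective (measurable_ext hA)
  have hop : ∀ ω : Sym2 (V d) → Bool, op (ext (fun k : Edge d => ω k.1)) = op ω := by
    intro ω
    funext a b
    refine propext (op_ext.trans ?_)
    exact ⟨fun h => ⟨h.1, h.2⟩, fun h => ⟨h.1, h.2⟩⟩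
  have e : {ω : Sym2 (V d) → Bool | (fun k : Edge d => ω k.1) ∈ ext ⁻¹' A} = A := by
    ext ω
    exact ⟨fun h => hi _ _ (hop ω) h, fun h => hi _ _ (hop ω).symm h⟩
  rw [e] at h
  unfold Pq
  rw [h, family_eq]
  unfold Pr
  rw [ofReal_measureReal]

lemma path_conn {σ : Config d} {n : ℕ} {f : ℕ → V d} (h : IsOpenPath σ n f) :
    conn (op (ext σ)) Set.univ (f 0) (f n) := by
  induction n with
  | zero => exact conn.refl
  | succ n ih =>
    exact (ih fun i hi => h i (by omega)).trans
      (conn.single (op_ext.2 (h n (by omega))) trivial trivial)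

lemma conn_of_connected {σ : Config d} {x y : V d} (h : chemDist σ x y ≠ ⊤) :
    conn (op (ext σ)) Set.univ x y := by
  by_contra hcon
  apply h
  unfold chemDist
  rw [sInf_eq_top]
  rintro r ⟨n, f, h1, rfl, rfl, -⟩
  exact absurd (path_conn h1) hcon

lemma chemDist_le {σ : Config d} {n : ℕ} {f : ℕ → V d} (h : ∀ i < n, op (ext σ) (f i) (f (i + 1))) :
    chemDist σ (f 0) (f n) ≤ n :=
  sInf_le ⟨n, f, fun i hi => op_ext.1 (h i hi), rfl, rfl, rfl⟩

lemma hitE_inv (D X T : Set (V d)) (ω ω' : Sym2 (V d) → Bool) (h : op ω = op ω')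
    (hω : ω ∈ hitE D X T) : ω' ∈ hitE D X T := by
  unfold hitE at *
  simp only [Set.mem_ofPred_eq] at *
  rw [← h]; exact hω

lemma perc_of_theta (F : BernoulliFamily d) (q : unitInterval)
    (h : 0 < F.P q {ω | InInfiniteCluster ω 0}) : perc d q := by
  have := F.prob q
  refine ⟨(F.P q {ω | InInfiniteCluster ω 0}).toReal, ENNReal.toReal_pos h.ne' (measure_ne_top _ _), ?_⟩
  intro n
  unfold aa
  refine ENNReal.toReal_le_of_le_ofReal Pr_nonneg ?_
  rw [← transfer F q ((hitE_dep _ _ _).meas (ED_finite (bx_finite _ _))) (hitE_inv _ _ _)]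
  refine measure_mono ?_
  intro σ hσ
  have hσ : (cluster σ 0).Infinite := hσ
  obtain ⟨y, hy, hyb⟩ := hσ.exists_notMem_finite (bx_finite (0 : V d) n)
  obtain ⟨v, hv, hc⟩ := (conn_of_connected hy).sphere (m := n) (fun a b h => h.1)
    (self_mem_bx (by positivity)) (fun h => hyb (bx_mono (by linarith) h))
  exact ⟨0, self_mem_bx (by simp), v, hv, hc.mono_set Set.inter_subset_right⟩

lemma theta_one (hd : 0 < d) (F : BernoulliFamily d) :
    0 < F.P (1 : ℝ) {ω | InInfiniteCluster ω 0} := by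
  have hP := F.prob (1 : unitInterval)
  have e1 : ((1 : unitInterval) : ℝ) = 1 := rfl
  have hcount : Countable (Edge d) := by unfold Edge; infer_instance
  have hall : ∀ᵐ ω ∂(F.P (1 : unitInterval)), ∀ e : Edge d, ω e = true := by
    rw [ae_all_iff]
    intro e
    rw [family_eq, ae_iff]
    have h := Pr_false (p := fun _ : Edge d => (1 : unitInterval)) e
    simp only [Set.Icc.coe_one, sub_self] at h
    have h2 : {ω : Config d | ¬ ω e = true} = {ω | ω e = false} := by ext ω; simp
    rw [h2]
    exact (measureReal_eq_zero_iff).1 h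
  have hsub : ∀ᵐ ω ∂(F.P (1 : unitInterval)), InInfiniteCluster ω 0 := by
    filter_upwards [hall] with ω hω
    let g : ℕ → V d := fun n => Pi.single ⟨0, hd⟩ (n : ℤ)
    refine Set.infinite_of_injective_forall_mem (f := g) ?_ ?_
    · intro a b hab
      have := congrFun hab ⟨0, hd⟩
      simpa [g] using this
    · intro n
      have hpath : ∀ i < n, op (ext ω) (g i) (g (i + 1)) := by
        intro i _
        refine op_ext.2 ?_
        have ha : adj (g i) (g (i + 1)) := by
          refine adj_iff.2 ⟨⟨0, hd⟩, by simp [g], fun j hj => by simp [g, hj]⟩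
        exact ⟨ha, hω _⟩
      have h := chemDist_le hpath
      have g0 : g 0 = 0 := by simp [g]
      rw [g0] at h
      exact ne_top_of_le_ne_top (ENNReal.natCast_ne_top n) h
  rw [← e1]
  have : F.P (1 : unitInterval) {ω | InInfiniteCluster ω 0} = 1 := by
    have := measure_congr (μ := F.P (1 : unitInterval)) (s := {ω | InInfiniteCluster ω 0}) (t := Set.univ)
      (eventuallyEq_univ.2 hsub)
    rw [this, measure_univ]
  rw [this]
  exact one_pos

end transfer

/-- **Uniform Antal–Pisztora estimate.**
Let `p₀ > p_c(d)`. There are `β(p₀) > 0`, `Â(p₀) > 0` and `B̂(p₀) > 0` such that for all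
`p ≥ p₀` and all `x ∈ ℤ^d`,
`ℙ(β‖x‖₁ ≤ D^{𝒞'_p}(0, x) < ∞) ≤ Â exp(-B̂ ‖x‖₁)`. -/
theorem statement_10 (d : ℕ) (hd : 2 ≤ d) (F : BernoulliFamily d)
    (p₀ : ℝ) (hp₀ : pc F < p₀) (hp₀1 : p₀ ≤ 1) :
    ∃ β Ahat Bhat : ℝ, 0 < β ∧ 0 < Ahat ∧ 0 < Bhat ∧
      ∀ p, p₀ ≤ p → p ≤ 1 → ∀ x : V d,
        F.P p {ω : Config d |
            ENNReal.ofReal (β * norm1 x) ≤ chemDist ω 0 x ∧ chemDist ω 0 x ≠ ⊤}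
          ≤ ENNReal.ofReal (Ahat * Real.exp (-(Bhat * norm1 x))) := by
  classical
  have hne : ({p : ℝ | 0 ≤ p ∧ p ≤ 1 ∧ 0 < F.P p {ω | InInfiniteCluster ω 0}}).Nonempty :=
    ⟨1, zero_le_one, le_rfl, theta_one (by omega) F⟩
  obtain ⟨q, ⟨hq0, hq1, hq⟩, hqp⟩ := exists_lt_of_csInf_lt hne hp₀
  set q0 : unitInterval := ⟨q, hq0, hq1⟩ with hq0d
  have hperc : perc d q0 := perc_of_theta F q0 hq
  set pu : unitInterval := ⟨p₀, hq0.trans hqp.le, hp₀1⟩ with hpu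
  have hlt : q0 < pu := hqp
  set η : ℝ := 1 / (2 * 2 ^ (kap d * 2)) with hη
  have hηpos : 0 < η := by positivity
  have hη1 : η ≤ 1 := by
    rw [hη, div_le_one (by positivity)]
    have : (1 : ℝ) ≤ 2 ^ (kap d * 2) := one_le_pow₀ (by norm_num)
    linarith
  have hη2 : (2 : ℝ) ^ (kap d * 4) * η ^ 2 = 1 / 4 := by
    rw [hη]
    have e : (2 : ℝ) ^ (kap d * 4) = (2 ^ (kap d * 2)) ^ 2 := by rw [← pow_mul]; congr 1; ring
    rw [e]
    field_simp
    norm_num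
  obtain ⟨M, hM⟩ := good_scales hd hlt hperc (ε := η ^ (11 ^ d)) (by positivity)
  refine ⟨((4 * (kap d * (8 * M + 1) ^ d) + 1 : ℕ) : ℝ), 1, 1, by positivity, one_pos, one_pos, ?_⟩
  intro p hp hp1 x
  set pp : unitInterval := ⟨p, (hq0.trans hqp.le).trans hp, hp1⟩ with hpp
  have hprob := F.prob pp
  change F.P pp _ ≤ _
  unfold norm1
  rcases Nat.eq_zero_or_pos (dist1 x 0) with hL | hL
  · rw [hL]
    refine prob_le_one.trans ?_
    simp
  obtain ⟨N, hN, hNM, hbad⟩ := hM pp hp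
  obtain ⟨A, hAm, hAp, hAi, hA⟩ := main_est hN hηpos.le hη1 hbad.le (x := x) rfl hL
  have hsub : {ω : Config d | ENNReal.ofReal (((4 * (kap d * (8 * M + 1) ^ d) + 1 : ℕ) : ℝ) * (dist1 x 0 : ℝ))
      ≤ chemDist ω 0 x ∧ chemDist ω 0 x ≠ ⊤} ⊆ ext ⁻¹' A := by
    rintro ω ⟨h1, h2⟩
    by_contra hcon
    obtain ⟨n, f, hn, hf0, hfn, hf⟩ := hA (ext ω) (conn_of_connected h2) hcon
    have h3 := chemDist_le hf
    rw [hf0, hfn] at h3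
    have h4 := h1.trans h3
    rw [← Nat.cast_mul, ENNReal.ofReal_natCast, Nat.cast_le] at h4
    have h5 : (8 * N + 1) ^ d ≤ (8 * M + 1) ^ d := Nat.pow_le_pow_left (by omega) d
    have h6 : kap d * (8 * N + 1) ^ d ≤ kap d * (8 * M + 1) ^ d := Nat.mul_le_mul_left _ h5
    have h7 := Nat.mul_le_mul_left (4 * dist1 x 0) h6
    nlinarith
  refine (measure_mono hsub).trans ?_
  rw [transfer F pp hAm hAi]
  refine ENNReal.ofReal_le_ofReal (hAp.trans ?_)
  rw [hη2, one_mul, one_mul]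
  have e : Real.exp (-(dist1 x 0 : ℝ)) = Real.exp (-1) ^ (dist1 x 0) := by
    rw [← Real.exp_nat_mul]; congr 1; ring
  rw [e]
  refine pow_le_pow_left₀ (by norm_num) ?_ _
  rw [Real.exp_neg, one_div]
  exact inv_anti₀ (Real.exp_pos 1) (by linarith [Real.exp_one_lt_d9])

end Perco
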